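/- Let k ≥ 1 and n ∈ ℕ with 2n ≥ (k/2)² + 3, let N ∈ ℕ and v_0 ∈ ℤ^{2n} with gcd(v_0, N) = 1. Fix bounded intervals (a_{ij}, b_{ij}) ⊆ ℝ for 1 ≤ i < j ≤ k, and let g ∈ SL_{2n}(ℝ). Then there exist constants C > 0 and T_0 > 0 depending on g, n, k, N and the intervals such that for all T ≥ T_0, | ∫_{SL_{2n}(ℝ)/Γ_{2n}(N)} S_{(v_0,N)}(χ_{E_{g,T}}) dμ_N − (1/N^{2nk}) · vol_{2nk}(E_{g,T}) | ≤ C · T^{2n(k−1) − (k−1)(k−2)}, where S_{(v_0,N)}(χ_{E_{g,T}}) is the rank-k congruence Siegel transform of the characteristic function of E_{g,T} and vol_{2nk} is Lebesgue measure on (ℝ^{2n})^k. -/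

import Mathlib

open Matrix MeasureTheory

noncomputable section

instance (m : ℕ) : MeasurableSpace (Matrix (Fin m) (Fin m) ℝ) := MeasurableSpace.pi

noncomputable instance (m : ℕ) : TopologicalSpace (Matrix.SpecialLinearGroup (Fin m) ℝ) :=
  instTopologicalSpaceSubtype

instance (m : ℕ) : MeasurableSpace (Matrix.SpecialLinearGroup (Fin m) ℝ) :=
  Subtype.instMeasurableSpace

abbrev SLR (m : ℕ) := Matrix.SpecialLinearGroup (Fin m) ℝ

/-- `SL_m(ℤ)`, viewed as a subgroup of `SL_m(ℝ)`. -/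
def SLZ (m : ℕ) : Subgroup (SLR m) :=
  (Matrix.SpecialLinearGroup.map (n := Fin m) (Int.castRingHom ℝ)).range

/-- The space `X_m = SL_m(ℝ)/SL_m(ℤ)`. -/
abbrev Xspace (m : ℕ) := SLR m ⧸ SLZ m

/-- Jordan measurability: bounded with null topological boundary. -/
def JordanMeasurable {k d : ℕ} (S : Set (Fin k → Fin d → ℝ)) : Prop :=
  Bornology.IsBounded S ∧ volume (frontier S) = 0

/-- `vol_r`, with the convention `vol_0 = 1`. -/
def jvol (d r : ℕ) (S : Set (Fin r → Fin d → ℝ)) : ℝ :=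
  if r = 0 then 1 else (volume S).toReal

/-- The principal congruence subgroup `Γ_m(N) = {γ ∈ SL_m(ℤ) : γ ≡ I mod N}`, viewed as a
subgroup of `SL_m(ℝ)` (as the image of the kernel of reduction mod `N`). -/
def GammaN (m N : ℕ) : Subgroup (SLR m) :=
  Subgroup.map (Matrix.SpecialLinearGroup.map (n := Fin m) (Int.castRingHom ℝ))
    (MonoidHom.ker (Matrix.SpecialLinearGroup.map (n := Fin m) (Int.castRingHom (ZMod N))))

/-- The space `SL_m(ℝ)/Γ_m(N)`. -/
abbrev XspaceN (m N : ℕ) := SLR m ⧸ GammaN m N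

abbrev Pairs (k : ℕ) := {p : Fin k × Fin k // p.1 < p.2}

/-- The standard symplectic matrix `J_n` with block form `(0 Iₙ; -Iₙ 0)`. -/
def Jmat (n : ℕ) : Matrix (Fin (2*n)) (Fin (2*n)) ℝ :=
  fun i j => if (i : ℕ) + n = (j : ℕ) then 1 else if (j : ℕ) + n = (i : ℕ) then -1 else 0

/-- The standard symplectic form `⟨v,w⟩ = vᵀ Jₙ w` on `ℝ^{2n}`. -/
def symp (n : ℕ) (v w : Fin (2*n) → ℝ) : ℝ := v ⬝ᵥ (Jmat n).mulVec w

/-- Euclidean norm on `ℝ^d` (presented as `Fin d → ℝ`). -/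
def enorm2 {d : ℕ} (v : Fin d → ℝ) : ℝ := Real.sqrt (∑ i, (v i)^2)

/-- The set `E_{g,T}` of tuples `(v_1,…,v_k)` with `⟨v_i,v_j⟩ ∈ (a_{ij},b_{ij})` for
`i < j` and `‖g v_ℓ‖ < T`. -/
def EgT (n k : ℕ) (g : SLR (2*n)) (a b : Pairs k → ℝ) (T : ℝ) :
    Set (Fin k → Fin (2*n) → ℝ) :=
  {v | (∀ p : Pairs k, symp n (v p.1.1) (v p.1.2) ∈ Set.Ioo (a p) (b p)) ∧
       ∀ l, enorm2 ((g : Matrix (Fin (2*n)) (Fin (2*n)) ℝ).mulVec (v l)) < T}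

open scoped ENNReal

theorem meas_entry {d : ℕ} (i j : Fin d) : Measurable (fun h : SLR d => h i j) := by
  have h1 : Measurable (fun h : SLR d => h.1) := measurable_subtype_coe
  exact (measurable_pi_apply j).comp ((measurable_pi_apply i).comp h1)

theorem meas_SLR_iff {d : ℕ} {α : Type*} [MeasurableSpace α] (f : α → SLR d)
    (hf : ∀ i j, Measurable (fun a => f a i j)) : Measurable f := by
  apply Measurable.subtype_mk (h := fun a => (f a).2) 
  exact measurable_pi_lambda _ (fun i => measurable_pi_lambda _ (fun j => hf i j))

theorem meas_mul_right {d : ℕ} (g : SLR d) : Measurable (fun h : SLR d => h * g) := by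
  apply meas_SLR_iff
  intro i j
  simp only [Matrix.SpecialLinearGroup.coe_mul, Matrix.mul_apply]
  exact Finset.measurable_sum _ (fun k _ => (meas_entry i k).mul_const _)

theorem meas_mul_left {d : ℕ} (g : SLR d) : Measurable (fun h : SLR d => g * h) := by
  apply meas_SLR_iff
  intro i j
  simp only [Matrix.SpecialLinearGroup.coe_mul, Matrix.mul_apply]
  exact Finset.measurable_sum _ (fun k _ => (meas_entry k j).const_mul _)

theorem meas_det {α : Type*} [MeasurableSpace α] {r : ℕ} (f : α → Matrix (Fin r) (Fin r) ℝ)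
    (hf : ∀ i j, Measurable (fun a => f a i j)) : Measurable (fun a => (f a).det) := by
  simp only [Matrix.det_apply]
  refine Finset.measurable_sum _ (fun σ _ => ?_)
  refine Measurable.const_smul ?_ _
  exact Finset.measurable_prod _ (fun i _ => hf _ _)

theorem meas_inv_entry {d : ℕ} (i j : Fin d) : Measurable (fun h : SLR d => (h⁻¹) i j) := by
  have : (fun h : SLR d => (h⁻¹) i j) = fun h : SLR d => ((h : Matrix (Fin d) (Fin d) ℝ).updateRow j (Pi.single i 1)).det := by
    ext h
    rw [← Matrix.adjugate_apply]; rfl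
  rw [this]
  apply meas_det
  intro a b
  by_cases hb : a = j
  · subst hb; simp
  · simp only [Matrix.updateRow_ne hb]; exact meas_entry a b

theorem gamma_int {d N : ℕ} (γ : SLR d) (hγ : γ ∈ GammaN d N) :
    ∃ z : SpecialLinearGroup (Fin d) ℤ, (∀ i j, γ i j = (z i j : ℝ)) ∧
      (∀ i j, (N : ℤ) ∣ z i j - (1 : Matrix (Fin d) (Fin d) ℤ) i j) := by
  obtain ⟨z, hz, rfl⟩ := hγ
  refine ⟨z, fun i j => rfl, fun i j => ?_⟩
  have h1 : Matrix.SpecialLinearGroup.map (Int.castRingHom (ZMod N)) z = 1 := hz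
  have h2 : ((z i j : ℤ) : ZMod N) = (((1 : Matrix (Fin d) (Fin d) ℤ) i j : ℤ) : ZMod N) := by
    have := congrArg (fun g : SpecialLinearGroup (Fin d) (ZMod N) => g i j) h1
    simp only [Matrix.SpecialLinearGroup.map_apply_coe, RingHom.mapMatrix_apply, Matrix.map_apply] at this
    rw [show ((z i j : ℤ) : ZMod N) = (Int.castRingHom (ZMod N)) (z i j) from rfl, this]
    simp only [Matrix.SpecialLinearGroup.coe_one, Matrix.one_apply]
    split_ifs <;> simp
  have h3 := (ZMod.intCast_eq_intCast_iff_dvd_sub _ _ _).1 h2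
  have := (dvd_neg.2 h3)
  rwa [neg_sub] at this

instance gamma_countable (d N : ℕ) : Countable (GammaN d N) := by
  have hc0 : Countable (Matrix (Fin d) (Fin d) ℤ) := inferInstanceAs (Countable (Fin d → Fin d → ℤ))
  have hc : Countable (SpecialLinearGroup (Fin d) ℤ) := Subtype.countable
  have : Set.Countable (GammaN d N : Set (SLR d)) := by
    unfold GammaN
    rw [Subgroup.coe_map]
    exact (Set.to_countable _).image _
  exact this.to_subtype

def boxB (d : ℕ) (p : ℕ × (Fin d → Fin d → ℤ)) : Set (SLR d) :=
  {h | (∀ i j, |(h⁻¹) i j| ≤ p.1) ∧ ∀ i j, ⌊h i j * (2 * (d+1) * (p.1+1))⌋ = p.2 i j}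

theorem boxB_meas (d : ℕ) (p) : MeasurableSet (boxB d p) := by
  unfold boxB
  have h1 : ∀ i j : Fin d, MeasurableSet {h : SLR d | |(h⁻¹) i j| ≤ p.1} := fun i j =>
    measurableSet_le ((meas_inv_entry i j).abs) measurable_const
  have h2 : ∀ i j : Fin d, MeasurableSet
      {h : SLR d | ⌊h i j * (2 * (d+1) * (p.1+1))⌋ = p.2 i j} := fun i j =>
    (((meas_entry i j).mul_const _).floor) (measurableSet_singleton _)
  simp only [Set.ofPred_and, Set.ofPred_forall]
  exact (MeasurableSet.iInter fun i => MeasurableSet.iInter fun j => h1 i j).inter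
    (MeasurableSet.iInter fun i => MeasurableSet.iInter fun j => h2 i j)

theorem boxB_cover (d : ℕ) (h : SLR d) : ∃ p, h ∈ boxB d p := by
  obtain ⟨m, hm⟩ := exists_nat_ge (∑ i, ∑ j, |(h⁻¹) i j|)
  refine ⟨(m, fun i j => ⌊h i j * (2 * (d+1) * (m+1))⌋), ⟨fun i j => ?_, fun i j => rfl⟩⟩
  refine le_trans ?_ hm
  refine le_trans ?_ (Finset.single_le_sum (f := fun i => ∑ j, |(h⁻¹) i j|)
    (fun i _ => Finset.sum_nonneg (fun j _ => abs_nonneg _)) (Finset.mem_univ i))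
  exact Finset.single_le_sum (f := fun j => |(h⁻¹) i j|) (fun j _ => abs_nonneg _) (Finset.mem_univ j)

theorem boxB_inj (d N : ℕ) (p) (h γ : SLR d) (hγ : γ ∈ GammaN d N) (h1 : h ∈ boxB d p)
    (h2 : h * γ ∈ boxB d p) : γ = 1 := by
  obtain ⟨z, hz, -⟩ := gamma_int γ hγ
  have e1 : ∀ i j, |(h * γ) i j - h i j| * (2 * (d+1) * (p.1+1)) < 1 := by
    intro i j
    have a1 := Int.abs_sub_lt_one_of_floor_eq_floor ((h2.2 i j).trans (h1.2 i j).symm)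
    rw [← sub_mul, abs_mul, abs_of_nonneg (a := (2 * ((d:ℝ)+1) * (p.1+1))) (by positivity)] at a1
    exact a1
  have e2 : ∀ i j, ((γ : Matrix (Fin d) (Fin d) ℝ) - 1) i j = ∑ k, (h⁻¹) i k * ((h * γ) k j - h k j) := by
    intro i j
    have : (γ : Matrix (Fin d) (Fin d) ℝ) - 1 = ((h⁻¹ : SLR d) : Matrix (Fin d) (Fin d) ℝ) * (((h * γ : SLR d) : Matrix (Fin d) (Fin d) ℝ) - h) := by
      rw [mul_sub, ← Matrix.SpecialLinearGroup.coe_mul, ← Matrix.SpecialLinearGroup.coe_mul, inv_mul_cancel_left,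
        inv_mul_cancel, Matrix.SpecialLinearGroup.coe_one]
    rw [this, Matrix.mul_apply]; rfl
  have e3 : ∀ i j, |((γ : Matrix (Fin d) (Fin d) ℝ) - 1) i j| < 1 := by
    intro i j
    rw [e2]
    have hp : (0:ℝ) < (2 * (d+1) * (p.1+1)) := by positivity
    calc |∑ k, (h⁻¹) i k * ((h * γ) k j - h k j)| 
        ≤ ∑ k, |(h⁻¹) i k * ((h * γ) k j - h k j)| := Finset.abs_sum_le_sum_abs _ _
      _ ≤ ∑ k : Fin d, (p.1:ℝ) * (1 / (2 * ((d:ℝ)+1) * ((p.1:ℝ)+1))) := by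
          refine Finset.sum_le_sum fun k _ => ?_
          rw [abs_mul]
          refine mul_le_mul (h1.1 i k) ?_ (abs_nonneg _) (by positivity)
          rw [le_div_iff₀ hp]; exact (e1 k j).le
      _ = d * p.1 / (2 * (d+1) * (p.1+1)) := by
          rw [Finset.sum_const, Finset.card_univ, Fintype.card_fin, nsmul_eq_mul]; ring
      _ < 1 := by
          rw [div_lt_one hp]
          have : (0:ℝ) ≤ d := by positivity
          have : (0:ℝ) ≤ p.1 := by positivity
          nlinarith
  apply Subtype.ext
  ext i j
  have := e3 i j
  rw [Matrix.sub_apply, hz] at this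
  have h4 : ((1 : Matrix (Fin d) (Fin d) ℝ) i j) = (((1 : Matrix (Fin d) (Fin d) ℤ) i j : ℤ) : ℝ) := by
    simp only [Matrix.one_apply]; split_ifs <;> simp
  rw [h4, ← Int.cast_sub, ← Int.cast_abs] at this
  have h5 : |z i j - (1 : Matrix (Fin d) (Fin d) ℤ) i j| < 1 := by exact_mod_cast this
  rw [hz, Matrix.SpecialLinearGroup.coe_one, h4]
  have := Int.abs_lt_one_iff.1 h5
  congr 1; linarith

theorem exists_section (d N : ℕ) : ∃ s : XspaceN d N → SLR d, Measurable s ∧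
    ∀ x, (QuotientGroup.mk (s x) : XspaceN d N) = x := by
  classical
  obtain ⟨e, he⟩ := exists_surjective_nat (ℕ × (Fin d → Fin d → ℤ))
  let hit : ℕ → SLR d → Prop := fun i h => ∃ γ : GammaN d N, h * γ.1 ∈ boxB d (e i)
  have hitm : ∀ i, MeasurableSet {h | hit i h} := by
    intro i
    have : {h | hit i h} = ⋃ γ : GammaN d N, (fun h => h * γ.1) ⁻¹' boxB d (e i) := by
      ext h; simp [hit]
    rw [this]
    exact MeasurableSet.iUnion fun γ => meas_mul_right _ (boxB_meas _ _)
  let D : Set (SLR d) := {h | ∃ i, h ∈ boxB d (e i) ∧ ∀ j < i, ¬ hit j h}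
  have Dm : MeasurableSet D := by
    have : D = ⋃ i, (boxB d (e i) ∩ ⋂ j, ⋂ (_ : j < i), {h | hit j h}ᶜ) := by
      ext h; simp [D]
    rw [this]
    exact MeasurableSet.iUnion fun i => (boxB_meas _ _).inter
      (MeasurableSet.iInter fun j => MeasurableSet.iInter fun _ => (hitm j).compl)
  have hit_mul : ∀ i h (γ : GammaN d N), hit i (h * γ.1) → hit i h := by
    rintro i h γ ⟨δ, hδ⟩
    exact ⟨γ * δ, by simpa [mul_assoc] using hδ⟩
  have Dex : ∀ h, ∃ γ : GammaN d N, h * γ.1 ∈ D := by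
    intro h
    have hex : ∃ i, hit i h := by
      obtain ⟨p, hp⟩ := boxB_cover d h
      obtain ⟨i, rfl⟩ := he p
      exact ⟨i, 1, by simpa using hp⟩
    obtain ⟨γ, hγ⟩ := Nat.find_spec hex
    exact ⟨γ, Nat.find hex, hγ, fun j hj hh => Nat.find_min hex hj (hit_mul _ _ _ hh)⟩
  have hit_mul' : ∀ i h (γ : GammaN d N), hit i h → hit i (h * γ.1) := by
    intro i h γ hh
    apply hit_mul i (h * γ.1) γ⁻¹
    simpa using hh
  have Duniq : ∀ h ∈ D, ∀ γ : GammaN d N, h * γ.1 ∈ D → h * γ.1 = h := by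
    rintro h ⟨i, hi, hi'⟩ γ ⟨j, hj, hj'⟩
    have : i = j := by
      rcases lt_trichotomy i j with hij | hij | hij
      · exact absurd (hit_mul' i h γ ⟨1, by simpa using hi⟩) (hj' i hij)
      · exact hij
      · exact absurd (hit_mul j h γ ⟨1, by simpa using hj⟩) (hi' j hij)
    subst this
    rw [boxB_inj d N _ h γ.1 γ.2 hi hj, mul_one]
  have hs : ∀ x : XspaceN d N, ∃ h ∈ D, (QuotientGroup.mk h : XspaceN d N) = x := by
    intro x
    obtain ⟨h, rfl⟩ := QuotientGroup.mk_surjective x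
    obtain ⟨γ, hγ⟩ := Dex h
    exact ⟨_, hγ, by rw [QuotientGroup.mk_mul_of_mem h γ.2]⟩
  choose s hsD hsx using hs
  refine ⟨s, ?_, hsx⟩
  have : Measurable (s ∘ (QuotientGroup.mk : SLR d → XspaceN d N)) := by
    intro B hB
    have : (s ∘ (QuotientGroup.mk : SLR d → XspaceN d N)) ⁻¹' B =
        ⋃ γ : GammaN d N, (fun h => h * γ.1) ⁻¹' (D ∩ B) := by
      ext h
      simp only [Set.mem_preimage, Function.comp, Set.mem_iUnion, Set.mem_inter_iff]
      have h1 : ∃ γ : GammaN d N, h * γ.1 = s (QuotientGroup.mk h) := by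
        have := QuotientGroup.eq.1 (hsx (QuotientGroup.mk h)).symm
        exact ⟨⟨_, this⟩, by simp⟩
      obtain ⟨γ, hγ⟩ := h1
      constructor
      · intro hB
        exact ⟨γ, hγ ▸ hsD _, hγ ▸ hB⟩
      · rintro ⟨δ, hδ, hδB⟩
        have := Duniq _ (hsD (QuotientGroup.mk h)) (γ⁻¹ * δ) (by simpa [← hγ] using hδ)
        rw [← this, ← hγ]
        simpa using hδB
    rw [this]
    exact MeasurableSet.iUnion fun γ => meas_mul_right _ (Dm.inter hB)
  exact measurable_from_quotient.2 this

def act {d r : ℕ} (h : SLR d) (x : Fin r → Fin d → ℝ) : Fin r → Fin d → ℝ :=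
  fun l => (h : Matrix (Fin d) (Fin d) ℝ).mulVec (x l)

def castv {d r : ℕ} (v : Fin r → Fin d → ℤ) : Fin r → Fin d → ℝ := fun l j => (v l j : ℝ)

theorem act_apply {d r : ℕ} (h : SLR d) (x : Fin r → Fin d → ℝ) (l j) :
    act h x l j = ∑ i, h j i * x l i := rfl

theorem act_mul {d r : ℕ} (g h : SLR d) (x : Fin r → Fin d → ℝ) :
    act (g * h) x = act g (act h x) := by
  funext l
  simp only [act, Matrix.SpecialLinearGroup.coe_mul, Matrix.mulVec_mulVec]

theorem meas_act_left {d r : ℕ} (x : Fin r → Fin d → ℝ) : Measurable (fun h : SLR d => act h x) := by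
  refine measurable_pi_lambda _ fun l => measurable_pi_lambda _ fun j => ?_
  simp only [act_apply]
  exact Finset.measurable_sum _ fun i _ => (meas_entry j i).mul_const _

theorem meas_coord {d r : ℕ} (l : Fin r) (j : Fin d) :
    Measurable (fun x : Fin r → Fin d → ℝ => x l j) :=
  (measurable_pi_apply j).comp (measurable_pi_apply l)

theorem meas_act_right {d r : ℕ} (h : SLR d) :
    Measurable (fun x : Fin r → Fin d → ℝ => act h x) := by
  refine measurable_pi_lambda _ fun l => measurable_pi_lambda _ fun j => ?_
  simp only [act_apply]
  exact Finset.measurable_sum _ fun i _ =>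
    (meas_coord l i).const_mul _

def nu {d r : ℕ} (m : Measure (SLR d)) (O : Set (Fin r → Fin d → ℤ)) :
    Measure (Fin r → Fin d → ℝ) :=
  Measure.sum (fun v : O => m.map (fun h => act h (castv v.1)))

instance nu_sfinite {d r : ℕ} (m : Measure (SLR d)) [SFinite m] (O : Set (Fin r → Fin d → ℤ)) :
    SFinite (nu m O) := by unfold nu; infer_instance

theorem lintegral_nu {d r : ℕ} (m : Measure (SLR d)) (O : Set (Fin r → Fin d → ℤ))
    (F : (Fin r → Fin d → ℝ) → ℝ≥0∞) (hF : Measurable F) :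
    ∫⁻ x, F x ∂(nu m O) = ∫⁻ h, ∑' v : O, F (act h (castv v.1)) ∂m := by
  unfold nu
  rw [lintegral_sum_measure, lintegral_tsum]
  · refine tsum_congr fun v => ?_
    rw [lintegral_map hF (meas_act_left _)]
  · exact fun v => (hF.comp (meas_act_left _)).aemeasurable

def GInv {d r : ℕ} (ν : Measure (Fin r → Fin d → ℝ)) : Prop :=
  ∀ g : SLR d, ∀ F : (Fin r → Fin d → ℝ) → ℝ≥0∞, Measurable F →
    ∫⁻ x, F (act g x) ∂ν = ∫⁻ x, F x ∂ν

def StableN {d r : ℕ} (N : ℕ) (O : Set (Fin r → Fin d → ℤ)) : Prop :=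
  ∀ z : SpecialLinearGroup (Fin d) ℤ,
    (∀ i j, (N : ℤ) ∣ z i j - (1 : Matrix (Fin d) (Fin d) ℤ) i j) →
    ∀ v, v ∈ O → (fun l => (z : Matrix (Fin d) (Fin d) ℤ).mulVec (v l)) ∈ O

theorem act_cast {d r : ℕ} (γ : SLR d) (z : SpecialLinearGroup (Fin d) ℤ)
    (hz : ∀ i j, γ i j = (z i j : ℝ)) (v : Fin r → Fin d → ℤ) :
    act γ (castv v) = castv (fun l => (z : Matrix (Fin d) (Fin d) ℤ).mulVec (v l)) := by
  funext l j
  rw [act_apply]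
  simp [castv, hz, Matrix.mulVec, dotProduct]

theorem castv_inj {d r : ℕ} : Function.Injective (castv : (Fin r → Fin d → ℤ) → _) := by
  intro v w h
  funext l j
  have := congrFun (congrFun h l) j
  simpa [castv] using this

theorem act_inj {d r : ℕ} (g : SLR d) :
    Function.Injective (act g : (Fin r → Fin d → ℝ) → _) := by
  intro x y h
  have := congrArg (act g⁻¹) h
  rwa [← act_mul, ← act_mul, inv_mul_cancel, show ∀ x : Fin r → Fin d → ℝ, act 1 x = x from
    fun x => by funext l; simp [act], show ∀ x : Fin r → Fin d → ℝ, act 1 x = x from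
    fun x => by funext l; simp [act]] at this

theorem Phi_inv {d r N : ℕ} (O : Set (Fin r → Fin d → ℤ)) (hO : StableN N O)
    (F : (Fin r → Fin d → ℝ) → ℝ≥0∞) (h γ : SLR d) (hγ : γ ∈ GammaN d N) :
    ∑' v : O, F (act (h * γ) (castv v.1)) = ∑' v : O, F (act h (castv v.1)) := by
  obtain ⟨z, hz, hzN⟩ := gamma_int γ hγ
  obtain ⟨z', hz', hzN'⟩ := gamma_int γ⁻¹ (inv_mem hγ)
  let f : O → O := fun v => ⟨_, hO z hzN v.1 v.2⟩
  have hf : Function.Bijective f := by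
    constructor
    · intro v w hvw
      have h1 := congrArg (fun v : O => castv v.1) hvw
      simp only [f] at h1
      rw [← act_cast γ z hz, ← act_cast γ z hz] at h1
      exact Subtype.ext (castv_inj (act_inj _ h1))
    · intro w
      refine ⟨⟨_, hO z' hzN' w.1 w.2⟩, ?_⟩
      apply Subtype.ext
      apply castv_inj
      simp only [f]
      rw [← act_cast γ z hz, ← act_cast _ z' hz', ← act_mul, mul_inv_cancel]
      funext l; simp [act]
  rw [← (Equiv.ofBijective f hf).tsum_eq (fun v : O => F (act h (castv v.1)))]
  refine tsum_congr fun v => ?_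
  simp only [Equiv.ofBijective_apply, f]
  rw [← act_cast γ z hz, act_mul]

theorem nu_GInv {d r N : ℕ} (μ : Measure (XspaceN d N))
    (hμ : ∀ γ : SLR d, Measure.map (fun x => γ • x) μ = μ)
    (s : XspaceN d N → SLR d) (hs : Measurable s)
    (hs' : ∀ x, (QuotientGroup.mk (s x) : XspaceN d N) = x)
    (O : Set (Fin r → Fin d → ℤ)) (hO : StableN N O) : GInv (nu (μ.map s) O) := by
  intro g F hF
  have hFm : ∀ F : (Fin r → Fin d → ℝ) → ℝ≥0∞, Measurable F →
      Measurable fun h => ∑' v : O, F (act h (castv v.1)) := fun F hF =>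
    Measurable.tsum fun v => hF.comp (meas_act_left _)
  have hFg : Measurable fun x : Fin r → Fin d → ℝ => F (act g x) := hF.comp (meas_act_right g)
  rw [lintegral_nu _ _ _ hFg, lintegral_nu _ _ _ hF, lintegral_map (hFm _ hFg) hs, lintegral_map (hFm _ hF) hs]
  have hsm : Measurable (fun x : XspaceN d N => g • x) := by
    refine measurable_from_quotient.2 ?_
    exact (measurable_quotient_mk'' (s := QuotientGroup.leftRel (GammaN d N))).comp (meas_mul_left g)
  conv_rhs => rw [← hμ g]
  have hFs : Measurable fun x : XspaceN d N => ∑' v : O, F (act (s x) (castv v.1)) :=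
    (hFm _ hF).comp hs
  rw [lintegral_map hFs hsm]
  refine lintegral_congr fun x => ?_
  have h1 : (QuotientGroup.mk (s (g • x)) : XspaceN d N) = QuotientGroup.mk (g * s x) := by
    rw [hs']
    conv_lhs => rw [← hs' x]
    rfl
  have h2 := QuotientGroup.eq.1 h1
  have h3 := Phi_inv O hO F (s (g • x)) _ h2
  rw [← h3]
  refine tsum_congr fun v => ?_
  rw [mul_inv_cancel_left, act_mul]

/-- minor matrix -/
def mnr {d r : ℕ} (x : Fin r → Fin d → ℝ) (I : Fin r → Fin d) : Matrix (Fin r) (Fin r) ℝ :=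
  fun m l => x l (I m)

theorem meas_mnr {d r : ℕ} (I : Fin r → Fin d) :
    Measurable fun x : Fin r → Fin d → ℝ => (mnr x I).det :=
  meas_det _ fun i j => meas_coord j (I i)

def addRow {d r : ℕ} (i : Fin d) (u : Fin r → ℝ) (x : Fin r → Fin d → ℝ) : Fin r → Fin d → ℝ :=
  fun l j => if j = i then x l j + u l else x l j

def setRow {d r : ℕ} (i : Fin d) (u : Fin r → ℝ) (x : Fin r → Fin d → ℝ) : Fin r → Fin d → ℝ :=
  fun l j => if j = i then u l else x l j

theorem rowAdd_exists {d : ℕ} (i : Fin d) (w : Fin d → ℝ) (hw : w i = 0) (r : ℕ) :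
    ∃ g : SLR d, ∀ x : Fin r → Fin d → ℝ, act g x = addRow i (fun l => w ⬝ᵥ x l) x := by
  refine ⟨⟨1 + Matrix.replicateCol Unit (Pi.single i (1:ℝ)) * Matrix.replicateRow Unit w, ?_⟩, ?_⟩
  · rw [Matrix.det_one_add_replicateCol_mul_replicateRow]; simp [hw]
  · intro x
    funext l j
    change ∑ q, (1 + Matrix.replicateCol Unit (Pi.single i (1:ℝ)) * Matrix.replicateRow Unit w :
      Matrix (Fin d) (Fin d) ℝ) j q * x l q = _
    simp only [Matrix.add_apply, Matrix.mul_apply, Matrix.replicateCol_apply,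
      Matrix.replicateRow_apply, Finset.univ_unique, Finset.sum_singleton, add_mul,
      Finset.sum_add_distrib, Matrix.one_apply, ite_mul, one_mul, zero_mul, Finset.sum_ite_eq,
      Finset.mem_univ, if_true, addRow, dotProduct, Pi.single_apply]
    split_ifs with h <;> simp

theorem mnr_update {d r : ℕ} (I : Fin r → Fin d) (p : Fin r) (j : Fin d) (y : Fin r → Fin d → ℝ) :
    mnr y (Function.update I p j) = (mnr y I).updateRow p (fun l => y l j) := by
  ext m l
  by_cases hm : m = p
  · subst hm; simp [mnr]
  · simp [mnr, hm]

theorem generic_null {d r : ℕ} (hrd : r < d) (ν : Measure (Fin r → Fin d → ℝ)) [SFinite ν]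
    (hν : GInv ν) (hgen : ∀ᵐ x ∂ν, ∃ I : Fin r → Fin d, (mnr x I).det ≠ 0) (i : Fin d) :
    ∀ᵐ x ∂ν, ∃ I : Fin r → Fin d, (∀ m, I m ≠ i) ∧ (mnr x I).det ≠ 0 := by
  classical
  have key : ∀ I : Fin r → Fin d, ν {x | (mnr x I).det ≠ 0 ∧
      ∀ I' : Fin r → Fin d, (∀ m, I' m ≠ i) → (mnr x I').det = 0} = 0 := by
    intro I
    set Z := {x : Fin r → Fin d → ℝ | (mnr x I).det ≠ 0 ∧
      ∀ I' : Fin r → Fin d, (∀ m, I' m ≠ i) → (mnr x I').det = 0} with hZ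
    have Zm : MeasurableSet Z := by
      have : Z = {x | (mnr x I).det ≠ 0} ∩ ⋂ I' : Fin r → Fin d, ⋂ (_ : ∀ m, I' m ≠ i),
          {x | (mnr x I').det = 0} := by
        ext x; simp [hZ]
      rw [this]
      refine MeasurableSet.inter ?_ (MeasurableSet.iInter fun I' => MeasurableSet.iInter fun _ => ?_)
      · exact (meas_mnr I) (measurableSet_singleton (0:ℝ)).compl
      · exact (meas_mnr I') (measurableSet_singleton (0:ℝ))
    by_cases hI : ∀ m, I m ≠ i
    · have : Z = ∅ := by
        ext x; simp only [hZ, Set.mem_ofPred_eq, Set.mem_empty_iff_false, iff_false, not_and]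
        exact fun h1 h2 => h1 (h2 I hI)
      rw [this]; simp
    push Not at hI
    obtain ⟨p, hp⟩ := hI
    by_cases hinj : Function.Injective I
    swap
    · have : Z = ∅ := by
        ext x; simp only [hZ, Set.mem_ofPred_eq, Set.mem_empty_iff_false, iff_false, not_and]
        intro h1
        exfalso; apply h1
        rw [Function.Injective] at hinj; push Not at hinj
        obtain ⟨a, b, hab, hne⟩ := hinj
        exact Matrix.det_zero_of_row_eq hne (by ext l; simp [mnr, hab])
      rw [this]; simp
    obtain ⟨j, hj⟩ : ∃ j, ∀ m, I m ≠ j := by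
      by_contra hcon
      push Not at hcon
      have := Fintype.card_le_of_surjective I hcon
      simp at this; omega
    have hji : i ≠ j := hp ▸ hj p
    have hI' : ∀ m, Function.update I p j m ≠ i := by
      intro m
      by_cases hm : m = p
      · subst hm; simp [hji.symm]
      · rw [Function.update_of_ne hm]; intro h; exact hm (hinj (h.trans hp.symm))
    let w : ℝ → Fin d → ℝ := fun c => Pi.single i c
    have hw : ∀ c, w c j = 0 := fun c => by simp [w, hji.symm]
    have hdot : ∀ c (y : Fin r → Fin d → ℝ) l, w c ⬝ᵥ y l = c * y l i := by
      intro c y l; simp [w]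
    choose g hg using fun c => rowAdd_exists j (w c) (hw c) r
    have hdet : ∀ c (y : Fin r → Fin d → ℝ),
        (mnr (act (g c) y) (Function.update I p j)).det =
          (mnr y (Function.update I p j)).det + c * (mnr y I).det := by
      intro c y
      have e1 : mnr (act (g c) y) I = mnr y I := by
        ext m l; simp [mnr, hg, addRow, hj m]
      rw [mnr_update, mnr_update, e1]
      have e2 : (fun l => act (g c) y l j) = (fun l => y l j) + c • (fun l => y l i) := by
        ext l; simp [hg, addRow, hdot]
      rw [e2, Matrix.det_updateRow_add, Matrix.det_updateRow_smul]
      congr 3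
      rw [← mnr_update, ← hp, Function.update_eq_self]
    have hmeas : ∀ c, ν ((act (g c)) ⁻¹' Z) = ν Z := by
      intro c
      have := hν (g c) (Z.indicator 1) (measurable_one.indicator Zm)
      rw [lintegral_indicator_one Zm] at this
      rw [← this, ← lintegral_indicator_one (meas_act_right _ Zm)]
      rfl
    by_contra hne
    have hpos : 0 < ν Z := pos_iff_ne_zero.2 hne
    have hcount := Measure.countable_meas_pos_of_disjoint_iUnion (μ := ν)
      (As := fun c : ℝ => (act (g c)) ⁻¹' Z) (fun c => meas_act_right _ Zm) (by
        intro c c' hcc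
        rw [Function.onFun, Set.disjoint_left]
        intro x hx hx'
        have a1 := hx.2 _ hI'
        have a2 := hx'.2 _ hI'
        rw [hdet] at a1 a2
        have a3 : (mnr x I).det ≠ 0 := by
          have e1 : mnr (act (g c) x) I = mnr x I := by
            ext m l; simp [mnr, hg, addRow, hj m]
          rw [← e1]; exact hx.1
        have : (c - c') * (mnr x I).det = 0 := by linarith
        rcases mul_eq_zero.1 this with h | h
        · exact hcc (sub_eq_zero.1 h)
        · exact a3 h)
    have : {c : ℝ | 0 < ν ((act (g c)) ⁻¹' Z)} = Set.univ := by
      ext c; simp only [Set.mem_ofPred_eq, hmeas, hpos, Set.mem_univ]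
    rw [this] at hcount
    exact Cardinal.not_countable_real hcount
  have key2 : ∀ᵐ x ∂ν, ∀ I : Fin r → Fin d, ¬ ((mnr x I).det ≠ 0 ∧
      ∀ I' : Fin r → Fin d, (∀ m, I' m ≠ i) → (mnr x I').det = 0) := by
    rw [ae_all_iff]
    intro I
    rw [ae_iff]; simpa only [not_not] using key I
  filter_upwards [key2, hgen] with x h1 ⟨I, hI⟩
  by_contra hcon
  push Not at hcon
  exact h1 I ⟨hI, hcon⟩

theorem meas_addRow {d r : ℕ} (i : Fin d) :
    Measurable fun p : (Fin r → Fin d → ℝ) × (Fin r → ℝ) => addRow i p.2 p.1 := by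
  refine measurable_pi_lambda _ fun l => measurable_pi_lambda _ fun j => ?_
  unfold addRow
  have h1 : Measurable fun p : (Fin r → Fin d → ℝ) × (Fin r → ℝ) => p.1 l j :=
    (meas_coord l j).comp measurable_fst
  have h2 : Measurable fun p : (Fin r → Fin d → ℝ) × (Fin r → ℝ) => p.2 l :=
    (measurable_pi_apply l).comp measurable_snd
  by_cases h : j = i
  · simp only [h, if_true]; subst h; exact h1.add h2
  · simpa only [h, if_false] using h1

theorem meas_setRow {d r : ℕ} (i : Fin d) :
    Measurable fun p : (Fin r → Fin d → ℝ) × (Fin r → ℝ) => setRow i p.2 p.1 := by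
  refine measurable_pi_lambda _ fun l => measurable_pi_lambda _ fun j => ?_
  unfold setRow
  have h1 : Measurable fun p : (Fin r → Fin d → ℝ) × (Fin r → ℝ) => p.1 l j :=
    (meas_coord l j).comp measurable_fst
  have h2 : Measurable fun p : (Fin r → Fin d → ℝ) × (Fin r → ℝ) => p.2 l :=
    (measurable_pi_apply l).comp measurable_snd
  by_cases h : j = i
  · simpa only [h, if_true] using h2
  · simpa only [h, if_false] using h1

/-- linear change of variables for lintegral -/
theorem lint_lin {r : ℕ} (M : Matrix (Fin r) (Fin r) ℝ) (hM : M.det ≠ 0)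
    (f : (Fin r → ℝ) → ℝ≥0∞) (hf : Measurable f) :
    ∫⁻ c, f (M.mulVec c) * ENNReal.ofReal |M.det| = ∫⁻ u, f u := by
  have h1 := Real.map_matrix_volume_pi_eq_smul_volume_pi hM
  have hm : Measurable (Matrix.toLin' M) := (Matrix.toLin' M).continuous_of_finiteDimensional.measurable
  have h2 : ∫⁻ c, f (M.mulVec c) = ENNReal.ofReal |M.det⁻¹| * ∫⁻ u, f u := by
    have := lintegral_map (μ := volume) hf hm
    rw [h1, lintegral_smul_measure] at this
    simpa using this.symm
  rw [lintegral_mul_const' _ _ ENNReal.ofReal_ne_top, h2, mul_comm, ← mul_assoc,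
    ← ENNReal.ofReal_mul (abs_nonneg _), ← abs_mul, mul_inv_cancel₀ hM]
  simp

theorem row_disint {d r : ℕ} (ν : Measure (Fin r → Fin d → ℝ)) [SFinite ν]
    (hν : GInv ν) (i : Fin d) (J : Fin r → Fin d) (hJ : ∀ m, J m ≠ i)
    (w : (Fin r → Fin d → ℝ) → ℝ≥0∞) (hw : Measurable w)
    (hwi : ∀ u x, w (addRow i u x) = w x) (hw0 : ∀ x, (mnr x J).det = 0 → w x = 0)
    (h : (Fin r → ℝ) → ℝ≥0∞) (hh : Measurable h) (hh1 : ∫⁻ u, h u = 1)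
    (G : (Fin r → Fin d → ℝ) → ℝ≥0∞) (hG : Measurable G) :
    ∫⁻ x, w x * G x ∂ν = ∫⁻ x, w x * (h (fun l => x l i) * ∫⁻ u, G (setRow i u x)) ∂ν := by
  classical
  have mrow : Measurable fun x : Fin r → Fin d → ℝ => fun l => x l i :=
    measurable_pi_lambda _ fun l => meas_coord l i
  -- linear combination vector
  let W : (Fin r → ℝ) → Fin d → ℝ := fun c j => ∑ m, if J m = j then c m else 0
  have hW : ∀ c, W c i = 0 := fun c => Finset.sum_eq_zero fun m _ => by simp [hJ m]
  have hdot : ∀ c (x : Fin r → Fin d → ℝ), (fun l => W c ⬝ᵥ x l) = (mnr x J)ᵀ.mulVec c := by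
    intro c x; funext l
    simp only [W, dotProduct, Matrix.mulVec, Matrix.transpose_apply, mnr, Finset.sum_mul]
    rw [Finset.sum_comm]
    refine Finset.sum_congr rfl fun m _ => ?_
    simp [mul_comm]
  choose g hg using fun c => rowAdd_exists i (W c) (hW c) r
  have hg' : ∀ c (x : Fin r → Fin d → ℝ), act (g c) x = addRow i ((mnr x J)ᵀ.mulVec c) x := by
    intro c x; rw [hg, hdot]
  have hinv : ∀ u (x : Fin r → Fin d → ℝ), mnr (addRow i u x) J = mnr x J := by
    intro u x; ext m l; simp [mnr, addRow, hJ m]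
  have mD : Measurable fun x : Fin r → Fin d → ℝ => ENNReal.ofReal |(mnr x J).det| :=
    (meas_mnr J).abs.ennreal_ofReal
  have mMul : Measurable fun p : (Fin r → Fin d → ℝ) × (Fin r → ℝ) => (mnr p.1 J)ᵀ.mulVec p.2 := by
    refine measurable_pi_lambda _ fun l => ?_
    simp only [Matrix.mulVec, dotProduct, Matrix.transpose_apply, mnr]
    exact Finset.measurable_sum _ fun m _ => ((meas_coord l (J m)).comp measurable_fst).mul
      ((measurable_pi_apply m).comp measurable_snd)
  have mMulc : ∀ c : Fin r → ℝ, Measurable fun x : Fin r → Fin d → ℝ => (mnr x J)ᵀ.mulVec c :=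
    fun c => mMul.comp (measurable_id.prodMk measurable_const)
  -- step 1
  have s1 : ∀ x, w x * G x = ∫⁻ c, w x * G x *
      (h (fun l => x l i + ((mnr x J)ᵀ.mulVec c) l) * ENNReal.ofReal |(mnr x J).det|) := by
    intro x
    by_cases hx : (mnr x J).det = 0
    · simp [hw0 x hx]
    have hx' : (mnr x J)ᵀ.det ≠ 0 := by rwa [Matrix.det_transpose]
    have m1 : Measurable fun u : Fin r → ℝ => h (fun l => x l i + u l) :=
      hh.comp (measurable_pi_lambda _ fun l => (measurable_pi_apply l).const_add _)
    have e1 := lint_lin _ hx' _ m1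
    rw [Matrix.det_transpose] at e1
    have e2 : ∫⁻ u : Fin r → ℝ, h (fun l => x l i + u l) = 1 := by
      rw [← hh1]
      exact lintegral_add_left_eq_self h (fun l => x l i)
    rw [lintegral_const_mul, e1, e2, mul_one]
    refine (m1.comp (mMul.comp (measurable_const.prodMk measurable_id))).mul_const _
  have s2 : ∫⁻ x, w x * G x ∂ν = ∫⁻ c, ∫⁻ x, w x * G x *
      (h (fun l => x l i + ((mnr x J)ᵀ.mulVec c) l) * ENNReal.ofReal |(mnr x J).det|) ∂ν := by
    rw [lintegral_congr s1, lintegral_lintegral_swap]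
    refine Measurable.aemeasurable ?_
    refine ((hw.comp measurable_fst).mul (hG.comp measurable_fst)).mul (Measurable.mul ?_ (mD.comp measurable_fst))
    exact hh.comp ((mrow.comp measurable_fst).add mMul)
  have s3 : ∀ c : Fin r → ℝ, ∫⁻ x, w x * G x *
      (h (fun l => x l i + ((mnr x J)ᵀ.mulVec c) l) * ENNReal.ofReal |(mnr x J).det|) ∂ν =
      ∫⁻ x, w x * G (addRow i ((mnr x J)ᵀ.mulVec (-c)) x) *
      (h (fun l => x l i) * ENNReal.ofReal |(mnr x J).det|) ∂ν := by
    intro c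
    have mF : Measurable fun x : Fin r → Fin d → ℝ => w x * G x *
      (h (fun l => x l i + ((mnr x J)ᵀ.mulVec c) l) * ENNReal.ofReal |(mnr x J).det|) :=
      (hw.mul hG).mul ((hh.comp (mrow.add (mMulc c))).mul mD)
    rw [← hν (g (-c)) _ mF]
    refine lintegral_congr fun x => ?_
    rw [hg', hwi, hinv]
    congr 3
    funext l
    simp [addRow, Matrix.mulVec_neg]
  have s4 : ∀ x, ∫⁻ c, w x * G (addRow i ((mnr x J)ᵀ.mulVec (-c)) x) *
      (h (fun l => x l i) * ENNReal.ofReal |(mnr x J).det|) =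
      w x * (h (fun l => x l i) * ∫⁻ u, G (setRow i u x)) := by
    intro x
    by_cases hx : (mnr x J).det = 0
    · simp [hw0 x hx]
    have hx' : (mnr x J)ᵀ.det ≠ 0 := by rwa [Matrix.det_transpose]
    have m1 : Measurable fun u : Fin r → ℝ => G (addRow i u x) :=
      hG.comp ((meas_addRow i).comp (measurable_const.prodMk measurable_id))
    have e1 := lint_lin _ hx' _ m1
    rw [Matrix.det_transpose] at e1
    have e0 : ∫⁻ u : Fin r → ℝ, G (addRow i u x) = ∫⁻ u, G (setRow i u x) := by
      rw [← lintegral_add_left_eq_self (fun u => G (setRow i u x)) (fun l => x l i)]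
      refine lintegral_congr fun u => ?_
      congr 1; funext l j; simp only [addRow, setRow, Pi.add_apply]
      split_ifs with hj
      · rw [hj]
      · rfl
    rw [← e0, ← e1]
    rw [← lintegral_neg_eq_self (μ := (volume : Measure (Fin r → ℝ))) (fun c => G (addRow i ((mnr x J)ᵀ.mulVec c) x) * ENNReal.ofReal |(mnr x J).det|)]
    have m2 : Measurable fun c : Fin r → ℝ => G (addRow i ((mnr x J)ᵀ.mulVec (-c)) x) * ENNReal.ofReal |(mnr x J).det| :=
      (m1.comp (mMul.comp (measurable_const.prodMk measurable_neg))).mul_const _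
    rw [← lintegral_const_mul _ m2, ← lintegral_const_mul _ (m2.const_mul _)]
    refine lintegral_congr fun c => ?_
    ring
  rw [s2, lintegral_congr s3, lintegral_lintegral_swap, lintegral_congr s4]
  refine Measurable.aemeasurable ?_
  refine ((hw.comp measurable_snd).mul (hG.comp ?_)).mul ((hh.comp (mrow.comp measurable_snd)).mul (mD.comp measurable_snd))
  exact (meas_addRow i).comp (measurable_snd.prodMk (mMul.comp (measurable_snd.prodMk measurable_fst.neg)))

theorem row_transl {d r : ℕ} (hrd : r < d) (ν : Measure (Fin r → Fin d → ℝ)) [SFinite ν]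
    (hν : GInv ν) (hgen : ∀ᵐ x ∂ν, ∃ I : Fin r → Fin d, (mnr x I).det ≠ 0) (i : Fin d)
    (s : Fin r → ℝ) (G : (Fin r → Fin d → ℝ) → ℝ≥0∞) (hG : Measurable G) :
    ∫⁻ x, G (addRow i s x) ∂ν = ∫⁻ x, G x ∂ν := by
  classical
  have hae := generic_null hrd ν hν hgen i
  let A : Finset (Fin r → Fin d) := Finset.univ.filter fun J => ∀ m, J m ≠ i
  let ind : (Fin r → Fin d) → (Fin r → Fin d → ℝ) → ℝ≥0∞ := fun J x => if (mnr x J).det = 0 then 0 else 1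
  have mind : ∀ J, Measurable (ind J) := fun J =>
    Measurable.ite ((meas_mnr J) (measurableSet_singleton (0:ℝ))) measurable_const measurable_const
  let w : (Fin r → Fin d) → (Fin r → Fin d → ℝ) → ℝ≥0∞ := fun J x => ind J x / ∑ J' ∈ A, ind J' x
  have mw : ∀ J, Measurable (w J) := fun J => (mind J).div (Finset.measurable_sum _ fun J' _ => mind J')
  have hindi : ∀ J ∈ A, ∀ u x, ind J (addRow i u x) = ind J x := by
    intro J hJ u x
    have hJ' : ∀ m, J m ≠ i := (Finset.mem_filter.1 hJ).2
    have : mnr (addRow i u x) J = mnr x J := by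
      ext m l; simp [mnr, addRow, hJ' m]
    simp only [ind, this]
  have hwi : ∀ J ∈ A, ∀ u x, w J (addRow i u x) = w J x := by
    intro J hJ u x
    simp only [w]
    rw [hindi J hJ, Finset.sum_congr rfl fun J' hJ' => hindi J' hJ' u x]
  have hsum : ∀ᵐ x ∂ν, ∑ J ∈ A, w J x = 1 := by
    filter_upwards [hae] with x ⟨I, hI, hI2⟩
    simp only [w, div_eq_mul_inv]
    rw [← Finset.sum_mul]
    refine ENNReal.mul_inv_cancel ?_ ?_
    · intro h0
      have := Finset.sum_eq_zero_iff.1 h0 I (by simp [A]; exact hI)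
      simp [ind, hI2] at this
    · refine (ENNReal.sum_lt_top.2 fun J _ => ?_).ne
      simp only [ind]; split_ifs <;> simp
  have hdec : ∀ G : (Fin r → Fin d → ℝ) → ℝ≥0∞, Measurable G →
      ∫⁻ x, G x ∂ν = ∑ J ∈ A, ∫⁻ x, w J x * G x ∂ν := by
    intro G hG
    have mwG : ∀ J ∈ A, Measurable fun x => w J x * G x := fun J _ => (mw J).mul hG
    rw [← lintegral_finsetSum _ mwG]
    refine lintegral_congr_ae ?_
    filter_upwards [hsum] with x hx
    rw [← Finset.sum_mul, hx, one_mul]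
  let h : (Fin r → ℝ) → ℝ≥0∞ := (Set.Icc 0 1).indicator 1
  have hh : Measurable h := measurable_one.indicator measurableSet_Icc
  have hh1 : ∫⁻ u, h u = 1 := by
    simp only [h]
    rw [lintegral_indicator_one measurableSet_Icc, Real.volume_Icc_pi]; simp
  have mGs : Measurable fun x => G (addRow i s x) :=
    hG.comp ((meas_addRow i).comp (measurable_id.prodMk measurable_const))
  rw [hdec _ mGs, hdec _ hG]
  refine Finset.sum_congr rfl fun J hJ => ?_
  have hJ' : ∀ m, J m ≠ i := (Finset.mem_filter.1 hJ).2
  have hw0 : ∀ x, (mnr x J).det = 0 → w J x = 0 := by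
    intro x hx; simp [w, ind, hx]
  rw [row_disint ν hν i J hJ' (w J) (mw J) (hwi J hJ) hw0 h hh hh1 _ mGs,
    row_disint ν hν i J hJ' (w J) (mw J) (hwi J hJ) hw0 h hh hh1 _ hG]
  refine lintegral_congr fun x => ?_
  congr 2
  rw [← lintegral_add_right_eq_self (fun u => G (setRow i u x)) s]
  refine lintegral_congr fun u => ?_
  congr 1; funext l j; simp only [addRow, setRow, Pi.add_apply]
  split_ifs <;> rfl

theorem nu_unique {d r : ℕ} (hrd : r < d) (ν : Measure (Fin r → Fin d → ℝ)) [SFinite ν]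
    (hν : GInv ν) (hgen : ∀ᵐ x ∂ν, ∃ I : Fin r → Fin d, (mnr x I).det ≠ 0) :
    ∃ c : ℝ≥0∞, ν = c • volume := by
  classical
  have htr : ∀ v : Fin r → Fin d → ℝ, ∀ G : (Fin r → Fin d → ℝ) → ℝ≥0∞, Measurable G →
      ∫⁻ x, G (v + x) ∂ν = ∫⁻ x, G x ∂ν := by
    intro v
    have key : ∀ S : Finset (Fin d), ∀ G : (Fin r → Fin d → ℝ) → ℝ≥0∞, Measurable G →
      ∫⁻ x, G ((fun l j => if j ∈ S then v l j else 0) + x) ∂ν = ∫⁻ x, G x ∂ν := by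
      intro S
      induction S using Finset.induction_on with
      | empty => intro G hG; refine lintegral_congr fun x => ?_; congr 1; funext l j; simp
      | insert i S hi ih =>
        intro G hG
        have m1 : Measurable fun x => G (addRow i (fun l => v l i) x) :=
          hG.comp ((meas_addRow i).comp (measurable_id.prodMk measurable_const))
        rw [← row_transl hrd ν hν hgen i (fun l => v l i) G hG, ← ih _ m1]
        refine lintegral_congr fun x => ?_
        congr 1; funext l j
        simp only [Pi.add_apply, addRow, Finset.mem_insert]
        by_cases hj : j = i
        · subst hj; simp [hi, add_comm]
        · simp [hj]
    intro G hG
    rw [← key Finset.univ G hG]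
    simp
  have hinv : ν.IsAddLeftInvariant := by
    constructor
    intro v
    ext B hB
    rw [Measure.map_apply (measurable_const_add v) hB]
    have := htr v (B.indicator 1) (measurable_one.indicator hB)
    rw [lintegral_indicator_one hB] at this
    rw [← this, ← lintegral_indicator_one (measurable_const_add v hB)]
    rfl
  let Q : Set (Fin r → Fin d → ℝ) := Set.pi Set.univ fun _ => Set.Icc 0 1
  have hQ : MeasurableSet Q := MeasurableSet.univ_pi fun _ => measurableSet_Icc
  have hQ1 : volume Q = 1 := by
    rw [volume_pi_pi]
    simp [Real.volume_Icc_pi]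
  refine ⟨∫⁻ x, Q.indicator 1 (-x) ∂ν, ?_⟩
  ext B hB
  have := measure_add_lintegral_eq ν volume hB (Q.indicator 1) (measurable_one.indicator hQ)
  rw [lintegral_indicator_one hQ, hQ1, mul_one] at this
  rw [this]
  simp only [measure_preimage_add_right]
  have m3 : Measurable fun x : Fin r → Fin d → ℝ => (Q.indicator 1 (-x) : ℝ≥0∞) :=
    (measurable_one.indicator hQ).comp measurable_neg
  rw [lintegral_const_mul _ m3, Measure.smul_apply, smul_eq_mul, mul_comm]

theorem exists_minor_field {K : Type*} [Field K] {r d : ℕ} (v : Fin r → Fin d → K)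
    (hv : LinearIndependent K v) :
    ∃ I : Fin r → Fin d, (Matrix.of fun m l => v l (I m)).det ≠ 0 := by
  let A : Matrix (Fin r) (Fin d) K := Matrix.of v
  have hr : A.rank = r := by
    have := LinearIndependent.rank_matrix (M := A) hv
    simpa using this
  have hspan : Submodule.span K (Set.range A.col) = ⊤ := by
    rw [← Matrix.range_mulVecLin]
    apply Submodule.eq_top_of_finrank_eq
    rw [Module.finrank_fintype_fun_eq_card, Fintype.card_fin]
    exact hr
  obtain ⟨b, hb, hbs, hbl⟩ := exists_linearIndependent K (Set.range A.col)
  let B : Module.Basis b K (Fin r → K) := Module.Basis.mk hbl (by rw [Subtype.range_coe, hbs, hspan])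
  let e : b ≃ Fin r := B.indexEquiv (Pi.basisFun K (Fin r))
  choose I hI using fun m => hb (e.symm m).2
  refine ⟨I, ?_⟩
  have hli : LinearIndependent K (Matrix.of fun m l => v l (I m)).row := by
    have h1 := hbl.comp e.symm e.symm.injective
    have : (Matrix.of fun m l => v l (I m)).row = (Subtype.val ∘ e.symm : Fin r → (Fin r → K)) := by
      funext m
      rw [Function.comp, ← hI m]; rfl
    rw [this]; exact h1
  have := Matrix.linearIndependent_rows_iff_isUnit.1 hli
  rw [Matrix.isUnit_iff_isUnit_det] at this
  exact this.ne_zero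

theorem li_of_minor {R : Type*} [CommRing R] [IsDomain R] {r d : ℕ} (v : Fin r → Fin d → R)
    (I : Fin r → Fin d) (h : (Matrix.of fun m l => v l (I m)).det ≠ 0) : LinearIndependent R v := by
  rw [Fintype.linearIndependent_iff]
  intro g hg
  have : (Matrix.of fun m l => v l (I m)).mulVec g = 0 := by
    funext m
    have := congrFun hg (I m)
    simpa [Matrix.mulVec, dotProduct, mul_comm] using this
  have := Matrix.eq_zero_of_mulVec_eq_zero h this
  exact fun i => congrFun this i

theorem li_Q {r d : ℕ} (v : Fin r → Fin d → ℤ) (hv : LinearIndependent ℤ v) :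
    LinearIndependent ℚ (fun l j => (v l j : ℚ)) := by
  rw [← LinearIndependent.iff_fractionRing ℤ ℚ]
  rw [Fintype.linearIndependent_iff] at hv ⊢
  intro g hg
  apply hv g
  funext j
  have := congrFun hg j
  simp at this
  have h2 : ((∑ i, g i * v i j : ℤ) : ℚ) = 0 := by push_cast; simpa using this
  simpa using (Int.cast_eq_zero.1 h2)

theorem exists_minor_int {r d : ℕ} (v : Fin r → Fin d → ℤ) (hv : LinearIndependent ℤ v) :
    ∃ I : Fin r → Fin d, (Matrix.of fun m l => v l (I m)).det ≠ 0 := by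
  obtain ⟨I, hI⟩ := exists_minor_field _ (li_Q v hv)
  refine ⟨I, fun h => hI ?_⟩
  have := congrArg (Int.cast : ℤ → ℚ) h
  rw [Int.cast_det] at this
  rw [Int.cast_zero] at this
  exact this

theorem li_castv {r d : ℕ} (v : Fin r → Fin d → ℤ) (hv : LinearIndependent ℤ v) :
    LinearIndependent ℝ (castv v) := by
  obtain ⟨I, hI⟩ := exists_minor_int v hv
  refine li_of_minor _ I fun h => hI ?_
  have : (((Matrix.of fun m l => v l (I m)).det : ℤ) : ℝ) = 0 := by
    rw [Int.cast_det]; exact h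
  exact_mod_cast this

theorem li_act {r d : ℕ} (h : SLR d) (x : Fin r → Fin d → ℝ) (hx : LinearIndependent ℝ x) :
    LinearIndependent ℝ (act h x) := by
  have := hx.map' (Matrix.toLin' (h : Matrix (Fin d) (Fin d) ℝ)) (by
    rw [LinearMap.ker_eq_bot]
    intro a b hab
    have h2 : act h (fun _ : Fin 1 => a) = act h (fun _ : Fin 1 => b) := by
      funext l; simpa [act] using hab
    exact congrFun (act_inj h h2) 0)
  exact this

theorem nu_generic {r d : ℕ} (m : Measure (SLR d)) (O : Set (Fin r → Fin d → ℤ))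
    (hO : ∀ v ∈ O, LinearIndependent ℤ v) :
    ∀ᵐ x ∂(nu m O), ∃ I : Fin r → Fin d, (mnr x I).det ≠ 0 := by
  have hms : MeasurableSet {x : Fin r → Fin d → ℝ | ∃ I : Fin r → Fin d, (mnr x I).det ≠ 0} := by
    rw [Set.ofPred_exists]
    exact MeasurableSet.iUnion fun I => (meas_mnr I) (measurableSet_singleton (0:ℝ)).compl
  unfold nu
  rw [Measure.ae_sum_iff' hms]
  intro v
  rw [ae_map_iff (meas_act_left _).aemeasurable hms]
  refine Filter.Eventually.of_forall fun h => ?_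
  exact exists_minor_field _ (li_act h _ (li_castv _ (hO v.1 v.2)))

def Prim {r d : ℕ} (w : Fin r → Fin d → ℤ) : Prop :=
  LinearIndependent ℤ w ∧ ∀ (m : ℤ) (y : Fin d → ℤ), m ≠ 0 →
    m • y ∈ Submodule.span ℤ (Set.range w) → y ∈ Submodule.span ℤ (Set.range w)

theorem ext_prim {r d : ℕ} (w : Fin r → Fin d → ℤ) (hw : Prim w) (x : Fin d → ℤ)
    (hx : x ∉ Submodule.span ℤ (Set.range w)) :
    ∃ (u : Fin d → ℤ) (t : ℕ) (z : Fin r → ℕ), 0 < t ∧ (∀ l, z l < t) ∧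
      x = (t : ℤ) • u + ∑ l, (z l : ℤ) • w l ∧ Prim (Fin.snoc w u : Fin (r+1) → Fin d → ℤ) := by
  classical
  set W := Submodule.span ℤ (Set.range w) with hW
  have htf : Module.IsTorsionFree ℤ ((Fin d → ℤ) ⧸ W) := by
    rw [Module.isTorsionFree_iff_smul_eq_zero]
    intro m q h
    obtain ⟨y, rfl⟩ := W.mkQ_surjective q
    rw [← map_smul, Submodule.mkQ_apply, Submodule.Quotient.mk_eq_zero] at h
    by_cases hm : m = 0
    · exact Or.inl hm
    · right; rw [Submodule.mkQ_apply, Submodule.Quotient.mk_eq_zero]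
      exact hw.2 m y hm h
  have hfree : Module.Free ℤ ((Fin d → ℤ) ⧸ W) := inferInstance
  let b := Module.Free.chooseBasis ℤ ((Fin d → ℤ) ⧸ W)
  have hx0 : W.mkQ x ≠ 0 := by
    rw [Submodule.mkQ_apply, Ne, Submodule.Quotient.mk_eq_zero]; exact hx
  have hne : (Finset.univ : Finset (Module.Free.ChooseBasisIndex ℤ ((Fin d → ℤ) ⧸ W))).Nonempty := by
    by_contra hcon
    rw [Finset.not_nonempty_iff_eq_empty] at hcon
    apply hx0
    rw [← b.sum_repr (W.mkQ x), hcon]; simp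
  obtain ⟨c, hc, hc1⟩ := Finset.extract_gcd (fun i => b.repr (W.mkQ x) i) hne
  set t := Finset.univ.gcd (fun i => b.repr (W.mkQ x) i) with ht
  have ht0 : 0 ≤ t := Int.nonneg_of_normalize_eq_self Finset.normalize_gcd
  have htne : t ≠ 0 := by
    intro h0
    apply hx0
    rw [← b.sum_repr (W.mkQ x)]
    refine Finset.sum_eq_zero fun i _ => ?_
    rw [hc i (Finset.mem_univ i), h0, zero_mul, zero_smul]
  obtain ⟨T, hT⟩ := Int.eq_ofNat_of_zero_le ht0
  have hTpos : 0 < T := by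
    rcases Nat.eq_zero_or_pos T with h | h
    · exfalso; apply htne; rw [hT, h]; rfl
    · exact h
  obtain ⟨u0, hu0⟩ := W.mkQ_surjective (∑ i, c i • b i)
  have hrepr : ∀ i, b.repr (W.mkQ u0) i = c i := by
    intro i; rw [hu0, b.repr_sum_self]
  have hxt : W.mkQ x = t • W.mkQ u0 := by
    rw [hu0, Finset.smul_sum, ← b.sum_repr (W.mkQ x)]
    refine Finset.sum_congr rfl fun i _ => ?_
    rw [hc i (Finset.mem_univ i), smul_smul]
  have hmem : x - t • u0 ∈ W := by
    rw [← Submodule.Quotient.mk_eq_zero, ← Submodule.mkQ_apply, map_sub, map_smul, hxt, sub_self]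
  obtain ⟨y, hy⟩ := (Submodule.mem_span_range_iff_exists_fun ℤ).1 hmem
  set u := u0 + ∑ l, (y l / t) • w l with hu
  have huQ : W.mkQ u = W.mkQ u0 := by
    rw [hu, map_add, add_eq_left, Submodule.mkQ_apply, Submodule.Quotient.mk_eq_zero]
    exact Submodule.sum_mem _ fun l _ => Submodule.smul_mem _ _ (Submodule.subset_span ⟨l, rfl⟩)
  have huW : ∀ a : ℤ, a • u ∈ W → a = 0 := by
    intro a ha
    rw [← Submodule.Quotient.mk_eq_zero, ← Submodule.mkQ_apply, map_smul, huQ] at ha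
    rcases smul_eq_zero.1 ha with h | h
    · exact h
    · exfalso; apply hx0; rw [hxt, h, smul_zero]
  refine ⟨u, T, fun l => (y l % t).toNat, hTpos, fun l => ?_, ?_, ?_, ?_⟩
  · have h1 := Int.emod_nonneg (y l) htne
    have h2 := Int.emod_lt_of_pos (y l) (lt_of_le_of_ne ht0 htne.symm)
    change (y l % t).toNat < T
    omega
  · have e1 : ∀ l, (((y l % t).toNat : ℕ) : ℤ) = y l % t := fun l =>
      Int.toNat_of_nonneg (Int.emod_nonneg _ htne)
    simp only [e1]
    rw [show ((T : ℕ) : ℤ) = t from hT.symm, hu, smul_add, Finset.smul_sum, add_assoc,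
      ← Finset.sum_add_distrib]
    have e2 : ∑ l, (t • (y l / t) • w l + (y l % t) • w l) = ∑ l, y l • w l := by
      refine Finset.sum_congr rfl fun l _ => ?_
      rw [smul_smul, ← add_smul, Int.mul_ediv_add_emod]
    rw [e2, hy]; abel
  · rw [Fintype.linearIndependent_iff]
    intro g hg
    rw [Fin.sum_univ_castSucc] at hg
    simp only [Fin.snoc_castSucc, Fin.snoc_last] at hg
    have hlast : g (Fin.last r) = 0 := by
      apply huW
      have : g (Fin.last r) • u = - ∑ i : Fin r, g i.castSucc • w i := by
        rw [eq_neg_iff_add_eq_zero, add_comm]; exact hg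
      rw [this]
      exact Submodule.neg_mem _ (Submodule.sum_mem _ fun l _ =>
        Submodule.smul_mem _ _ (Submodule.subset_span ⟨l, rfl⟩))
    rw [hlast, zero_smul, add_zero] at hg
    have := Fintype.linearIndependent_iff.1 hw.1 _ hg
    intro i
    refine Fin.lastCases hlast (fun i => this i) i
  · intro m y' hm hmy
    rw [Fin.range_snoc, Submodule.mem_span_insert] at hmy ⊢
    obtain ⟨a, z, hz, hmz⟩ := hmy
    have h1 : m • W.mkQ y' = a • W.mkQ u0 := by
      rw [← map_smul, hmz, map_add, map_smul, huQ, add_eq_left, Submodule.mkQ_apply,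
        Submodule.Quotient.mk_eq_zero]
      exact hz
    have h2 : ∀ i, m ∣ a * c i := by
      intro i
      have := congrArg (fun q => b.repr q i) h1
      simp only [map_smul, Finsupp.smul_apply, hrepr, smul_eq_mul] at this
      exact ⟨_, this.symm⟩
    have h3 : m ∣ a := by
      have : m ∣ Finset.univ.gcd fun i => a * c i := Finset.dvd_gcd fun i _ => h2 i
      rw [Finset.gcd_mul_left, hc1, mul_one] at this
      exact dvd_normalize_iff.1 this
    obtain ⟨a', rfl⟩ := h3
    refine ⟨a', y' - a' • u, ?_, by abel⟩
    apply hw.2 m _ hm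
    rw [smul_sub, hmz, smul_smul]
    simpa using hz

theorem hnf {d : ℕ} : ∀ (r : ℕ) (v : Fin r → Fin d → ℤ), LinearIndependent ℤ v →
    ∃ w : Fin r → Fin d → ℤ, Prim w ∧ ∃ (t : Fin r → ℕ) (D : Fin r → Fin r → ℕ),
      (∀ j, 0 < t j) ∧ (∀ l j, D l j < t j) ∧ (∀ l j, j ≤ l → D l j = 0) ∧
      (∀ j, v j = (t j : ℤ) • w j + ∑ l, (D l j : ℤ) • w l) ∧
      (∀ y ∈ Submodule.span ℤ (Set.range w), ∃ m : ℤ, m ≠ 0 ∧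
        m • y ∈ Submodule.span ℤ (Set.range v)) := by
  intro r
  induction r with
  | zero =>
    intro v hv
    refine ⟨v, ⟨hv, ?_⟩, fun i => i.elim0, fun i => i.elim0, fun i => i.elim0, fun i => i.elim0,
      fun i => i.elim0, fun i => i.elim0, fun y hy => ⟨1, one_ne_zero, by simpa using hy⟩⟩
    intro m y hm h
    simp only [Set.range_eq_empty, Submodule.span_empty, Submodule.mem_bot] at h ⊢
    exact (smul_eq_zero.1 h).resolve_left hm
  | succ r ih =>
    intro v hv
    have hv0 : LinearIndependent ℤ (fun i : Fin r => v i.castSucc) :=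
      hv.comp _ (Fin.castSucc_injective r)
    obtain ⟨w, hw, t, D, ht, hD, hD0, hvw, hsp⟩ := ih _ hv0
    have hx : v (Fin.last r) ∉ Submodule.span ℤ (Set.range w) := by
      intro hx
      obtain ⟨m, hm, hmx⟩ := hsp _ hx
      obtain ⟨c, hc⟩ := (Submodule.mem_span_range_iff_exists_fun ℤ).1 hmx
      rw [Fintype.linearIndependent_iff] at hv
      have := hv (Fin.snoc c (-m)) (by
        rw [Fin.sum_univ_castSucc]
        simp only [Fin.snoc_castSucc, Fin.snoc_last, hc, neg_smul, add_neg_cancel]) (Fin.last r)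
      simp at this; exact hm this
    obtain ⟨u, T, z, hT, hz, hxu, hp⟩ := ext_prim w hw _ hx
    refine ⟨_, hp, Fin.snoc (α := fun _ => ℕ) t T, Fin.snoc (α := fun _ => Fin (r+1) → ℕ)
      (fun l => Fin.snoc (α := fun _ => ℕ) (D l) (z l)) (fun _ => 0), ?_, ?_, ?_, ?_, ?_⟩
    · intro j
      refine Fin.lastCases ?_ (fun j => ?_) j <;> simp [hT, ht]
    · intro l j
      refine Fin.lastCases ?_ (fun j => ?_) j <;> refine Fin.lastCases ?_ (fun l => ?_) l <;>
        simp [hT, ht, hz, hD]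
    · intro l j
      refine Fin.lastCases ?_ (fun j => ?_) j <;> refine Fin.lastCases ?_ (fun l => ?_) l
      · simp
      · intro h; exact absurd h (not_le.2 (Fin.castSucc_lt_last l))
      · simp
      · intro h; simp; exact hD0 l j (by simpa using h)
    · intro j
      rw [Fin.sum_univ_castSucc]
      refine Fin.lastCases ?_ (fun j => ?_) j
      · simp [hxu]
      · simp [hvw]
    · intro y hy
      rw [Fin.range_snoc, Submodule.mem_span_insert] at hy
      obtain ⟨a, y', hy', rfl⟩ := hy
      have h1 : (T : ℤ) • y' - a • ∑ l, (z l : ℤ) • w l ∈ Submodule.span ℤ (Set.range w) :=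
        Submodule.sub_mem _ (Submodule.smul_mem _ _ hy') (Submodule.smul_mem _ _
          (Submodule.sum_mem _ fun l _ => Submodule.smul_mem _ _ (Submodule.subset_span ⟨l, rfl⟩)))
      obtain ⟨m, hm, hmy⟩ := hsp _ h1
      refine ⟨m * T, mul_ne_zero hm (by exact_mod_cast hT.ne'), ?_⟩
      have : (m * T) • (a • u + y') = m • ((T : ℤ) • y' - a • ∑ l, (z l : ℤ) • w l) +
          (m * a) • v (Fin.last r) := by
        rw [hxu]; module
      rw [this]
      refine Submodule.add_mem _ (Submodule.span_mono ?_ hmy) (Submodule.smul_mem _ _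
        (Submodule.subset_span ⟨_, rfl⟩))
      rintro _ ⟨i, rfl⟩; exact ⟨_, rfl⟩

theorem auerbach {k r : ℕ} (c : Fin k → Fin r → ℚ) (ι0 : Fin r → Fin k)
    (h0 : (Matrix.of fun l => c (ι0 l)).det ≠ 0) :
    ∃ ι : Fin r → Fin k, (Matrix.of fun l => c (ι l)).det ≠ 0 ∧
      ∀ i, ∃ q : Fin r → ℚ, (∀ l, |q l| ≤ 1) ∧ c i = ∑ l, q l • c (ι l) := by
  classical
  have : Nonempty (Fin r → Fin k) := ⟨ι0⟩
  obtain ⟨ι, hι⟩ := Finite.exists_max fun ι : Fin r → Fin k => |(Matrix.of fun l => c (ι l)).det|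
  have hdet : (Matrix.of fun l => c (ι l)).det ≠ 0 := by
    intro h
    have := hι ι0
    rw [h, abs_zero] at this
    exact h0 (abs_nonpos_iff.1 this)
  refine ⟨ι, hdet, fun i => ?_⟩
  set M : Matrix (Fin r) (Fin r) ℚ := Matrix.of fun l => c (ι l) with hM
  have hu : IsUnit M.det := hdet.isUnit
  let q := c i ᵥ* M⁻¹
  have hq : c i = ∑ l, q l • c (ι l) := by
    have h1 : q ᵥ* M = c i := by
      simp only [q, Matrix.vecMul_vecMul, Matrix.nonsing_inv_mul M hu, Matrix.vecMul_one]
    rw [← h1]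
    funext j
    simp [Matrix.vecMul, dotProduct, hM]
  refine ⟨q, fun l => ?_, hq⟩
  have h2 : (M.updateRow l (c i)).det = q l * M.det := by
    have := Matrix.det_updateRow_sum M l q
    rw [smul_eq_mul] at this
    rw [← this, hq]; rfl
  have h3 : M.updateRow l (c i) = Matrix.of fun m => c (Function.update ι l i m) := by
    ext m j
    by_cases hm : m = l
    · subst hm; simp
    · simp [hm, hM]
  have h4 := hι (Function.update ι l i)
  simp only [← h3, h2, abs_mul] at h4
  exact le_of_mul_le_mul_right (by simpa using h4) (abs_pos.2 hdet)

def Lset {k r : ℕ} (d : ℕ) (ι : Fin r → Fin k) : Set (Fin k → Fin d → ℤ) :=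
  {v | LinearIndependent ℤ (v ∘ ι) ∧ ∀ i, ∃ q : Fin r → ℚ, (∀ l, |q l| ≤ 1) ∧
    ∀ j, (v i j : ℚ) = ∑ l, q l * (v (ι l) j : ℚ)}

theorem Lset_cover {k d : ℕ} (v : Fin k → Fin d → ℤ) :
    ∃ r, r ≤ k ∧ (¬ LinearIndependent ℤ v → r < k) ∧ ∃ ι : Fin r → Fin k, v ∈ Lset d ι := by
  classical
  let vq : Fin k → Fin d → ℚ := fun l j => (v l j : ℚ)
  obtain ⟨b, hb, hbs, hbl⟩ := exists_linearIndependent ℚ (Set.range vq)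
  have hbf : b.Finite := (Set.finite_range vq).subset hb
  have := hbf.fintype
  let r := Fintype.card b
  let e : Fin r ≃ b := (Fintype.equivFin b).symm
  choose ι0 hι0 using fun l => hb (e l).2
  have hli0 : LinearIndependent ℚ (fun l => vq (ι0 l)) := by
    have h1 := hbl.comp e e.injective
    have : (fun l => vq (ι0 l)) = (Subtype.val ∘ e : Fin r → (Fin d → ℚ)) := by
      funext m; exact hι0 m
    rw [this]; exact h1
  have hspan : Submodule.span ℚ (Set.range fun l => vq (ι0 l)) = Submodule.span ℚ (Set.range vq) := by
    rw [← hbs]; congr 1; ext x; constructor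
    · rintro ⟨l, rfl⟩; simp only [hι0]; exact (e l).2
    · intro hx; exact ⟨e.symm ⟨x, hx⟩, by simp [hι0]⟩
  have hc : ∀ i, ∃ c : Fin r → ℚ, ∑ l, c l • vq (ι0 l) = vq i := by
    intro i
    rw [← Submodule.mem_span_range_iff_exists_fun (R := ℚ) (v := fun l => vq (ι0 l)), hspan]
    exact Submodule.subset_span ⟨i, rfl⟩
  choose c hc using hc
  rw [Fintype.linearIndependent_iff] at hli0
  have hc0 : (Matrix.of fun l => c (ι0 l)) = (1 : Matrix (Fin r) (Fin r) ℚ) := by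
    ext m l
    have h1 : ∑ l, (c (ι0 m) l - (1 : Matrix (Fin r) (Fin r) ℚ) m l) • vq (ι0 l) = 0 := by
      simp only [sub_smul, Finset.sum_sub_distrib, hc]
      simp [Matrix.one_apply]
    have := hli0 _ h1 l
    simp only [Matrix.of_apply]; linarith
  obtain ⟨ι, hdet, hq⟩ := auerbach c ι0 (by rw [hc0]; simp)
  have hli : LinearIndependent ℤ (v ∘ ι) := by
    rw [Fintype.linearIndependent_iff]
    intro g hg
    have h1 : ∑ l, (g l : ℚ) • vq (ι l) = 0 := by
      funext j
      have := congrFun hg j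
      simp only [Finset.sum_apply, Pi.smul_apply, Function.comp, smul_eq_mul, Pi.zero_apply] at this ⊢
      simp only [vq]; exact_mod_cast this
    have h2 : ∑ m, (∑ l, (g l : ℚ) * c (ι l) m) • vq (ι0 m) = 0 := by
      rw [← h1]
      simp only [Finset.sum_smul]
      rw [Finset.sum_comm]
      refine Finset.sum_congr rfl fun l _ => ?_
      rw [← hc (ι l), Finset.smul_sum]
      refine Finset.sum_congr rfl fun m _ => ?_
      rw [smul_smul]
    have h3 := hli0 _ h2
    have h4 : (fun l => (g l : ℚ)) ᵥ* (Matrix.of fun l => c (ι l)) = 0 := by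
      funext m; exact h3 m
    have h5 := Matrix.eq_zero_of_vecMul_eq_zero hdet h4
    intro i
    have := congrFun h5 i
    simpa using this
  have hinj : Function.Injective ι := (hli.injective).of_comp
  have hrk : r ≤ k := by simpa using Fintype.card_le_of_injective ι hinj
  refine ⟨r, hrk, ?_, ι, hli, fun i => ?_⟩
  · intro hnl
    refine lt_of_le_of_ne hrk fun hEq => hnl ?_
    have hbij : Function.Bijective ι := (Fintype.bijective_iff_injective_and_card ι).2 ⟨hinj, by simpa using hEq⟩
    have h6 := hli.comp (Equiv.ofBijective ι hbij).symm (Equiv.injective _)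
    convert h6 using 1
    funext i
    simp only [Function.comp]
    congr 1
    exact ((Equiv.ofBijective ι hbij).apply_symm_apply i).symm
  · obtain ⟨q, hq1, hq2⟩ := hq i
    refine ⟨q, hq1, fun j => ?_⟩
    have h7 : vq i = ∑ l, q l • vq (ι l) := by
      rw [← hc i, hq2]
      simp only [← hc (ι _), Finset.smul_sum, Finset.sum_apply, Pi.smul_apply, Finset.sum_smul]
      rw [Finset.sum_comm]
      refine Finset.sum_congr rfl fun l _ => Finset.sum_congr rfl fun m _ => ?_
      rw [smul_assoc]
    have := congrFun h7 j
    simpa [vq] using this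

theorem code_exists {k r d : ℕ} (ι : Fin r → Fin k) (v : Fin k → Fin d → ℤ) (hv : v ∈ Lset d ι) :
    ∃ w : Fin r → Fin d → ℤ, Prim w ∧ ∃ (t : Fin r → ℕ) (D : Fin r → Fin r → ℕ),
      (∀ j, 0 < t j) ∧ (∀ l j, D l j < t j) ∧ (∀ l j, j ≤ l → D l j = 0) ∧
      (∀ j, v (ι j) = (t j : ℤ) • w j + ∑ l, (D l j : ℤ) • w l) ∧
      ∀ i, ∃ (y : Fin r → ℤ) (q : Fin r → ℚ), (∀ l, |q l| ≤ 1) ∧ v i = ∑ l, y l • w l ∧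
        ∀ j, (y j : ℚ) = t j * q j + ∑ m, D j m * q m := by
  obtain ⟨w, hw, t, D, ht, hD, hD0, hvw, -⟩ := hnf r _ hv.1
  refine ⟨w, hw, t, D, ht, hD, hD0, hvw, fun i => ?_⟩
  obtain ⟨q, hq, hvq⟩ := hv.2 i
  have hvq' : ∀ j, (v i j : ℚ) = ∑ l, (t l * q l + ∑ m, D l m * q m) * (w l j : ℚ) := by
    intro j
    rw [hvq j]
    have : ∀ l, q l * (v (ι l) j : ℚ) = q l * (t l * w l j) + ∑ m, q l * (D m l * (w m j : ℚ)) := by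
      intro l
      have := congrFun (hvw l) j
      simp only [Function.comp] at this
      rw [this]
      simp only [Pi.add_apply, Pi.smul_apply, Finset.sum_apply, smul_eq_mul]
      push_cast
      rw [mul_add, Finset.mul_sum]
    simp only [this, Finset.sum_add_distrib, add_mul, Finset.sum_mul]
    rw [Finset.sum_comm (f := fun l m => q l * (D m l * (w m j : ℚ)))]
    congr 1
    · exact Finset.sum_congr rfl fun l _ => by ring
    · exact Finset.sum_congr rfl fun l _ => Finset.sum_congr rfl fun m _ => by ring
  have hmem : v i ∈ Submodule.span ℤ (Set.range w) := by
    obtain ⟨b, hb⟩ := IsLocalization.exist_integer_multiples_of_finset (nonZeroDivisors ℤ)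
      (Finset.univ.image fun l => (t l * q l + ∑ m, D l m * q m))
    have hb0 : (b : ℤ) ≠ 0 := nonZeroDivisors.ne_zero b.2
    refine hw.2 b _ hb0 ?_
    choose a ha using fun l => hb _ (Finset.mem_image_of_mem _ (Finset.mem_univ l))
    rw [Submodule.mem_span_range_iff_exists_fun]
    refine ⟨a, ?_⟩
    funext j
    have : ((∑ l, a l * w l j : ℤ) : ℚ) = ((b * v i j : ℤ) : ℚ) := by
      push_cast
      rw [hvq' j, Finset.mul_sum]
      refine Finset.sum_congr rfl fun l _ => ?_
      have := ha l
      simp only [eq_intCast, zsmul_eq_mul] at this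
      rw [this]; ring
    have h2 := Int.cast_injective this
    simpa using h2
  obtain ⟨y, hy⟩ := (Submodule.mem_span_range_iff_exists_fun ℤ).1 hmem
  refine ⟨y, q, hq, hy.symm, fun j => ?_⟩
  have hl := li_Q w hw.1
  rw [Fintype.linearIndependent_iff] at hl
  have := hl (fun l => y l - (t l * q l + ∑ m, D l m * q m)) (by
    funext j
    have h1 := hvq' j
    rw [← hy] at h1
    simp only [Finset.sum_apply, Pi.smul_apply, smul_eq_mul] at h1
    push_cast at h1
    simp only [Finset.sum_apply, Pi.smul_apply, smul_eq_mul, sub_mul, Finset.sum_sub_distrib,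
      Pi.zero_apply]
    rw [h1, sub_self]) j
  linarith

theorem code_inj {r : ℕ} (t : Fin r → ℕ) (D : Fin r → Fin r → ℕ) (ht : ∀ j, 0 < t j)
    (hD0 : ∀ l j, j ≤ l → D l j = 0) (y y' : Fin r → ℤ) (q q' : Fin r → ℚ)
    (h : ∀ j, (y j : ℚ) = t j * q j + ∑ m, D j m * q m)
    (h' : ∀ j, (y' j : ℚ) = t j * q' j + ∑ m, D j m * q' m)
    (hmod : ∀ j, y j % (t j : ℤ) = y' j % (t j : ℤ)) (hfl : ∀ j, ⌊q j⌋ = ⌊q' j⌋) : y = y' := by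
  have key : ∀ j, q j = q' j := by
    intro j
    induction j using WellFoundedGT.induction with
    | ind j ih =>
    have e1 : ∑ m, (D j m : ℚ) * q m = ∑ m, (D j m : ℚ) * q' m := by
      refine Finset.sum_congr rfl fun m _ => ?_
      rcases le_or_gt m j with hm | hm
      · simp [hD0 j m hm]
      · rw [ih m hm]
    obtain ⟨a, ha⟩ : (t j : ℤ) ∣ y j - y' j := Int.ModEq.dvd (hmod j).symm
    have ha' : (y j : ℚ) - y' j = t j * a := by exact_mod_cast ha
    have e2 : (t j : ℚ) * (q j - q' j) = t j * a := by
      rw [← ha', h j, h' j, e1]; ring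
    have htq : (t j : ℚ) ≠ 0 := by exact_mod_cast (ht j).ne'
    have e3 : q j - q' j = a := mul_left_cancel₀ htq e2
    have e4 := Int.abs_sub_lt_one_of_floor_eq_floor (hfl j)
    rw [e3] at e4
    have e5 : |a| < 1 := by exact_mod_cast e4
    rw [Int.abs_lt_one_iff.1 e5] at e3
    simpa [sub_eq_zero] using e3
  funext j
  have : (y j : ℚ) = y' j := by
    rw [h j, h' j]; simp only [key]
  exact_mod_cast this

abbrev Code {k r : ℕ} (ι : Fin r → Fin k) : Type :=
  Σ t : Fin r → ℕ, ((Fin r → ∀ j, Fin (t j + 1)) ×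
    ({i // i ∉ Set.range ι} → ∀ j, Fin (t j + 1) × Fin 3))

def Dm {k r : ℕ} {ι : Fin r → Fin k} (c : Code ι) : Matrix (Fin r) (Fin r) ℕ :=
  fun l j => if l = j then c.1 j + 1 else if l < j then (c.2.1 l j : ℕ) else 0

theorem code_map {k r d : ℕ} (ι : Fin r → Fin k) :
    ∃ φ : Lset d ι → Code ι × {w : Fin r → Fin d → ℤ // Prim w}, Function.Injective φ ∧
      ∀ v j, v.1 (ι j) = ∑ l, (Dm (φ v).1 l j : ℤ) • (φ v).2.1 l := by
  classical
  choose w hw t D ht hD hD0 hvw y q hq hvy hyq using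
    fun v : Lset d ι => code_exists ι v.1 v.2
  have hfl : ∀ v i j, 0 ≤ ⌊q v i j⌋ + 1 ∧ ⌊q v i j⌋ + 1 < 3 := by
    intro v i j
    have := abs_le.1 (hq v i j)
    constructor
    · have : -1 ≤ ⌊q v i j⌋ := Int.le_floor.2 (by push_cast; exact this.1)
      omega
    · have : ⌊q v i j⌋ < 2 := Int.floor_lt.2 (by push_cast; linarith [this.2])
      omega
  have ht1 : ∀ v j, t v j - 1 + 1 = t v j := fun v j => Nat.sub_add_cancel (ht v j)
  let φ : Lset d ι → Code ι × {w : Fin r → Fin d → ℤ // Prim w} := fun v =>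
    (⟨fun j => t v j - 1, (fun l j => ⟨D v l j, by rw [ht1]; exact hD v l j⟩,
      fun i j => (⟨(y v i.1 j % (t v j : ℤ)).toNat, by
        rw [ht1]
        have h1 := Int.emod_nonneg (y v i.1 j) (b := (t v j : ℤ)) (by exact_mod_cast (ht v j).ne')
        have h2 := Int.emod_lt_of_pos (y v i.1 j) (b := (t v j : ℤ)) (by exact_mod_cast (ht v j))
        omega⟩, ⟨(⌊q v i.1 j⌋ + 1).toNat, by have := hfl v i.1 j; omega⟩))⟩, ⟨w v, hw v⟩)
  have hcomb : ∀ v j, v.1 (ι j) = ∑ l, (Dm (φ v).1 l j : ℤ) • (φ v).2.1 l := by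
    intro v j
    rw [hvw v j]
    have h1 : ∀ l, (Dm (φ v).1 l j : ℤ) = (if l = j then (t v j : ℤ) else 0) + D v l j := by
      intro l
      simp only [Dm, φ, ht1]
      rcases lt_trichotomy l j with h | h | h
      · simp [h, h.ne]
      · simp [h, hD0 v j j le_rfl]
      · simp [h.ne', not_lt.2 h.le, hD0 v l j h.le]
    simp only [h1, add_smul, Finset.sum_add_distrib, ite_smul, zero_smul, Finset.sum_ite_eq',
      Finset.mem_univ, if_true]
    rfl
  refine ⟨φ, ?_, hcomb⟩
  intro v v' h
  apply Subtype.ext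
  funext i
  by_cases hi : i ∈ Set.range ι
  · obtain ⟨j, rfl⟩ := hi
    rw [hcomb, hcomb, h]
  have hww : w v = w v' := congrArg (fun p => p.2.1) h
  have htt : t v = t v' := by
    funext j
    have : (φ v).1.1 j = (φ v').1.1 j := by rw [h]
    simp only [φ] at this
    have h1 := ht1 v j; have h2 := ht1 v' j; omega
  have gen : ∀ (a b : Code ι), a = b → ∀ l j, (a.2.1 l j : ℕ) = b.2.1 l j := by
    rintro a b rfl l j; rfl
  have gen2 : ∀ (a b : Code ι), a = b → ∀ i j, ((a.2.2 i j).1 : ℕ) = (b.2.2 i j).1 ∧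
      ((a.2.2 i j).2 : ℕ) = (b.2.2 i j).2 := by
    rintro a b rfl l j; exact ⟨rfl, rfl⟩
  have h1 : (φ v).1 = (φ v').1 := by rw [h]
  have hDD : D v = D v' := by
    funext l j; exact gen _ _ h1 l j
  have hy2 := fun j => gen2 _ _ h1 ⟨i, hi⟩ j
  rw [hvy v i, hvy v' i, hww]
  have : y v i = y v' i := by
    refine code_inj (t v) (D v) (ht v) (hD0 v) _ _ (q v i) (q v' i) (hyq v i) ?_ ?_ ?_
    · rw [htt, hDD]; exact hyq v' i
    · intro j
      have := (hy2 j).1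
      simp only [φ] at this
      have a1 := Int.emod_nonneg (y v i j) (b := (t v j : ℤ)) (by exact_mod_cast (ht v j).ne')
      have a2 := Int.emod_nonneg (y v' i j) (b := (t v' j : ℤ)) (by exact_mod_cast (ht v' j).ne')
      rw [htt] at *
      omega
    · intro j
      have := (hy2 j).2
      simp only [φ] at this
      have a1 := hfl v i j
      have a2 := hfl v' i j
      omega
  rw [this]

/-- triangular combination map and its volume -/
def comb {r d : ℕ} (A : Matrix (Fin r) (Fin r) ℝ) (x : Fin r → Fin d → ℝ) : Fin r → Fin d → ℝ :=
  fun j i => ∑ l, A l j * x l i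

theorem vol_comb {r d : ℕ} (A : Matrix (Fin r) (Fin r) ℝ) (hA : A.det ≠ 0)
    (B : Set (Fin r → Fin d → ℝ)) :
    volume (comb A ⁻¹' B) = ENNReal.ofReal |(A.det ^ d)⁻¹| * volume B := by
  let f : (Fin r → Fin d → ℝ) →ₗ[ℝ] (Fin r → Fin d → ℝ) :=
    { toFun := comb A
      map_add' := by
        intro x y; funext j i; simp [comb, mul_add, Finset.sum_add_distrib]
      map_smul' := by
        intro c x; funext j i; simp only [comb, Pi.smul_apply, smul_eq_mul, Finset.mul_sum, RingHom.id_apply]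
        exact Finset.sum_congr rfl fun l _ => by ring }
  have hdet : LinearMap.det f = A.det ^ d := by
    let e : (Fin r → Fin d → ℝ) ≃ₗ[ℝ] (Fin r × Fin d → ℝ) := (LinearEquiv.curry ℝ ℝ (Fin r) (Fin d)).symm
    have h1 : (e : (Fin r → Fin d → ℝ) →ₗ[ℝ] _) ∘ₗ f ∘ₗ (e.symm : _ →ₗ[ℝ] (Fin r → Fin d → ℝ)) =
        Matrix.toLin' (Matrix.kroneckerMap (· * ·) Aᵀ (1 : Matrix (Fin d) (Fin d) ℝ)) := by
      refine LinearMap.ext fun x => ?_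
      funext p
      rw [Matrix.toLin'_apply]
      change ∑ l, A l p.1 * x (l, p.2) = _
      simp only [Matrix.mulVec, dotProduct, Fintype.sum_prod_type, Matrix.kroneckerMap_apply,
        Matrix.transpose_apply, Matrix.one_apply]
      simp
    have h2 := LinearMap.det_conj f e
    rw [← h2, h1, LinearMap.det_toLin', Matrix.det_kronecker]
    simp
  have := Measure.addHaar_preimage_linearMap (volume : Measure (Fin r → Fin d → ℝ)) (f := f)
    (by rw [hdet]; exact pow_ne_zero _ hA) B
  rw [hdet] at this
  exact this

theorem prim_stable {d r N : ℕ} : StableN N {w : Fin r → Fin d → ℤ | Prim w} := by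
  intro z _ w hw
  let e : (Fin d → ℤ) ≃ₗ[ℤ] (Fin d → ℤ) := Matrix.SpecialLinearGroup.toLin' z
  have he : (fun l => (z : Matrix (Fin d) (Fin d) ℤ).mulVec (w l)) = e ∘ w := by
    funext l
    rfl
  change Prim _
  rw [he]
  have hs : Submodule.span ℤ (Set.range (e ∘ w)) =
      (Submodule.span ℤ (Set.range w)).map (e : (Fin d → ℤ) →ₗ[ℤ] (Fin d → ℤ)) := by
    rw [Submodule.map_span, Set.range_comp]; rfl
  refine ⟨hw.1.map' (e : (Fin d → ℤ) →ₗ[ℤ] (Fin d → ℤ)) e.ker, fun m y hm hy => ?_⟩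
  rw [hs] at hy ⊢
  obtain ⟨x, hx, hxy⟩ := hy
  refine ⟨e.symm y, hw.2 m _ hm ?_, by simp⟩
  have : x = m • e.symm y := by
    apply e.injective
    rw [map_smul]
    simpa using hxy
  rwa [← this]

theorem tsum_le_inj {α β : Type*} (f : α → ℝ≥0∞) (g : β → ℝ≥0∞) (e : Function.support f → β)
    (he : Function.Injective e) (h : ∀ a, f a.1 ≤ g (e a)) : ∑' a, f a ≤ ∑' b, g b := by
  rw [← tsum_subtype_support f]
  exact (ENNReal.tsum_le_tsum h).trans (ENNReal.tsum_comp_le_tsum_of_injective he g)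

def bx (d r : ℕ) (R : ℝ) : Set (Fin r → Fin d → ℝ) := {x | ∀ l j, |x l j| < R}

theorem bx_open (d r : ℕ) (R : ℝ) : IsOpen (bx d r R) := by
  have : bx d r R = ⋂ l, ⋂ j, {x | |x l j| < R} := by ext; simp [bx]
  rw [this]
  exact isOpen_iInter_of_finite fun l => isOpen_iInter_of_finite fun j =>
    isOpen_lt (by fun_prop) continuous_const

theorem bx_eq (d r : ℕ) (R : ℝ) : bx d r R =
    Set.univ.pi fun _ => Set.univ.pi fun _ => Set.Ioo (-R) R := by
  ext x; simp [bx, abs_lt, Set.mem_pi]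

theorem bx_vol (d r : ℕ) (R : ℝ) : volume (bx d r R) = ENNReal.ofReal (2 * R) ^ (d * r) := by
  rw [bx_eq, volume_pi_pi]
  simp only [volume_pi_pi, Real.volume_Ioo, Finset.prod_const, Finset.card_univ, Fintype.card_fin]
  rw [← pow_mul]
  congr 2
  ring

theorem nu_apply {d r : ℕ} (m : Measure (SLR d)) (O : Set (Fin r → Fin d → ℤ))
    (A : Set (Fin r → Fin d → ℝ)) (hA : MeasurableSet A) :
    nu m O A = ∫⁻ h, ∑' v : O, A.indicator (fun _ => 1) (act h (castv v.1)) ∂m := by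
  rw [← lintegral_nu m O _ (measurable_const.indicator hA)]
  simp [hA]

theorem prim_full {d : ℕ} (w : Fin d → Fin d → ℤ) (hw : Prim w) (x : Fin d → ℤ) :
    x ∈ Submodule.span ℤ (Set.range w) := by
  have hdet : Matrix.det (fun i => w i : Matrix (Fin d) (Fin d) ℤ) ≠ 0 := by
    intro h0
    obtain ⟨v, hv, hv0⟩ := Matrix.exists_vecMul_eq_zero_iff.2 h0
    have := Fintype.linearIndependent_iff.1 hw.1 v (by
      rw [← hv0]; funext j; simp [Matrix.vecMul, dotProduct])
    exact hv (funext this)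
  refine hw.2 _ x hdet ?_
  set M : Matrix (Fin d) (Fin d) ℤ := fun i => w i
  have h2 : M.det • x = Matrix.vecMul (Matrix.vecMul x M.adjugate) M := by
    rw [Matrix.vecMul_vecMul, Matrix.adjugate_mul]
    simp
  rw [h2]
  have h3 : Matrix.vecMul (Matrix.vecMul x M.adjugate) M = ∑ l, (Matrix.vecMul x M.adjugate) l • w l := by
    funext j; simp [Matrix.vecMul, dotProduct, M]
  rw [h3]
  exact Submodule.sum_mem _ fun l _ => Submodule.smul_mem _ _ (Submodule.subset_span ⟨l, rfl⟩)

theorem base_count {d : ℕ} (R : ℝ) : ∃ K : ℕ, ∀ h : SLR d,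
    ∑' w : {w : Fin d → Fin d → ℤ | Prim w}, (bx d d R).indicator (fun _ => (1 : ℝ≥0∞))
      (act h (castv w.1)) ≤ K := by
  classical
  set B : ℤ := ⌈(d.factorial : ℝ) * R ^ d⌉
  refine ⟨Fintype.card (Fin d → Fin d → Set.Icc (-B) B), fun h => ?_⟩
  by_cases hex : ∃ w0 : Fin d → Fin d → ℤ, Prim w0 ∧ act h (castv w0) ∈ bx d d R
  swap
  · push Not at hex
    have : ∀ w : {w : Fin d → Fin d → ℤ | Prim w}, (bx d d R).indicator (fun _ => (1 : ℝ≥0∞))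
      (act h (castv w.1)) = 0 := fun w => Set.indicator_of_notMem (hex w.1 w.2) _
    simp [this]
  obtain ⟨w0, hw0, hb0⟩ := hex
  have key : ∀ w : Fin d → Fin d → ℤ, act h (castv w) ∈ bx d d R →
      ∃ A : Fin d → Fin d → Set.Icc (-B) B, ∀ l, w l = ∑ m, (A l m : ℤ) • w0 m := by
    intro w hw
    have h1 : ∀ l, ∃ c : Fin d → ℤ, ∑ m, c m • w0 m = w l := fun l =>
      (Submodule.mem_span_range_iff_exists_fun ℤ).1 (prim_full w0 hw0 (w l))
    choose c hc using h1
    have hM : ∀ l m, |c l m| ≤ B := by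
      intro l m
      set X : Matrix (Fin d) (Fin d) ℝ := fun i => act h (castv w0) i with hX
      have hXdet : 1 ≤ |X.det| := by
        have e1 : X = Matrix.of (castv w0) * (h : Matrix (Fin d) (Fin d) ℝ)ᵀ := by
          ext i j
          simp [X, act_apply, Matrix.mul_apply, mul_comm]
        rw [e1, Matrix.det_mul, Matrix.det_transpose, h.2, mul_one]
        have e2 : Matrix.of (castv w0) =
            (Int.castRingHom ℝ).mapMatrix (Matrix.of w0) := by
          ext i j; simp [castv]
        rw [e2, ← RingHom.map_det]
        have hdet : Matrix.det (Matrix.of w0) ≠ 0 := by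
          intro h0
          obtain ⟨v, hv, hv0⟩ := Matrix.exists_vecMul_eq_zero_iff.2 h0
          have := Fintype.linearIndependent_iff.1 hw0.1 v (by
            rw [← hv0]; funext j; simp [Matrix.vecMul, dotProduct])
          exact hv (funext this)
        have := Int.one_le_abs hdet
        simp only [eq_intCast]
        exact_mod_cast this
      have e3 : act h (castv w) l = ∑ p, (c l p : ℝ) • X p := by
        funext j
        rw [act_apply]
        simp only [X, Finset.sum_apply, Pi.smul_apply, smul_eq_mul, act_apply, castv, ← hc l,
          Int.cast_sum, Int.cast_mul, Finset.mul_sum]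
        rw [Finset.sum_comm]
        refine Finset.sum_congr rfl fun _ _ => Finset.sum_congr rfl fun _ _ => by ring
      have e4 := Matrix.det_updateRow_sum X m (fun p => (c l p : ℝ))
      rw [← e3] at e4
      have e5 : |(X.updateRow m (act h (castv w) l)).det| ≤ (d.factorial : ℝ) * R ^ d := by
        have := Matrix.det_le (A := X.updateRow m (act h (castv w) l))
          (abv := AbsoluteValue.abs) (x := R) (by
            intro i j
            simp only [Matrix.updateRow_apply, AbsoluteValue.abs_apply]
            split_ifs
            · exact (hw l j).le
            · exact (hb0 i j).le)
        simpa using this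
      rw [e4, smul_eq_mul, abs_mul] at e5
      have e6 : |(c l m : ℝ)| ≤ (d.factorial : ℝ) * R ^ d :=
        le_trans (le_mul_of_one_le_right (abs_nonneg _) hXdet) e5
      have e7 := e6.trans (Int.le_ceil _)
      exact_mod_cast e7
    exact ⟨fun l m => ⟨c l m, abs_le.1 (hM l m)⟩, fun l => (hc l).symm⟩
  choose A hA using key
  have hmem : ∀ w : Function.support (fun w : {w : Fin d → Fin d → ℤ | Prim w} =>
    (bx d d R).indicator (fun _ => (1 : ℝ≥0∞)) (act h (castv w.1))),
      act h (castv w.1.1) ∈ bx d d R := by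
    intro w
    by_contra hc; exact w.2 (Set.indicator_of_notMem hc _)
  have := tsum_le_inj (fun w : {w : Fin d → Fin d → ℤ | Prim w} =>
    (bx d d R).indicator (fun _ => (1 : ℝ≥0∞)) (act h (castv w.1)))
    (fun _ : Fin d → Fin d → Set.Icc (-B) B => 1) (fun w => A w.1.1 (hmem w)) (by
      intro w w' hww
      apply Subtype.ext; apply Subtype.ext
      funext l
      rw [hA _ (hmem w), hA _ (hmem w')]
      simp only at hww
      rw [hww]) (fun w => Set.indicator_apply_le' (fun _ => le_rfl) (fun _ => zero_le))
  refine this.trans ?_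
  rw [tsum_fintype]; simp

def Pm {d r : ℕ} (x : Fin r → Fin d → ℝ) : Matrix (Fin d) (Fin d) ℝ :=
  Matrix.of fun i j => if h : (j : ℕ) < r then x ⟨j, h⟩ i else if i = j then 1 else 0

def Ar (d r : ℕ) : Set (Fin r → Fin d → ℝ) := bx d r 2 ∩ {x | 1 / 2 < (Pm x).det}

theorem Ar_open (d r : ℕ) : IsOpen (Ar d r) := by
  refine (bx_open d r 2).inter (isOpen_lt continuous_const ?_)
  refine Continuous.matrix_det ?_
  refine continuous_matrix fun i j => ?_
  simp only [Pm, Matrix.of_apply]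
  split_ifs <;> fun_prop

theorem Ar_nonempty (d r : ℕ) (hr : r ≤ d) : (Ar d r).Nonempty := by
  refine ⟨fun l i => if i = Fin.castLE hr l then 1 else 0, ?_, ?_⟩
  · intro l j; dsimp only; split_ifs <;> norm_num
  · have : Pm (fun (l : Fin r) (i : Fin d) => if i = Fin.castLE hr l then (1:ℝ) else 0) = 1 := by
      ext i j
      simp only [Pm, Matrix.of_apply, Matrix.one_apply]
      split_ifs <;> simp_all [Fin.ext_iff]
    change (1:ℝ) / 2 < Matrix.det _
    rw [this, Matrix.det_one]; norm_num

theorem Pm_mulVec {d r : ℕ} (hr : r ≤ d) (x : Fin r → Fin d → ℝ) (s : Fin r → ℝ) :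
    (Pm x).mulVec (fun i => if h : (i : ℕ) < r then s ⟨i, h⟩ else 0) = ∑ l, s l • x l := by
  funext j
  simp only [Matrix.mulVec, dotProduct, Finset.sum_apply, Pi.smul_apply, smul_eq_mul]
  symm
  have : ∀ l : Fin r, s l * x l j = Pm x j (Fin.castLE hr l) *
      (if h : ((Fin.castLE hr l : Fin d) : ℕ) < r then s ⟨_, h⟩ else 0) := by
    intro l; simp [Pm, mul_comm]
  simp only [this]
  apply Finset.sum_of_injOn (Fin.castLE hr) (Fin.castLE_injective hr).injOn (by simp)
  · intro i _ hi
    have : ¬ (i : ℕ) < r := by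
      intro h; apply hi; exact ⟨⟨i, h⟩, by simp, by simp⟩
    simp [this]
  · intros; rfl

theorem mink {d r : ℕ} (hr : r < d) (h : SLR d) (w : Fin r → Fin d → ℤ) 
    (hA : act h (castv w) ∈ Ar d r) :
    ∃ z : Fin d → ℤ, z ∉ Submodule.span ℤ (Set.range w) ∧
      ∀ j, |∑ i, h j i * (z i : ℝ)| ≤ 4 * d := by
  classical
  set x := act h (castv w) with hx
  have hP : (1:ℝ) / 2 < (Pm x).det := hA.2
  have hP0 : (Pm x).det ≠ 0 := by linarith
  have hPu : IsUnit (Pm x).det := isUnit_iff_ne_zero.2 hP0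
  set M : Matrix (Fin d) (Fin d) ℝ := (Pm x)⁻¹ * (h : Matrix (Fin d) (Fin d) ℝ) with hM
  have hMdet : M.det = (Pm x).det⁻¹ := by
    rw [hM, Matrix.det_mul, h.2, mul_one, Matrix.det_nonsing_inv, Ring.inverse_eq_inv]
  set b : Fin d → ℝ := fun i => if (i : ℕ) < r then 1 else 2
  set f : (Fin d → ℝ) →ₗ[ℝ] (Fin d → ℝ) := Matrix.toLin' M
  set S : Set (Fin d → ℝ) := f ⁻¹' (Set.univ.pi fun i => Set.Ioo (-b i) (b i)) with hS
  have hfdet : LinearMap.det f = (Pm x).det⁻¹ := by rw [LinearMap.det_toLin', hMdet]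
  have hvol : volume S = ENNReal.ofReal ((Pm x).det) * ENNReal.ofReal (∏ i, (2 * b i)) := by
    rw [hS, Measure.addHaar_preimage_linearMap _ (by rw [hfdet]; exact inv_ne_zero hP0), hfdet,
      inv_inv, abs_of_pos (by linarith), volume_pi_pi]
    congr 1
    rw [ENNReal.ofReal_prod_of_nonneg]
    · refine Finset.prod_congr rfl fun i _ => ?_
      rw [Real.volume_Ioo]; congr 1; ring
    · intro i _; simp only [b]; split_ifs <;> norm_num
  have hbprod : (2:ℝ) ^ (d + 1) ≤ ∏ i, (2 * b i) := by
    have h1 : (2:ℝ) ^ d * 2 ≤ ∏ i, (2 * b i) := by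
      rw [Finset.prod_mul_distrib]
      simp only [Finset.prod_const, Finset.card_univ, Fintype.card_fin]
      refine mul_le_mul_of_nonneg_left ?_ (by positivity)
      have : b ⟨r, hr⟩ = 2 := by simp [b]
      rw [← this]
      rw [← Finset.mul_prod_erase Finset.univ b (Finset.mem_univ (⟨r, hr⟩ : Fin d))]
      refine le_mul_of_one_le_right (by rw [this]; norm_num) ?_
      refine Finset.prod_induction _ (fun y => (1:ℝ) ≤ y) (fun _ _ => one_le_mul_of_one_le_of_one_le) le_rfl ?_
      intro i _; simp only [b]; split_ifs <;> norm_num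
    rwa [pow_succ]
  have hlt : (2:ℝ) ^ d < (Pm x).det * ∏ i, (2 * b i) := by
    have : (0:ℝ) < 2 ^ d := by positivity
    rw [pow_succ] at hbprod
    nlinarith
  have fund := ZSpan.isAddFundamentalDomain (Pi.basisFun ℝ (Fin d)) (volume : Measure (Fin d → ℝ))
  have hsym : ∀ y ∈ S, -y ∈ S := by
    intro y hy
    simp only [hS, Set.mem_preimage, Set.mem_pi, Set.mem_univ, true_imp_iff, map_neg, Pi.neg_apply,
      Set.mem_Ioo] at hy ⊢
    intro i; constructor <;> linarith [(hy i).1, (hy i).2]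
  have hconv : Convex ℝ S := (convex_pi fun i _ => convex_Ioo _ _).linear_preimage f
  haveI : Countable (Submodule.span ℤ (Set.range (Pi.basisFun ℝ (Fin d)))).toAddSubgroup :=
    inferInstanceAs (Countable (Submodule.span ℤ (Set.range (Pi.basisFun ℝ (Fin d)))))
  obtain ⟨y, hy0, hyS⟩ := exists_ne_zero_mem_lattice_of_measure_mul_two_pow_lt_measure
    (L := (Submodule.span ℤ (Set.range (Pi.basisFun ℝ (Fin d)))).toAddSubgroup) fund hsym hconv (by
    rw [ZSpan.volume_fundamentalDomain, hvol, ← ENNReal.ofReal_mul (by linarith)]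
    have : Matrix.of (Pi.basisFun ℝ (Fin d)) = 1 := by
      ext i j; simp [Matrix.one_apply, Pi.single_apply, eq_comm]
    rw [this]
    simp only [Matrix.det_one, abs_one, ENNReal.ofReal_one, one_mul, Module.finrank_fin_fun]
    rw [show (2:ℝ≥0∞) = ENNReal.ofReal 2 by simp, ← ENNReal.ofReal_pow (by norm_num)]
    exact (ENNReal.ofReal_lt_ofReal_iff (lt_trans (by positivity) hlt)).2 hlt)
  have hyint : ∃ z : Fin d → ℤ, (y : Fin d → ℝ) = fun i => (z i : ℝ) := by
    have := y.2
    have h2 := (Module.Basis.mem_span_iff_repr_mem ℤ (Pi.basisFun ℝ (Fin d)) (y : Fin d → ℝ)).1 y.2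
    choose z hz using h2
    exact ⟨z, funext fun i => by have := hz i; simpa using this.symm⟩
  obtain ⟨z, hz⟩ := hyint
  have ht : ∀ i, |M.mulVec (fun i => (z i : ℝ)) i| < b i := by
    intro i
    have := hyS i (Set.mem_univ _)
    rw [hz] at this
    exact abs_lt.2 this
  have hPt : (Pm x).mulVec (M.mulVec (fun i => (z i : ℝ))) =
      (h : Matrix (Fin d) (Fin d) ℝ).mulVec (fun i => (z i : ℝ)) := by
    rw [Matrix.mulVec_mulVec, hM, ← Matrix.mul_assoc, Matrix.mul_nonsing_inv _ hPu, Matrix.one_mul]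
  refine ⟨z, ?_, ?_⟩
  · intro hmem
    obtain ⟨s, hs⟩ := (Submodule.mem_span_range_iff_exists_fun ℤ).1 hmem
    have e1 : (h : Matrix (Fin d) (Fin d) ℝ).mulVec (fun i => (z i : ℝ)) = ∑ l, (s l : ℝ) • x l := by
      funext j
      simp only [Matrix.mulVec, dotProduct, Finset.sum_apply, Pi.smul_apply, smul_eq_mul, hx, act_apply, castv,
        ← hs, Int.cast_sum, Int.cast_mul, Finset.mul_sum]
      rw [Finset.sum_comm]
      refine Finset.sum_congr rfl fun _ _ => Finset.sum_congr rfl fun _ _ => by ring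
    rw [← Pm_mulVec hr.le x (fun l => (s l : ℝ)), ← hPt] at e1
    have e2 := Matrix.mulVec_injective_iff_isUnit.2 ((Matrix.isUnit_iff_isUnit_det _).2 hPu) e1
    have e3 : ∀ l, s l = 0 := by
      intro l
      have := ht (Fin.castLE hr.le l)
      rw [e2] at this
      simp only [Fin.val_castLE, Fin.is_lt, dif_pos, b, if_pos, Fin.eta] at this
      have : |s l| < 1 := by exact_mod_cast this
      exact Int.abs_lt_one_iff.1 this
    apply hy0
    apply Subtype.ext
    rw [hz, ← hs]
    funext i; simp [e3]
  · intro j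
    have e1 : ∑ i, h j i * (z i : ℝ) = ∑ i, Pm x j i * M.mulVec (fun i => (z i : ℝ)) i :=
      (congrFun hPt j).symm
    rw [e1]
    refine (Finset.abs_sum_le_sum_abs _ _).trans ?_
    have : ∀ i ∈ Finset.univ, |Pm x j i * M.mulVec (fun i => (z i : ℝ)) i| ≤ 4 := by
      intro i _
      rw [abs_mul]
      have h1 : |Pm x j i| ≤ 2 := by
        simp only [Pm, Matrix.of_apply]
        split_ifs
        · exact (hA.1 _ _).le
        · norm_num
        · norm_num
      have h2 : |M.mulVec (fun i => (z i : ℝ)) i| ≤ 2 := (ht i).le.trans (by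
        simp only [b]; split_ifs <;> norm_num)
      nlinarith [abs_nonneg (Pm x j i), abs_nonneg (M.mulVec (fun i => (z i : ℝ)) i)]
    refine (Finset.sum_le_card_nsmul _ _ _ this).trans ?_
    simp [mul_comm]

abbrev PrimS (d r : ℕ) : Set (Fin r → Fin d → ℤ) := {w | Prim w}

theorem step_le {d r : ℕ} (hr : r < d) (h : SLR d) :
    ∑' w : PrimS d r, (Ar d r).indicator (fun _ => (1 : ℝ≥0∞)) (act h (castv w.1)) ≤
    ∑' w : PrimS d (r+1), (bx d (r+1) (6 * d + 1)).indicator (fun _ => (1 : ℝ≥0∞))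
      (act h (castv w.1)) := by
  classical
  have hmem : ∀ w : Function.support (fun w : PrimS d r =>
      (Ar d r).indicator (fun _ => (1 : ℝ≥0∞)) (act h (castv w.1))),
      act h (castv w.1.1) ∈ Ar d r := by
    intro w
    by_contra hc; exact w.2 (Set.indicator_of_notMem hc _)
  have key : ∀ w : Fin r → Fin d → ℤ, Prim w → act h (castv w) ∈ Ar d r →
      ∃ u : Fin d → ℤ, Prim (Fin.snoc w u : Fin (r+1) → Fin d → ℤ) ∧
        act h (castv (Fin.snoc w u : Fin (r+1) → Fin d → ℤ)) ∈ bx d (r+1) (6 * d + 1) := by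
    intro w hw hA
    obtain ⟨z, hz, hzb⟩ := mink hr h w hA
    obtain ⟨u, t, q, ht, hq, hzu, hP⟩ := ext_prim w hw z hz
    refine ⟨u, hP, ?_⟩
    have hd1 : (1:ℝ) ≤ d := by exact_mod_cast (by omega : 1 ≤ d)
    intro l j
    refine Fin.lastCases ?_ (fun l => ?_) l
    · rw [act_apply]
      simp only [castv, Fin.snoc_last]
      have ht' : (0:ℝ) < t := by exact_mod_cast ht
      have e1 : ∑ i, h j i * (z i : ℝ) = t * (∑ i, h j i * (u i : ℝ)) +
          ∑ l, (q l : ℝ) * act h (castv w) l j := by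
        simp only [act_apply, castv, hzu, Pi.add_apply, Pi.smul_apply, smul_eq_mul, Finset.sum_apply,
          Int.cast_add, Int.cast_mul, Int.cast_sum, Int.cast_natCast, mul_add, Finset.sum_add_distrib,
          Finset.mul_sum]
        congr 1
        · exact Finset.sum_congr rfl fun _ _ => by ring
        · rw [Finset.sum_comm]
          refine Finset.sum_congr rfl fun _ _ => Finset.sum_congr rfl fun _ _ => by ring
      have e2 : |∑ l, (q l : ℝ) * act h (castv w) l j| ≤ t * (2 * d) := by
        refine (Finset.abs_sum_le_sum_abs _ _).trans ?_
        have : ∀ l ∈ Finset.univ, |(q l : ℝ) * act h (castv w) l j| ≤ t * 2 := by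
          intro l _
          rw [abs_mul]
          have a1 := (hA.1 l j).le
          have a2 : |(q l : ℝ)| ≤ t := by
            rw [abs_of_nonneg (by positivity)]; exact_mod_cast (hq l).le
          exact mul_le_mul a2 a1 (abs_nonneg _) ht'.le
        refine (Finset.sum_le_card_nsmul _ _ _ this).trans ?_
        simp only [Finset.card_univ, Fintype.card_fin, nsmul_eq_mul]
        have : (r:ℝ) ≤ d := by exact_mod_cast hr.le
        nlinarith
      have e3 : |t * (∑ i, h j i * (u i : ℝ))| ≤ 4 * d + t * (2 * d) := by
        have : t * (∑ i, h j i * (u i : ℝ)) = ∑ i, h j i * (z i : ℝ) - 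
          ∑ l, (q l : ℝ) * act h (castv w) l j := by rw [e1]; ring
        rw [this]
        exact (abs_sub _ _).trans (add_le_add (hzb j) e2)
      rw [abs_mul, abs_of_pos ht'] at e3
      have ht1 : (1:ℝ) ≤ t := by exact_mod_cast ht
      have : (t:ℝ) * |∑ i, h j i * (u i : ℝ)| ≤ t * (6 * d) := by nlinarith
      have := le_of_mul_le_mul_left this ht'
      linarith
    · have := hA.1 l j
      rw [act_apply] at this ⊢
      simp only [castv, Fin.snoc_castSucc] at this ⊢
      linarith
  choose u hu1 hu2 using key
  refine tsum_le_inj _ _ (fun w => ⟨Fin.snoc w.1.1 (u w.1.1 w.1.2 (hmem w)), hu1 _ _ _⟩) ?_ ?_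
  · intro w w' hww
    have := congrArg (fun v : PrimS d (r+1) => Fin.init (α := fun _ => Fin d → ℤ) v.1) hww
    simp only [Fin.init_snoc] at this
    exact Subtype.ext (Subtype.ext this)
  · intro w
    rw [Set.indicator_of_mem (hmem w), Set.indicator_of_mem (hu2 _ _ _)]

theorem prim_fin {d N : ℕ} (m : Measure (SLR d)) [IsProbabilityMeasure m]
    (hG : ∀ (r : ℕ) (O : Set (Fin r → Fin d → ℤ)), StableN N O → GInv (nu m O)) :
    ∀ q r : ℕ, r + q = d → (∀ R : ℝ, nu m (PrimS d r) (bx d r R) < ∞) ∧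
      (r < d → ∃ c : ℝ≥0∞, c ≠ ∞ ∧ nu m (PrimS d r) = c • volume) := by
  intro q
  induction q with
  | zero =>
    intro r hr
    obtain rfl : r = d := by omega
    refine ⟨fun R => ?_, fun h => absurd h (lt_irrefl _)⟩
    obtain ⟨K, hK⟩ := base_count (d := r) R
    rw [nu_apply _ _ _ (bx_open _ _ _).measurableSet]
    refine (lintegral_mono hK).trans_lt ?_
    simp
  | succ q ih =>
    intro r hr
    have hrd : r < d := by omega
    have ih' := (ih (r+1) (by omega)).1 (6 * d + 1)
    obtain ⟨c, hc⟩ := nu_unique hrd (nu m (PrimS d r)) (hG _ _ prim_stable)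
      (nu_generic m _ fun v hv => hv.1)
    have hcf : c ≠ ∞ := by
      intro hc0
      have h1 : nu m (PrimS d r) (Ar d r) < ∞ := by
        refine lt_of_le_of_lt ?_ ih'
        rw [nu_apply _ _ _ (bx_open _ _ _).measurableSet, nu_apply _ _ _ (Ar_open _ _).measurableSet]
        exact lintegral_mono fun h => step_le hrd h
      have h2 : volume (Ar d r) ≠ 0 := ((Ar_open d r).measure_pos _ (Ar_nonempty d r hrd.le)).ne'
      rw [hc, hc0] at h1
      simp only [Measure.smul_apply, smul_eq_mul, ENNReal.top_mul h2] at h1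
      exact lt_irrefl _ h1
    refine ⟨fun R => ?_, fun _ => ⟨c, hcf, hc⟩⟩
    rw [hc, Measure.smul_apply, bx_vol, smul_eq_mul]
    exact ENNReal.mul_lt_top hcf.lt_top (ENNReal.pow_lt_top ENNReal.ofReal_lt_top)

theorem prim_const {d N r : ℕ} (hr : r < d) (m : Measure (SLR d)) [IsProbabilityMeasure m]
    (hG : ∀ (r : ℕ) (O : Set (Fin r → Fin d → ℤ)), StableN N O → GInv (nu m O)) :
    ∃ c : ℝ≥0∞, c ≠ ∞ ∧ nu m (PrimS d r) = c • volume :=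
  (prim_fin m hG (d - r) r (by omega)).2 hr

theorem pow_sum_fin : ∀ (r : ℕ) (f : ℕ → ℝ≥0∞), ∑' t : Fin r → ℕ, ∏ j, f (t j) = (∑' t, f t) ^ r := by
  intro r f
  induction r with
  | zero => simp
  | succ r ih =>
    rw [← (Fin.consEquiv fun _ => ℕ).tsum_eq, ENNReal.tsum_prod', pow_succ']
    simp only [Fin.consEquiv_apply, Fin.prod_univ_succ, Fin.cons_zero, Fin.cons_succ]
    simp_rw [ENNReal.tsum_mul_left, ih, ENNReal.tsum_mul_right]

/-- domination -/
theorem domin {d N k r : ℕ} (hkd : k + 2 ≤ d) (ι : Fin r → Fin k) (hι : Function.Injective ι) (m : Measure (SLR d))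
    [IsProbabilityMeasure m]
    (hG : ∀ (r : ℕ) (O : Set (Fin r → Fin d → ℤ)), StableN N O → GInv (nu m O)) :
    ∃ K : ℝ≥0∞, K ≠ ∞ ∧ ∀ (E : Set (Fin k → Fin d → ℝ)) (E' : Set (Fin r → Fin d → ℝ)),
      MeasurableSet E' → (∀ x ∈ E, (fun j => x (ι j)) ∈ E') →
      ∫⁻ h, ∑' v : Lset d ι, E.indicator (fun _ => (1:ℝ≥0∞)) (act h (castv v.1)) ∂m ≤
        K * volume E' := by
  classical
  have hrk : r ≤ k := by simpa using Fintype.card_le_of_injective ι hι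
  obtain ⟨c, hc, hcv⟩ := prim_const (show r < d by omega) m hG
  obtain ⟨φ, hφ, hφv⟩ := code_map (d := d) ι
  set DR : Code ι → Matrix (Fin r) (Fin r) ℝ := fun c => (Dm c).map (fun n : ℕ => (n : ℝ)) with hDR
  have hdet : ∀ c : Code ι, (DR c).det = ∏ j, ((c.1 j : ℝ) + 1) := by
    intro c
    rw [Matrix.det_of_isUpperTriangular]
    · refine Finset.prod_congr rfl fun j _ => ?_
      simp [hDR, Dm]
    · intro i j hij
      simp only [id] at hij
      simp [hDR, Dm, hij.ne', not_lt.2 hij.le]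
  have hdet0 : ∀ c : Code ι, 0 < (DR c).det := by
    intro c; rw [hdet]; exact Finset.prod_pos fun j _ => by positivity
  set K1 : ℝ≥0∞ := ∑' c : Code ι, ENNReal.ofReal |((DR c).det ^ d)⁻¹| with hK1
  have hK1f : K1 ≠ ∞ := by
    have hle : K1 ≤ 3 ^ ((k - r) * r) * (∑' t : ℕ, ENNReal.ofReal (1 / ((t : ℝ) + 1) ^ 2)) ^ r := by
      rw [hK1, ← pow_sum_fin, ENNReal.tsum_sigma', ← ENNReal.tsum_mul_left]
      refine ENNReal.tsum_le_tsum fun t => ?_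
      simp only [hdet]
      rw [tsum_fintype, Finset.sum_const, Finset.card_univ, Fintype.card_prod]
      simp only [Fintype.card_pi, Fintype.card_prod, Fintype.card_fin, Finset.prod_const, Finset.card_univ]
      have hcard : Fintype.card {i // i ∉ Set.range ι} = k - r := by
        have : Fintype.card {i // i ∈ Set.range ι} = r := by
          have := Set.card_range_of_injective hι
          rw [Fintype.card_fin] at this; exact (Fintype.card_congr (Equiv.refl _)).trans this
        rw [Fintype.card_subtype_compl, this, Fintype.card_fin]
      rw [hcard, ← ENNReal.ofReal_prod_of_nonneg (fun _ _ => by positivity), nsmul_eq_mul,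
        show (3:ℝ≥0∞) = ENNReal.ofReal 3 by simp, ← ENNReal.ofReal_pow (by norm_num),
        ← ENNReal.ofReal_mul (by positivity), ← ENNReal.ofReal_natCast,
        ← ENNReal.ofReal_mul (by positivity)]
      refine ENNReal.ofReal_le_ofReal ?_
      set p : ℝ := ∏ j, ((t j : ℝ) + 1) with hp
      have hp1 : 1 ≤ p := Finset.prod_induction _ (fun y => (1:ℝ) ≤ y)
        (fun _ _ => one_le_mul_of_one_le_of_one_le) le_rfl (fun j _ => by
          have : (0:ℝ) ≤ t j := by positivity
          linarith)
      have e1 : (∏ j, 1 / ((t j : ℝ) + 1) ^ 2) = 1 / p ^ 2 := by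
        rw [Finset.prod_div_distrib, Finset.prod_pow]; simp [hp]
      rw [e1]
      push_cast
      rw [← hp, abs_of_pos (by positivity)]
      have e2 : (∏ j, (((t j : ℝ) + 1) * 3)) = p * 3 ^ r := by
        rw [Finset.prod_mul_distrib]; simp [hp]
      rw [e2, mul_pow, ← pow_mul, mul_comm r (k - r)]
      have e3 : p ^ r * (p ^ (k - r)) = p ^ k := by rw [← pow_add]; congr 1; omega
      have e4 : p ^ k * (p ^ d)⁻¹ ≤ 1 / p ^ 2 := by
        rw [← div_eq_mul_inv, div_le_div_iff₀ (by positivity) (by positivity), ← pow_add, one_mul]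
        exact pow_le_pow_right₀ hp1 hkd
      calc p ^ r * (p ^ (k - r) * 3 ^ ((k - r) * r)) * (p ^ d)⁻¹
          = 3 ^ ((k - r) * r) * (p ^ r * p ^ (k - r) * (p ^ d)⁻¹) := by ring
        _ ≤ _ := by rw [e3]; gcongr
    refine ne_top_of_le_ne_top ?_ hle
    refine ENNReal.mul_ne_top (by simp) (ENNReal.pow_ne_top ?_)
    have hs : Summable fun t : ℕ => 1 / ((t : ℝ) + 1) ^ 2 := by
      have := (summable_nat_add_iff 1).2 (Real.summable_one_div_nat_pow.2 (by norm_num : 1 < 2))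
      simpa using this
    rw [← ENNReal.ofReal_tsum_of_nonneg (fun _ => by positivity) hs]
    exact ENNReal.ofReal_ne_top
  refine ⟨c * K1, ENNReal.mul_ne_top hc hK1f, fun E E' hE' hEE => ?_⟩
  have hcm : ∀ A : Matrix (Fin r) (Fin r) ℝ, Measurable (comb (d := d) A) := by
    intro A
    refine measurable_pi_lambda _ fun j => measurable_pi_lambda _ fun i => ?_
    exact Finset.measurable_sum _ fun l _ => (meas_coord l i).const_mul _
  have hpt : ∀ h : SLR d, ∑' v : Lset d ι, E.indicator (fun _ => (1:ℝ≥0∞)) (act h (castv v.1)) ≤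
      ∑' p : Code ι, ∑' w : PrimS d r, (comb (DR p) ⁻¹' E').indicator (fun _ => (1:ℝ≥0∞)) (act h (castv w.1)) := by
    intro h
    rw [← ENNReal.tsum_prod (f := fun (p : Code ι) (w : PrimS d r) =>
      (comb (DR p) ⁻¹' E').indicator (fun _ => (1:ℝ≥0∞)) (act h (castv w.1)))]
    refine tsum_le_inj _ _ (fun v => φ v.1) (hφ.comp Subtype.val_injective) ?_
    intro v
    have hv : act h (castv v.1.1) ∈ E := by
      by_contra hc; exact v.2 (Set.indicator_of_notMem hc _)
    rw [Set.indicator_of_mem hv, Set.indicator_of_mem]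
    have := hEE _ hv
    rw [Set.mem_preimage]
    convert this using 1
    funext j i
    simp only [comb, act_apply, castv, hφv, hDR, Matrix.map_apply, Finset.sum_apply, Pi.smul_apply, smul_eq_mul,
      Int.cast_sum, Int.cast_mul, Int.cast_natCast, Finset.mul_sum]
    rw [Finset.sum_comm]
    refine Finset.sum_congr rfl fun _ _ => Finset.sum_congr rfl fun _ _ => by ring
  refine (lintegral_mono hpt).trans ?_
  rw [lintegral_tsum]
  · have : ∀ p : Code ι, ∫⁻ h, ∑' w : PrimS d r, (comb (DR p) ⁻¹' E').indicator (fun _ => (1:ℝ≥0∞))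
        (act h (castv w.1)) ∂m = c * (ENNReal.ofReal |((DR p).det ^ d)⁻¹| * volume E') := by
      intro p
      rw [← nu_apply m _ _ (hcm _ hE'), hcv, Measure.smul_apply, vol_comb _ (hdet0 p).ne', smul_eq_mul]
    simp only [this]
    rw [ENNReal.tsum_mul_left, ENNReal.tsum_mul_right, mul_assoc]
  · intro p
    have : Measurable fun h : SLR d => ∑' w : PrimS d r, (comb (DR p) ⁻¹' E').indicator
        (fun _ => (1:ℝ≥0∞)) (act h (castv w.1)) := by
      refine Measurable.tsum fun w => ?_
      exact (measurable_const.indicator (hcm _ hE')).comp (meas_act_left _)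
    exact this.aemeasurable

theorem Lset_inj {k r d : ℕ} (ι : Fin r → Fin k) (v : Fin k → Fin d → ℤ) (hv : v ∈ Lset d ι) :
    Function.Injective ι := fun i j hij => hv.1.injective (by simp [hij])

theorem cover_bound {d N k : ℕ} (hkd : k + 2 ≤ d) (m : Measure (SLR d))
    [IsProbabilityMeasure m]
    (hG : ∀ (r : ℕ) (O : Set (Fin r → Fin d → ℤ)), StableN N O → GInv (nu m O))
    (q : ℕ) (O : Set (Fin k → Fin d → ℤ))
    (hO : ∀ v ∈ O, ∃ r, r < q ∧ ∃ ι : Fin r → Fin k, v ∈ Lset d ι) :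
    ∃ K : ℝ≥0∞, K ≠ ∞ ∧ ∀ (E : Set (Fin k → Fin d → ℝ)) (V : ℝ≥0∞), MeasurableSet E →
      (∀ r, r < q → ∀ ι : Fin r → Fin k, Function.Injective ι →
        ∃ E' : Set (Fin r → Fin d → ℝ), MeasurableSet E' ∧ (∀ x ∈ E, (fun j => x (ι j)) ∈ E') ∧
          volume E' ≤ V) →
      ∫⁻ h, ∑' v : O, E.indicator (fun _ => (1:ℝ≥0∞)) (act h (castv v.1)) ∂m ≤ K * V := by
  classical
  have hdom : ∀ p : (Σ r : Fin q, (Fin r → Fin k)), ∃ K : ℝ≥0∞, K ≠ ∞ ∧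
    ∀ (E : Set (Fin k → Fin d → ℝ)) (V : ℝ≥0∞), 
      (Function.Injective p.2 → 
        ∃ E' : Set (Fin p.1 → Fin d → ℝ), MeasurableSet E' ∧ (∀ x ∈ E, (fun j => x (p.2 j)) ∈ E') ∧
          volume E' ≤ V) →
      ∫⁻ h, ∑' v : Lset d p.2, E.indicator (fun _ => (1:ℝ≥0∞)) (act h (castv v.1)) ∂m ≤ K * V := by
    intro p
    by_cases hp : Function.Injective p.2
    · obtain ⟨K, hK, h⟩ := domin hkd p.2 hp m hG
      refine ⟨K, hK, fun E V hV => ?_⟩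
      obtain ⟨E', h1, h2, h3⟩ := hV hp
      exact (h E E' h1 h2).trans (by gcongr)
    · refine ⟨0, by simp, fun E V _ => ?_⟩
      have : IsEmpty (Lset d p.2) := ⟨fun v => hp (Lset_inj _ _ v.2)⟩
      simp
  choose K hK hKb using hdom
  refine ⟨∑ p, K p, by simp [hK], fun E V hE hV => ?_⟩
  choose r hr ι hι using hO
  have hpt : ∀ h : SLR d, ∑' v : O, E.indicator (fun _ => (1:ℝ≥0∞)) (act h (castv v.1)) ≤
      ∑ p : (Σ r : Fin q, (Fin r → Fin k)), ∑' v : Lset d p.2, 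
        E.indicator (fun _ => (1:ℝ≥0∞)) (act h (castv v.1)) := by
    intro h
    rw [← tsum_fintype (L := .unconditional _), ← ENNReal.tsum_sigma
      (f := fun (p : Σ r : Fin q, (Fin r → Fin k)) (v : Lset d p.2) =>
        E.indicator (fun _ => (1:ℝ≥0∞)) (act h (castv v.1)))]
    refine tsum_le_inj _ _ (fun v => ⟨⟨⟨r v.1.1 v.1.2, hr _ _⟩, ι v.1.1 v.1.2⟩, ⟨v.1.1, hι _ _⟩⟩) ?_ ?_
    · intro v w hvw
      have := congrArg (fun z : (Σ p : (Σ r : Fin q, (Fin r → Fin k)), Lset d p.2) => z.2.1) hvw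
      exact Subtype.ext (Subtype.ext this)
    · intro v; exact le_rfl
  refine (lintegral_mono hpt).trans ?_
  rw [lintegral_finsetSum, Finset.sum_mul]
  · exact Finset.sum_le_sum fun p _ => hKb p E V fun hp => hV _ p.1.2 _ hp
  · intro p _
    refine Measurable.tsum fun w => ?_
    exact (measurable_const.indicator hE).comp (meas_act_left _)

def Oall {d : ℕ} (k N : ℕ) (v₀ : Fin d → ℤ) : Set (Fin k → Fin d → ℤ) :=
  {v | ∀ l j, (N : ℤ) ∣ (v l j - v₀ j)}

theorem vol_act {d k : ℕ} (h : SLR d) (B : Set (Fin k → Fin d → ℝ)) (hB : MeasurableSet B) :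
    volume {x | act h x ∈ B} = volume B := by
  have h1 : MeasurePreserving (fun y : Fin d → ℝ => (h : Matrix (Fin d) (Fin d) ℝ).mulVec y)
      volume volume := by
    have := Real.map_matrix_volume_pi_eq_smul_volume_pi (M := (h : Matrix (Fin d) (Fin d) ℝ))
      (by rw [h.2]; norm_num)
    rw [h.2] at this
    refine ⟨(Matrix.toLin' (h : Matrix (Fin d) (Fin d) ℝ)).continuous_of_finiteDimensional.measurable, ?_⟩
    simp only [inv_one, abs_one, ENNReal.ofReal_one, one_smul] at this
    exact this
  have h2 := volume_preserving_pi (fun _ : Fin k => h1)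
  exact h2.measure_preimage hB.nullMeasurableSet

def pcell {d k : ℕ} (N : ℕ) (v₀ : Fin d → ℤ) (x : Fin k → Fin d → ℝ) : Fin k → Fin d → ℤ :=
  fun l j => v₀ j + N * ⌊(x l j - v₀ j) / N⌋

theorem pcell_iff {d k N : ℕ} (hN : 0 < N) (v₀ : Fin d → ℤ) (x : Fin k → Fin d → ℝ)
    (v : Fin k → Fin d → ℤ) (hv : v ∈ Oall k N v₀) :
    pcell N v₀ x = v ↔ x ∈ Set.univ.pi fun l => Set.univ.pi fun j =>
      Set.Ico (v l j : ℝ) ((v l j : ℝ) + N) := by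
  have hN' : (0:ℝ) < N := by exact_mod_cast hN
  simp only [Set.mem_pi, Set.mem_univ, true_imp_iff, funext_iff, pcell]
  refine forall_congr' fun l => forall_congr' fun j => ?_
  obtain ⟨q, hq⟩ := hv l j
  have hq' : v l j = v₀ j + N * q := by linarith
  have e1 : v₀ j + (N:ℤ) * ⌊(x l j - v₀ j) / N⌋ = v l j ↔ ⌊(x l j - v₀ j) / N⌋ = q := by
    rw [hq']
    constructor
    · intro h
      have : (N:ℤ) * ⌊(x l j - v₀ j) / N⌋ = N * q := by linarith
      exact mul_left_cancel₀ (by exact_mod_cast hN.ne') this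
    · rintro rfl; rfl
  rw [e1, Int.floor_eq_iff, le_div_iff₀ hN', div_lt_iff₀ hN', Set.mem_Ico, hq']
  push_cast
  constructor <;> rintro ⟨a, b⟩ <;> constructor <;> linarith

theorem pcell_mem {d k N : ℕ} (v₀ : Fin d → ℤ) (x : Fin k → Fin d → ℝ) : 
    pcell N v₀ x ∈ Oall k N v₀ := by
  intro l j; simp [pcell]

theorem cell_count {d k N : ℕ} (hN : 0 < N) (v₀ : Fin d → ℤ) (h : SLR d)
    (A : Set (Fin k → Fin d → ℝ)) :
    volume {x : Fin k → Fin d → ℝ | act h (castv (pcell N v₀ x)) ∈ A} = 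
      (N : ℝ≥0∞) ^ (d * k) *
      ∑' v : Oall k N v₀, A.indicator (fun _ => (1:ℝ≥0∞)) (act h (castv v.1)) := by
  classical
  set U : Oall k N v₀ → Set (Fin k → Fin d → ℝ) := fun v =>
    if act h (castv v.1) ∈ A then Set.univ.pi fun l => Set.univ.pi fun j =>
      Set.Ico (v.1 l j : ℝ) ((v.1 l j : ℝ) + N) else ∅ with hU
  have h1 : {x : Fin k → Fin d → ℝ | act h (castv (pcell N v₀ x)) ∈ A} = ⋃ v, U v := by
    ext x
    simp only [Set.mem_iUnion, hU]
    constructor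
    · intro hx
      refine ⟨⟨pcell N v₀ x, pcell_mem _ _⟩, ?_⟩
      rw [if_pos (show act h (castv (pcell N v₀ x)) ∈ A from hx)]
      exact (pcell_iff hN v₀ x _ (pcell_mem _ _)).1 rfl
    · rintro ⟨v, hv⟩
      split_ifs at hv with hA
      · rw [← pcell_iff hN v₀ x _ v.2] at hv
        change act h (castv (pcell N v₀ x)) ∈ A
        rwa [hv]
      · exact hv.elim
  rw [h1, measure_iUnion, ← ENNReal.tsum_mul_left]
  · refine tsum_congr fun v => ?_
    simp only [hU, Set.indicator_apply]
    split_ifs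
    · rw [volume_pi_pi]
      simp only [volume_pi_pi, Real.volume_Ico, add_sub_cancel_left, ENNReal.ofReal_natCast, Finset.prod_const,
        Finset.card_univ, Fintype.card_fin, mul_one]
      rw [← pow_mul]
    · simp
  · intro v w hvw
    refine Set.disjoint_left.2 fun x hx hx' => hvw ?_
    simp only [hU] at hx hx'
    split_ifs at hx with hA
    · split_ifs at hx' with hA'
      · rw [← pcell_iff hN v₀ x _ v.2] at hx
        rw [← pcell_iff hN v₀ x _ w.2] at hx'
        exact Subtype.ext (hx.symm.trans hx')
      · exact hx'.elim
    · exact hx.elim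
  · intro v
    simp only [hU]
    split_ifs
    · exact MeasurableSet.univ_pi fun l => MeasurableSet.univ_pi fun j => measurableSet_Ico
    · exact MeasurableSet.empty

theorem cell_close {d k N : ℕ} (hN : 0 < N) (v₀ : Fin d → ℤ) (h : SLR d) : ∃ ρ : ℝ, 
    ∀ (x : Fin k → Fin d → ℝ) (l : Fin k) (j : Fin d), |act h x l j - act h (castv (pcell N v₀ x)) l j| ≤ ρ := by
  have hN' : (0:ℝ) < N := by exact_mod_cast hN
  refine ⟨∑ j, ∑ i, |h j i| * N, fun x l j => ?_⟩
  have e1 : ∀ i, |x l i - (pcell N v₀ x l i : ℝ)| ≤ N := by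
    intro i
    have := (pcell_iff hN v₀ x _ (pcell_mem v₀ x)).1 rfl l (Set.mem_univ _) i (Set.mem_univ _)
    rw [abs_le]; constructor <;> linarith [this.1, this.2]
  rw [act_apply, act_apply, ← Finset.sum_sub_distrib]
  refine (Finset.abs_sum_le_sum_abs _ _).trans ?_
  refine le_trans ?_ (Finset.single_le_sum (f := fun j => ∑ i, |h j i| * (N:ℝ))
    (fun j _ => Finset.sum_nonneg fun i _ => by positivity) (Finset.mem_univ j))
  refine Finset.sum_le_sum fun i _ => ?_
  rw [← mul_sub, abs_mul]
  exact mul_le_mul_of_nonneg_left (e1 i) (abs_nonneg _)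

theorem cnt_limit {d k N : ℕ} (hN : 0 < N) (v₀ : Fin d → ℤ) (h : SLR d) :
    Filter.Tendsto (fun n : ℕ => (N : ℝ≥0∞) ^ (d * k) *
      (∑' v : Oall k N v₀, (bx d k (n+1)).indicator (fun _ => (1:ℝ≥0∞)) (act h (castv v.1))) /
        (ENNReal.ofReal (2 * (n + 1))) ^ (d * k)) Filter.atTop (nhds 1) := by
  obtain ⟨ρ, hρ⟩ := cell_close (k := k) hN v₀ h
  have hpos : ∀ n : ℕ, (0:ℝ) < 2 * (n + 1) := fun n => by positivity
  have hdiv : ∀ (n : ℕ) (y : ℝ), ENNReal.ofReal (2 * y) ^ (d * k) / 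
      (ENNReal.ofReal (2 * (n + 1))) ^ (d * k) = (ENNReal.ofReal (y / (n+1))) ^ (d * k) := by
    intro n y
    rw [div_eq_mul_inv, ENNReal.inv_pow, ← mul_pow, ← div_eq_mul_inv, ← ENNReal.ofReal_div_of_pos (hpos n), mul_div_mul_left _ _ (by norm_num : (2:ℝ) ≠ 0)]
  have hlim : ∀ c : ℝ, Filter.Tendsto (fun n : ℕ => (ENNReal.ofReal (((n:ℝ) + 1 + c) / (n+1))) ^ (d * k))
      Filter.atTop (nhds 1) := by
    intro c
    have h1 : Filter.Tendsto (fun n : ℕ => ((n:ℝ) + 1 + c) / (n+1)) Filter.atTop (nhds 1) := by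
      have h2 : Filter.Tendsto (fun n : ℕ => 1 + c * (1 / ((n:ℝ)+1))) Filter.atTop (nhds (1 + c * 0)) :=
        tendsto_const_nhds.add (tendsto_one_div_add_atTop_nhds_zero_nat.const_mul c)
      simp only [mul_zero, add_zero] at h2
      refine h2.congr fun n => ?_
      field_simp
    have h3 := ENNReal.Tendsto.pow (n := d * k) (ENNReal.tendsto_ofReal h1)
    simpa using h3
  refine tendsto_of_tendsto_of_tendsto_of_le_of_le (hlim (-ρ)) (hlim ρ) ?_ ?_
  · intro n
    dsimp only
    rw [← cell_count hN v₀ h]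
    rw [← hdiv, ← bx_vol, ← vol_act h _ (bx_open d k _).measurableSet]
    gcongr
    intro hx l j
    have h1 := hρ x l j
    have h2 := hx l j
    rw [abs_le] at h1; rw [abs_lt] at h2 ⊢
    constructor <;> linarith [h1.1, h1.2, h2.1, h2.2]
  · intro n
    dsimp only
    rw [← cell_count hN v₀ h]
    rw [← hdiv, ← bx_vol d k (n + 1 + ρ), ← vol_act h (bx d k (n + 1 + ρ)) (bx_open d k _).measurableSet]
    gcongr
    intro hx l j
    have h1 := hρ x l j
    have h2 := hx l j
    rw [abs_le] at h1; rw [abs_lt] at h2 ⊢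
    constructor <;> linarith [h1.1, h1.2, h2.1, h2.2]

theorem act_castv_sub {d k : ℕ} (h : SLR d) (v w : Fin k → Fin d → ℤ) (l j) :
    act h (castv (v - w)) l j = act h (castv v) l j - act h (castv w) l j := by
  simp only [act_apply, castv, Pi.sub_apply, Int.cast_sub, mul_sub, Finset.sum_sub_distrib]

theorem cnt_dom {d k N : ℕ} (v₀ : Fin d → ℤ) (h : SLR d) (n : ℕ) :
    ∑' v : Oall k N v₀, (bx d k (n+1)).indicator (fun _ => (1:ℝ≥0∞)) (act h (castv v.1)) ≤
      (ENNReal.ofReal (2 * (n + 1))) ^ (d * k) *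
        ∑' v : (Set.univ : Set (Fin k → Fin d → ℤ)), (bx d k 1).indicator (fun _ => (1:ℝ≥0∞)) (act h (castv v.1)) := by
  classical
  set f : Oall k N v₀ → ℝ≥0∞ := fun v =>
    (bx d k (n+1)).indicator (fun _ => (1:ℝ≥0∞)) (act h (castv v.1)) with hf
  have hmem : ∀ v : Function.support f, act h (castv v.1.1) ∈ bx d k (n+1) := by
    intro v
    by_contra hc; exact v.2 (Set.indicator_of_notMem hc _)
  let Q := Fin k → Fin d → Fin (2 * (n + 1))
  have hfl : ∀ (v : Function.support f) l j, 0 ≤ ⌊act h (castv v.1.1) l j⌋ + (n + 1) ∧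
      ⌊act h (castv v.1.1) l j⌋ + (n + 1) < 2 * (n + 1) := by
    intro v l j
    have := abs_lt.1 (hmem v l j)
    constructor
    · have : -(n + 1 : ℤ) ≤ ⌊act h (castv v.1.1) l j⌋ := Int.le_floor.2 (by push_cast; linarith [this.1])
      omega
    · have : ⌊act h (castv v.1.1) l j⌋ < (n + 1 : ℤ) := Int.floor_lt.2 (by push_cast; linarith [this.2])
      omega
  let qf : Function.support f → Q := fun v l j =>
    ⟨(⌊act h (castv v.1.1) l j⌋ + (n + 1)).toNat, by have := hfl v l j; omega⟩
  have hqf : ∀ v w : Function.support f, qf v = qf w → ∀ l j,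
      ⌊act h (castv v.1.1) l j⌋ = ⌊act h (castv w.1.1) l j⌋ := by
    intro v w hvw l j
    have := congrArg Fin.val (congrFun (congrFun hvw l) j)
    simp only [qf] at this
    have h1 := hfl v l j; have h2 := hfl w l j
    omega
  by_cases hne : Nonempty (Function.support f)
  swap
  · have : ∀ v, f v = 0 := by
      intro v; by_contra hv; exact hne ⟨⟨v, hv⟩⟩
    rw [show f = fun _ => 0 from funext this]
    simp
  have hrep : ∀ v, qf (Function.invFun qf (qf v)) = qf v := fun v => Function.invFun_eq ⟨v, rfl⟩
  have := tsum_le_inj f (fun p : Q × (Set.univ : Set (Fin k → Fin d → ℤ)) =>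
    (bx d k 1).indicator (fun _ => (1:ℝ≥0∞)) (act h (castv p.2.1)))
    (fun v => (qf v, ⟨v.1.1 - (Function.invFun qf (qf v)).1.1, Set.mem_univ _⟩)) (by
      intro v w hvw
      rw [Prod.mk.injEq, Subtype.mk.injEq] at hvw
      obtain ⟨h1, h2⟩ := hvw
      rw [h1] at h2
      exact Subtype.ext (Subtype.ext (sub_left_injective h2))) (by
      intro v
      rw [Set.indicator_of_mem]
      · simp only [hf]; exact Set.indicator_apply_le' (fun _ => le_rfl) (fun _ => zero_le)
      · intro l j
        rw [act_castv_sub]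
        exact Int.abs_sub_lt_one_of_floor_eq_floor (hqf _ _ (hrep v).symm l j))
  refine this.trans ?_
  rw [ENNReal.tsum_prod', tsum_fintype]
  simp only [Finset.sum_const, Finset.card_univ, nsmul_eq_mul]
  gcongr
  simp only [Q, Fintype.card_pi, Fintype.card_fin, Finset.prod_const, Finset.card_univ]
  rw [← pow_mul]
  have : ENNReal.ofReal (2 * (n + 1)) = ((2 * (n+1) : ℕ) : ℝ≥0∞) := by
    rw [← ENNReal.ofReal_natCast]; push_cast; rfl
  rw [this, Nat.cast_pow]

theorem stable_LI {d k N : ℕ} (v₀ : Fin d → ℤ) :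
    StableN N {v : Fin k → Fin d → ℤ | v ∈ Oall k N v₀ ∧ LinearIndependent ℤ v} := by
  intro z hz v hv
  refine ⟨fun l j => ?_, ?_⟩
  · have e1 : (z : Matrix (Fin d) (Fin d) ℤ).mulVec (v l) j - v₀ j =
        ∑ i, (z j i - (1 : Matrix (Fin d) (Fin d) ℤ) j i) * v l i + (v l j - v₀ j) := by
      simp only [Matrix.mulVec, dotProduct, sub_mul, Finset.sum_sub_distrib, Matrix.one_apply]
      simp
    rw [e1]
    exact dvd_add (Finset.dvd_sum fun i _ => (hz j i).mul_right _) (hv.1 l j)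
  · let e : (Fin d → ℤ) ≃ₗ[ℤ] (Fin d → ℤ) := Matrix.SpecialLinearGroup.toLin' z
    exact hv.2.map' (e : (Fin d → ℤ) →ₗ[ℤ] (Fin d → ℤ)) e.ker

theorem split_sum {d k N : ℕ} (v₀ : Fin d → ℤ) (F : (Fin k → Fin d → ℤ) → ℝ≥0∞) :
    ∑' v : Oall k N v₀, F v.1 =
    ∑' v : {v : Fin k → Fin d → ℤ | v ∈ Oall k N v₀ ∧ LinearIndependent ℤ v}, F v.1 +
    ∑' v : {v : Fin k → Fin d → ℤ | v ∈ Oall k N v₀ ∧ ¬ LinearIndependent ℤ v}, F v.1 := by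
  classical
  rw [tsum_subtype, tsum_subtype (s := {v | v ∈ Oall k N v₀ ∧ LinearIndependent ℤ v}), 
    tsum_subtype (s := {v | v ∈ Oall k N v₀ ∧ ¬ LinearIndependent ℤ v}), ← ENNReal.tsum_add]
  refine tsum_congr fun v => ?_
  by_cases h1 : v ∈ Oall k N v₀ <;> by_cases h2 : LinearIndependent ℤ v <;>
    simp [Set.indicator_apply, h1, h2]

theorem meas_sum {d k : ℕ} (O : Set (Fin k → Fin d → ℤ)) (E : Set (Fin k → Fin d → ℝ))
    (hE : MeasurableSet E) : Measurable fun h : SLR d =>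
      ∑' v : O, E.indicator (fun _ => (1:ℝ≥0∞)) (act h (castv v.1)) :=
  Measurable.tsum fun _ => (measurable_const.indicator hE).comp (meas_act_left _)

/-- main identity: the mean equals `N^{-dk} vol E` plus a controlled remainder -/
theorem main_id {d N k : ℕ} (hk : 1 ≤ k) (hkd : k + 2 ≤ d) (hN : 0 < N) (v₀ : Fin d → ℤ) (m : Measure (SLR d))
    [IsProbabilityMeasure m]
    (hG : ∀ (r : ℕ) (O : Set (Fin r → Fin d → ℤ)), StableN N O → GInv (nu m O)) :
    ∃ K : ℝ≥0∞, K ≠ ∞ ∧ ∀ (E : Set (Fin k → Fin d → ℝ)) (V : ℝ≥0∞), MeasurableSet E →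
      (∀ r, r < k → ∀ ι : Fin r → Fin k, Function.Injective ι →
        ∃ E' : Set (Fin r → Fin d → ℝ), MeasurableSet E' ∧ (∀ x ∈ E, (fun j => x (ι j)) ∈ E') ∧
          volume E' ≤ V) →
      ∃ L : ℝ≥0∞, L ≤ K * V ∧
      ∫⁻ h, ∑' v : Oall k N v₀, E.indicator (fun _ => (1:ℝ≥0∞)) (act h (castv v.1)) ∂m =
        ((N:ℝ≥0∞) ^ (d * k))⁻¹ * volume E + L := by
  classical
  obtain ⟨K, hK, hKb⟩ := cover_bound hkd m hG k
    {v : Fin k → Fin d → ℤ | v ∈ Oall k N v₀ ∧ ¬ LinearIndependent ℤ v} (by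
      intro v hv
      obtain ⟨r, _, hr, ι, hι⟩ := Lset_cover v
      exact ⟨r, hr hv.2, ι, hι⟩)
  obtain ⟨c, hc⟩ := nu_unique (show k < d by omega)
    (nu m {v : Fin k → Fin d → ℤ | v ∈ Oall k N v₀ ∧ LinearIndependent ℤ v}) (hG _ _ (stable_LI v₀))
      (nu_generic m _ fun v hv => hv.2)
  obtain ⟨K2, hK2, hKb2⟩ := cover_bound hkd m hG (k+1) (Set.univ : Set (Fin k → Fin d → ℤ)) (by
      intro v hv
      obtain ⟨r, hr, _, ι, hι⟩ := Lset_cover v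
      exact ⟨r, by omega, ι, hι⟩)
  have hid : ∀ E : Set (Fin k → Fin d → ℝ), MeasurableSet E →
      ∫⁻ h, ∑' v : Oall k N v₀, E.indicator (fun _ => (1:ℝ≥0∞)) (act h (castv v.1)) ∂m =
        c * volume E + ∫⁻ h, ∑' v : {v : Fin k → Fin d → ℤ | v ∈ Oall k N v₀ ∧ ¬ LinearIndependent ℤ v}, 
          E.indicator (fun _ => (1:ℝ≥0∞)) (act h (castv v.1)) ∂m := by
    intro E hE
    have h1 := nu_apply m {v : Fin k → Fin d → ℤ | v ∈ Oall k N v₀ ∧ LinearIndependent ℤ v} E hE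
    rw [hc, Measure.smul_apply, smul_eq_mul] at h1
    rw [h1, ← lintegral_add_left (meas_sum _ E hE)]
    refine lintegral_congr fun h => ?_
    exact split_sum v₀ (fun v => E.indicator (fun _ => (1:ℝ≥0∞)) (act h (castv v)))
  have hf : ∫⁻ h, ∑' v : (Set.univ : Set (Fin k → Fin d → ℤ)), (bx d k 1).indicator (fun _ => (1:ℝ≥0∞))
      (act h (castv v.1)) ∂m ≠ ∞ := by
    refine ne_top_of_le_ne_top ?_ (hKb2 (bx d k 1) (2 ^ (d * k)) (bx_open _ _ _).measurableSet ?_)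
    · exact ENNReal.mul_ne_top hK2 (by simp)
    · intro r hr ι _
      refine ⟨bx d r 1, (bx_open _ _ _).measurableSet, fun x hx l j => hx _ _, ?_⟩
      rw [bx_vol]
      simp only [mul_one, ENNReal.ofReal_ofNat]
      exact pow_le_pow_right₀ (by norm_num) (Nat.mul_le_mul_left _ (by omega))
  have hND0 : ((N:ℝ≥0∞) ^ (d * k)) ≠ 0 := pow_ne_zero _ (by exact_mod_cast hN.ne')
  have hNDt : ((N:ℝ≥0∞) ^ (d * k)) ≠ ∞ := by simp
  set G : ℕ → SLR d → ℝ≥0∞ := fun n h => (N : ℝ≥0∞) ^ (d * k) *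
      (∑' v : Oall k N v₀, (bx d k (n+1)).indicator (fun _ => (1:ℝ≥0∞)) (act h (castv v.1))) /
        (ENNReal.ofReal (2 * (n + 1))) ^ (d * k) with hGd
  have hp0 : ∀ n : ℕ, (ENNReal.ofReal (2 * ((n:ℝ) + 1))) ^ (d * k) ≠ 0 := fun n =>
    pow_ne_zero _ (by rw [Ne, ENNReal.ofReal_eq_zero, not_le]; positivity)
  have hpt : ∀ n : ℕ, (ENNReal.ofReal (2 * ((n:ℝ) + 1))) ^ (d * k) ≠ ∞ := fun n =>
    ENNReal.pow_ne_top ENNReal.ofReal_ne_top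
  have hlim : Filter.Tendsto (fun n => ∫⁻ h, G n h ∂m) Filter.atTop (nhds 1) := by
    have := tendsto_lintegral_of_dominated_convergence (μ := m) (F := G) (f := fun _ => 1)
      (fun h => (N : ℝ≥0∞) ^ (d * k) * ∑' v : (Set.univ : Set (Fin k → Fin d → ℤ)),
        (bx d k 1).indicator (fun _ => (1:ℝ≥0∞)) (act h (castv v.1)))
      (fun n => ((meas_sum _ _ (bx_open _ _ _).measurableSet).const_mul _).div_const _) (by
        intro n
        refine Filter.Eventually.of_forall fun h => ?_
        simp only [hGd]
        refine ENNReal.div_le_of_le_mul ?_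
        rw [mul_assoc]
        gcongr
        rw [mul_comm]
        exact cnt_dom v₀ h n) (by
        rw [lintegral_const_mul _ (meas_sum _ _ (bx_open _ _ _).measurableSet)]
        exact ENNReal.mul_ne_top hNDt hf) (Filter.Eventually.of_forall fun h => cnt_limit hN v₀ h)
    simpa using this
  have hval : ∀ n, ∫⁻ h, G n h ∂m = (N : ℝ≥0∞) ^ (d * k) * c + (N : ℝ≥0∞) ^ (d * k) * 
      ((∫⁻ h, ∑' v : {v : Fin k → Fin d → ℤ | v ∈ Oall k N v₀ ∧ ¬ LinearIndependent ℤ v}, 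
          (bx d k (n+1)).indicator (fun _ => (1:ℝ≥0∞)) (act h (castv v.1)) ∂m) / 
        (ENNReal.ofReal (2 * (n + 1))) ^ (d * k)) := by
    intro n
    simp only [hGd, div_eq_mul_inv]
    rw [lintegral_mul_const _ ((meas_sum _ _ (bx_open _ _ _).measurableSet).const_mul _),
      lintegral_const_mul _ (meas_sum _ _ (bx_open _ _ _).measurableSet), hid _ (bx_open _ _ _).measurableSet,
      bx_vol, mul_assoc, add_mul, mul_assoc c, ENNReal.mul_inv_cancel (hp0 n) (hpt n), mul_one, mul_add]
  have hval2 : Filter.Tendsto (fun n => ∫⁻ h, G n h ∂m) Filter.atTop (nhds ((N : ℝ≥0∞) ^ (d * k) * c)) := by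
    have hz : Filter.Tendsto (fun n : ℕ => 
      ((∫⁻ h, ∑' v : {v : Fin k → Fin d → ℤ | v ∈ Oall k N v₀ ∧ ¬ LinearIndependent ℤ v}, 
          (bx d k (n+1)).indicator (fun _ => (1:ℝ≥0∞)) (act h (castv v.1)) ∂m) / 
        (ENNReal.ofReal (2 * (n + 1))) ^ (d * k))) Filter.atTop (nhds 0) := by
      have hub : Filter.Tendsto (fun n : ℕ => K * ENNReal.ofReal (1 / ((n:ℝ) + 1))) Filter.atTop (nhds 0) := by
        have h1 := ENNReal.tendsto_ofReal (tendsto_one_div_add_atTop_nhds_zero_nat (𝕜 := ℝ))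
        have h2 := ENNReal.Tendsto.const_mul (a := K) h1 (Or.inr hK)
        simpa using h2
      refine tendsto_of_tendsto_of_tendsto_of_le_of_le tendsto_const_nhds hub (fun _ => zero_le) ?_
      intro n
      dsimp only
      have h1 := hKb (bx d k (n+1)) ((ENNReal.ofReal (2 * (n + 1))) ^ (d * (k - 1)))
        (bx_open _ _ _).measurableSet (by
          intro r hr ι _
          refine ⟨bx d r (n+1), (bx_open _ _ _).measurableSet, fun x hx l j => hx _ _, ?_⟩
          rw [bx_vol]
          refine pow_le_pow_right₀ ?_ (Nat.mul_le_mul_left _ (by omega))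
          rw [ENNReal.one_le_ofReal]
          have : (0:ℝ) ≤ n := by positivity
          linarith)
      refine (ENNReal.div_le_div_right h1 _).trans ?_
      rw [mul_div_assoc]
      gcongr
      have hx : (0:ℝ) < 2 * (n + 1) := by positivity
      rw [← ENNReal.ofReal_pow hx.le, ← ENNReal.ofReal_pow hx.le, ← ENNReal.ofReal_div_of_pos (by positivity)]
      refine ENNReal.ofReal_le_ofReal ?_
      rw [div_le_div_iff₀ (by positivity) (by positivity)]
      have hx1 : (1:ℝ) ≤ 2 * (n + 1) := by
        have : (0:ℝ) ≤ n := by positivity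
        linarith
      calc (2 * ((n:ℝ) + 1)) ^ (d * (k-1)) * (n + 1) ≤ (2 * ((n:ℝ) + 1)) ^ (d * (k-1)) * (2 * (n + 1)) := by
            gcongr; linarith
        _ = (2 * ((n:ℝ) + 1)) ^ (d * (k-1) + 1) := by rw [pow_succ]
        _ ≤ (2 * ((n:ℝ) + 1)) ^ (d * k) := by
            refine pow_le_pow_right₀ hx1 ?_
            obtain ⟨k', rfl⟩ : ∃ k', k = k' + 1 := ⟨k - 1, by omega⟩
            simp only [Nat.add_sub_cancel, mul_add, mul_one]; omega
        _ = 1 * (2 * ((n:ℝ) + 1)) ^ (d * k) := (one_mul _).symm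
    have h2 := (ENNReal.Tendsto.const_mul (a := (N : ℝ≥0∞) ^ (d * k)) hz (Or.inr hNDt)).const_add
      ((N : ℝ≥0∞) ^ (d * k) * c)
    simp only [mul_zero, add_zero] at h2
    exact h2.congr fun n => (hval n).symm
  have hcN : (N : ℝ≥0∞) ^ (d * k) * c = 1 := tendsto_nhds_unique hval2 hlim
  have hc' : c = ((N : ℝ≥0∞) ^ (d * k))⁻¹ := ENNReal.eq_inv_of_mul_eq_one_left (by rwa [mul_comm] at hcN)
  refine ⟨K, hK, fun E V hE hV => ⟨_, hKb E V hE hV, ?_⟩⟩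
  rw [hid E hE, hc']

abbrev VV (n : ℕ) := Fin n → ℝ × ℝ

def om {n : ℕ} (x y : VV n) : ℝ := ∑ i, ((x i).1 * (y i).2 - (x i).2 * (y i).1)

theorem om_cont {n : ℕ} : Continuous fun z : VV n × VV n => om z.1 z.2 := by
  unfold om; fun_prop

theorem om_succ {n : ℕ} (i0 : Fin (n+1)) (x y : VV (n+1)) :
    om x y = ((x i0).1 * (y i0).2 - (x i0).2 * (y i0).1) +
      om (fun j => x (i0.succAbove j)) (fun j => y (i0.succAbove j)) := by
  unfold om
  rw [Fin.sum_univ_succAbove _ i0]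

theorem om_sub_smul {n : ℕ} (w z z' : VV n) (α α' : ℝ) :
    om (z - α • w) (z' - α' • w) = om z z' - α * om w z' + α' * om w z := by
  unfold om
  rw [Finset.mul_sum, Finset.mul_sum, ← Finset.sum_sub_distrib, ← Finset.sum_add_distrib]
  refine Finset.sum_congr rfl fun i _ => ?_
  simp only [Pi.sub_apply, Pi.smul_apply, Prod.fst_sub, Prod.snd_sub, Prod.smul_fst, Prod.smul_snd, smul_eq_mul]
  ring

def al (p t : ℝ × ℝ) : ℝ := (t.1 * p.1 + t.2 * p.2) / (p.1^2 + p.2^2)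
def dd (p t : ℝ × ℝ) : ℝ := p.1 * t.2 - p.2 * t.1

theorem mp_lin (p : ℝ × ℝ) (hp : 0 < p.1^2 + p.2^2) :
    MeasurePreserving (fun t : ℝ × ℝ => (al p t, dd p t)) volume volume := by
  set q := p.1^2 + p.2^2 with hq
  let M : Matrix (Fin 2) (Fin 2) ℝ := !![p.1/q, p.2/q; -p.2, p.1]
  let L := Matrix.toLin (Module.Basis.finTwoProd ℝ) (Module.Basis.finTwoProd ℝ) M
  have hL : (fun t : ℝ × ℝ => (al p t, dd p t)) = L := by
    funext t
    have := Matrix.toLin_finTwoProd_apply (p.1/q) (p.2/q) (-p.2) p.1 t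
    simp only [L, M]
    rw [this]
    simp only [al, dd, ← hq]
    ext
    · simp only []; field_simp; try ring
    · simp only []; ring
  have hdet : LinearMap.det L = 1 := by
    simp only [L, LinearMap.det_toLin, M, Matrix.det_fin_two_of]
    field_simp
    rw [hq]; ring
  refine ⟨?_, ?_⟩
  · unfold al dd; fun_prop
  · rw [hL, Measure.map_linearMap_addHaar_eq_smul_addHaar volume (f := L) (by rw [hdet]; exact one_ne_zero), hdet]
    simp

theorem mp_phi {n : ℕ} (u : VV (n+1)) (i0 : Fin (n+1)) (hp : 0 < (u i0).1^2 + (u i0).2^2) :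
    MeasurePreserving (fun x : VV (n+1) =>
      (((al (u i0) (x i0), om u x) : ℝ × ℝ),
        (fun j => x (i0.succAbove j)) - al (u i0) (x i0) • (fun j => u (i0.succAbove j))))
      volume volume := by
  set w : VV n := fun j => u (i0.succAbove j) with hw
  have h1 := volume_preserving_piFinSuccAbove (fun _ : Fin (n+1) => ℝ × ℝ) i0
  have h2 : MeasurePreserving (fun z : (ℝ × ℝ) × VV n => ((al (u i0) z.1, dd (u i0) z.1), z.2)) volume volume :=
    (mp_lin (u i0) hp).prod (MeasurePreserving.id (volume : Measure (VV n)))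
  have h3 : MeasurePreserving (fun z : (ℝ × ℝ) × VV n => (z.1, z.2 - z.1.1 • w)) volume volume := by
    refine MeasurePreserving.skew_product (f := id) (g := fun (a : ℝ × ℝ) (y : VV n) => y - a.1 • w)
      (MeasurePreserving.id _) ?_ (Filter.Eventually.of_forall fun a => ?_)
    · apply Continuous.measurable; simp only [Function.uncurry_def]; fun_prop
    · exact map_sub_right_eq_self volume (a.1 • w)
  have h4 : MeasurePreserving (fun z : (ℝ × ℝ) × VV n => ((z.1.1, z.1.2 + om w z.2), z.2)) volume volume := by
    have hsw : MeasurePreserving (fun z : VV n × (ℝ × ℝ) => (z.1, ((z.2.1, z.2.2 + om w z.1) : ℝ × ℝ))) volume volume := by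
      refine MeasurePreserving.skew_product (f := id) (g := fun (y : VV n) (a : ℝ × ℝ) => ((a.1, a.2 + om w y) : ℝ × ℝ))
        (MeasurePreserving.id _) ?_ (Filter.Eventually.of_forall fun a => ?_)
      · apply Continuous.measurable; simp only [Function.uncurry_def, om]; fun_prop
      · have := map_add_right_eq_self (volume : Measure (ℝ × ℝ)) (0, om w a)
        simpa [Prod.add_def] using this
    exact (Measure.measurePreserving_swap.comp hsw).comp Measure.measurePreserving_swap
  have := h4.comp (h3.comp (h2.comp h1))
  refine Eq.subst (motive := fun f : VV (n+1) → (ℝ × ℝ) × VV n => MeasurePreserving f volume volume)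
    (Eq.symm (funext fun x => ?_)) this
  simp only [Function.comp, MeasurableEquiv.piFinSuccAbove_apply, Fin.insertNthEquiv_symm_apply]
  ext1
  · ext1
    · rfl
    · simp only []
      rw [om_succ i0, ← hw]
      have := om_sub_smul w w (fun j => x (i0.succAbove j)) 0 (al (u i0) (x i0))
      have e : om w w = 0 := by unfold om; exact Finset.sum_eq_zero fun i _ => by ring
      rw [zero_smul, sub_zero, e] at this
      simp only [Fin.removeNth_apply, dd] 
      change _ = _ + om w ((fun j => x (i0.succAbove j)) - al (u i0) (x i0) • w)
      rw [this]; ring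
  · rfl

def WS (n r : ℕ) (S K : ℝ) (c : Fin r → Fin r → ℝ) : Set (Fin r → VV n) :=
  {u | (∀ l, ‖u l‖ ≤ S) ∧ ∀ i j, i < j → |om (u i) (u j) - c i j| ≤ K}

theorem om_cont' {n : ℕ} {X : Type*} [TopologicalSpace X] {f g : X → VV n} (hf : Continuous f) (hg : Continuous g) :
    Continuous fun z => om (f z) (g z) := by
  unfold om; fun_prop

theorem om_identity {n : ℕ} (u x x' : VV (n+1)) (i0 : Fin (n+1)) (hp : 0 < (u i0).1^2 + (u i0).2^2) :
    om x x' = om ((fun j => x (i0.succAbove j)) - al (u i0) (x i0) • (fun j => u (i0.succAbove j)))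
      ((fun j => x' (i0.succAbove j)) - al (u i0) (x' i0) • (fun j => u (i0.succAbove j)))
      + al (u i0) (x i0) * om u x' - al (u i0) (x' i0) * om u x := by
  rw [om_sub_smul, om_succ i0 x x', om_succ i0 u x', om_succ i0 u x]
  unfold al
  field_simp
  ring

theorem al_le {p t : ℝ × ℝ} (hp : 0 < ‖p‖) {S : ℝ} (ht : ‖t‖ ≤ S) : |al p t| ≤ 2 * S / ‖p‖ := by
  have h1 : |p.1| ≤ ‖p‖ := norm_fst_le p
  have h2 : |p.2| ≤ ‖p‖ := norm_snd_le p
  have h3 : |t.1| ≤ S := (norm_fst_le t).trans ht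
  have h4 : |t.2| ≤ S := (norm_snd_le t).trans ht
  have hq : ‖p‖^2 ≤ p.1^2 + p.2^2 := by
    rw [Prod.norm_def, Real.norm_eq_abs, Real.norm_eq_abs]
    rcases max_choice |p.1| |p.2| with h | h <;> rw [h, sq_abs] <;> nlinarith [sq_nonneg p.1, sq_nonneg p.2]
  have hqp : 0 < p.1^2 + p.2^2 := lt_of_lt_of_le (by positivity) hq
  unfold al
  rw [abs_div, abs_of_pos hqp, div_le_div_iff₀ hqp hp]
  have hS : 0 ≤ S := (norm_nonneg _).trans ht
  have : |t.1 * p.1 + t.2 * p.2| ≤ 2 * S * ‖p‖ := by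
    calc _ ≤ |t.1 * p.1| + |t.2 * p.2| := abs_add_le _ _
      _ = |t.1| * |p.1| + |t.2| * |p.2| := by rw [abs_mul, abs_mul]
      _ ≤ S * ‖p‖ + S * ‖p‖ := by gcongr
      _ = _ := by ring
  calc _ ≤ 2 * S * ‖p‖ * ‖p‖ := by gcongr
    _ = 2 * S * ‖p‖^2 := by ring
    _ ≤ _ := by gcongr

theorem slice {n s : ℕ} (u : VV (n+1)) (hu : u ≠ 0) (S K : ℝ) (b : Fin s → ℝ) (c : Fin s → Fin s → ℝ) (B : ℝ≥0∞)
    (hB : ∀ c', volume (WS n s (3 * S) K c') ≤ B) :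
    volume {x : Fin s → VV (n+1) | (∀ j, ‖x j‖ ≤ S) ∧ (∀ j, |om u (x j) - b j| ≤ K) ∧
      ∀ i j, i < j → |om (x i) (x j) - c i j| ≤ K} ≤
      (ENNReal.ofReal (4 * S / ‖u‖) * ENNReal.ofReal (2 * K)) ^ s * B := by
  obtain ⟨i0, hi0⟩ : ∃ i0, ‖u i0‖ = ‖u‖ := by
    obtain ⟨i, hi⟩ := Finite.exists_max (fun i => ‖u i‖)
    exact ⟨i, le_antisymm (norm_le_pi_norm u i) ((pi_norm_le_iff_of_nonneg (norm_nonneg _)).2 hi)⟩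
  have hup : 0 < ‖u‖ := norm_pos_iff.2 hu
  have hq : ‖u i0‖^2 ≤ (u i0).1^2 + (u i0).2^2 := by
    rw [Prod.norm_def, Real.norm_eq_abs, Real.norm_eq_abs]
    rcases max_choice |(u i0).1| |(u i0).2| with h | h <;> rw [h, sq_abs] <;> nlinarith [sq_nonneg (u i0).1, sq_nonneg (u i0).2]
  have hqp : 0 < (u i0).1^2 + (u i0).2^2 := lt_of_lt_of_le (by rw [hi0]; positivity) hq
  have hm := (volume_measurePreserving_arrowProdEquivProdArrow (ℝ × ℝ) (VV n) (Fin s)).comp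
    (volume_preserving_pi (fun _ : Fin s => mp_phi u i0 hqp))
  set Q : Set ((Fin s → ℝ × ℝ) × (Fin s → VV n)) := {z |
    (∀ j, z.1 j ∈ Set.Icc (-(2 * S / ‖u‖)) (2 * S / ‖u‖) ×ˢ Set.Icc (b j - K) (b j + K)) ∧
    z.2 ∈ WS n s (3 * S) K (fun i j => c i j - (z.1 i).1 * (z.1 j).2 + (z.1 j).1 * (z.1 i).2)} with hQ
  have hQm : MeasurableSet Q := by
    apply IsClosed.measurableSet
    change IsClosed {z : (Fin s → ℝ × ℝ) × (Fin s → VV n) |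
      (∀ j, z.1 j ∈ Set.Icc (-(2 * S / ‖u‖)) (2 * S / ‖u‖) ×ˢ Set.Icc (b j - K) (b j + K)) ∧
      (∀ l, ‖z.2 l‖ ≤ 3 * S) ∧ ∀ i j, i < j → |om (z.2 i) (z.2 j) -
        (c i j - (z.1 i).1 * (z.1 j).2 + (z.1 j).1 * (z.1 i).2)| ≤ K}
    simp only [Set.ofPred_and, Set.ofPred_forall, Set.mem_prod, Set.mem_Icc]
    refine IsClosed.inter (isClosed_iInter fun j => ?_) (IsClosed.inter (isClosed_iInter fun j => ?_)
      (isClosed_iInter fun i => isClosed_iInter fun j => isClosed_iInter fun _ => ?_))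
    · refine IsClosed.inter (IsClosed.inter ?_ ?_) (IsClosed.inter ?_ ?_) <;>
        exact isClosed_le (by fun_prop) (by fun_prop)
    · exact isClosed_le (by fun_prop) (by fun_prop)
    · refine isClosed_le (Continuous.abs (Continuous.sub (om_cont' (by fun_prop) (by fun_prop)) (by fun_prop))) (by fun_prop)
  have hvQ : volume Q ≤ (ENNReal.ofReal (4 * S / ‖u‖) * ENNReal.ofReal (2 * K)) ^ s * B := by
    rw [Measure.volume_eq_prod, Measure.prod_apply hQm]
    set R : Set (Fin s → ℝ × ℝ) := Set.univ.pi fun j => Set.Icc (-(2 * S / ‖u‖)) (2 * S / ‖u‖) ×ˢ Set.Icc (b j - K) (b j + K)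
    have hR : MeasurableSet R := MeasurableSet.univ_pi fun j => measurableSet_Icc.prod measurableSet_Icc
    calc _ ≤ ∫⁻ x, R.indicator (fun _ => B) x := by
          refine lintegral_mono fun x => ?_
          by_cases hx : x ∈ R
          · rw [Set.indicator_of_mem hx]
            refine le_trans (measure_mono ?_) (hB (fun i j => c i j - (x i).1 * (x j).2 + (x j).1 * (x i).2))
            intro y hy; exact hy.2
          · rw [Set.indicator_of_notMem hx, nonpos_iff_eq_zero]
            convert measure_empty (μ := (volume : Measure (Fin s → VV n)))
            ext y
            simp only [Set.mem_preimage, hQ, Set.mem_ofPred_eq, Set.mem_empty_iff_false, iff_false]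
            intro h
            exact hx fun j _ => h.1 j
      _ = B * volume R := by rw [lintegral_indicator hR, setLIntegral_const]
      _ = _ := by
          rw [mul_comm, volume_pi_pi]
          congr 1
          have : ∀ j, volume (Set.Icc (-(2 * S / ‖u‖)) (2 * S / ‖u‖) ×ˢ Set.Icc (b j - K) (b j + K)) =
              ENNReal.ofReal (4 * S / ‖u‖) * ENNReal.ofReal (2 * K) := by
            intro j
            rw [Measure.volume_eq_prod, Measure.prod_prod, Real.volume_Icc, Real.volume_Icc]
            congr 2 <;> ring
          simp only [this, Finset.prod_const, Finset.card_univ, Fintype.card_fin]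
  refine le_trans ?_ hvQ
  rw [← hm.measure_preimage hQm.nullMeasurableSet]
  refine measure_mono fun x hx => ?_
  obtain ⟨h1, h2, h3⟩ := hx
  have ha : ∀ j, |al (u i0) (x j i0)| ≤ 2 * S / ‖u‖ := fun j => by
    rw [← hi0]; exact al_le (by rw [hi0]; exact hup) ((norm_le_pi_norm _ _).trans (h1 j))
  refine ⟨fun j => ⟨abs_le.1 (ha j), ?_⟩, fun j => ?_, fun i j hij => ?_⟩
  · have := abs_le.1 (h2 j)
    exact ⟨by change _ ≤ om u (x j); linarith, by change om u (x j) ≤ _; linarith⟩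
  · change ‖(fun l => x j (i0.succAbove l)) - al (u i0) (x j i0) • (fun l => u (i0.succAbove l))‖ ≤ 3 * S
    have hS : 0 ≤ S := (norm_nonneg _).trans (h1 j)
    have e1 : ‖(fun l => x j (i0.succAbove l))‖ ≤ S := (pi_norm_le_iff_of_nonneg hS).2 fun l => (norm_le_pi_norm (x j) _).trans (h1 j)
    have e2 : ‖(fun l => u (i0.succAbove l))‖ ≤ ‖u‖ := (pi_norm_le_iff_of_nonneg (norm_nonneg _)).2 fun l => norm_le_pi_norm u _
    calc _ ≤ ‖(fun l => x j (i0.succAbove l))‖ + ‖al (u i0) (x j i0) • (fun l => u (i0.succAbove l))‖ := norm_sub_le _ _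
      _ ≤ S + 2 * S / ‖u‖ * ‖u‖ := by
        rw [norm_smul, Real.norm_eq_abs]
        have := ha j
        gcongr
      _ = 3 * S := by field_simp; ring
  · have := h3 i j hij
    rw [om_identity u (x i) (x j) i0 hqp] at this
    change |om ((fun l => x i (i0.succAbove l)) - al (u i0) (x i i0) • (fun l => u (i0.succAbove l)))
      ((fun l => x j (i0.succAbove l)) - al (u i0) (x j i0) • (fun l => u (i0.succAbove l))) -
      (c i j - al (u i0) (x i i0) * om u (x j) + al (u i0) (x j i0) * om u (x i))| ≤ K
    convert this using 2
    ring

theorem norm_int {D s : ℕ} (hs : s < 2 * D) {S : ℝ} (hS : 0 < S) :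
    ∫⁻ v : VV D, (Metric.closedBall (0 : VV D) S).indicator (fun v => ENNReal.ofReal ((‖v‖ ^ s)⁻¹)) v ≤
      ENNReal.ofReal (2 * D * 4 ^ D * S ^ (2 * D - s)) := by
  have hD : 0 < D := by omega
  have : Nonempty (Fin D) := ⟨⟨0, hD⟩⟩
  have : Nontrivial (VV D) := inferInstance
  have hdim : Module.finrank ℝ (VV D) = 2 * D := by
    simp [Module.finrank_pi_fintype, mul_comm]
  set f : ℝ → ℝ := (Set.Iic S).indicator (fun y => (y ^ s)⁻¹) with hf
  have key : Set.EqOn (fun y : ℝ => y ^ (2 * D - 1) • f y) ((Set.Ioc 0 S).indicator fun y => y ^ (2 * D - 1 - s)) (Set.Ioi 0) := by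
    intro y hy
    have hy' : 0 < y := hy
    simp only [hf]
    by_cases h : y ≤ S
    · rw [Set.indicator_of_mem (show y ∈ Set.Iic S from h), Set.indicator_of_mem (show y ∈ Set.Ioc 0 S from ⟨hy', h⟩)]
      rw [smul_eq_mul, pow_sub₀ y hy'.ne' (show s ≤ 2 * D - 1 by omega)]
    · rw [Set.indicator_of_notMem (show y ∉ Set.Iic S from h), Set.indicator_of_notMem (fun h' => h h'.2)]
      simp
  have hintc : IntegrableOn (fun y : ℝ => y ^ (2 * D - 1 - s)) (Set.Ioc 0 S) :=
    ((continuous_pow _).integrableOn_Icc (a := 0) (b := S)).mono_set Set.Ioc_subset_Icc_self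
  have hint : Integrable (fun v : VV D => f ‖v‖) := by
    rw [integrable_fun_norm_addHaar volume, hdim, integrableOn_congr_fun key measurableSet_Ioi]
    exact (hintc.integrable_indicator measurableSet_Ioc).integrableOn
  have hval : ∫ v : VV D, f ‖v‖ ≤ 2 * D * 4 ^ D * S ^ (2 * D - s) := by
    rw [integral_fun_norm_addHaar volume, hdim, setIntegral_congr_fun measurableSet_Ioi key,
      setIntegral_indicator measurableSet_Ioc,
      Set.inter_eq_self_of_subset_right (Set.Ioc_subset_Ioi_self : Set.Ioc 0 S ⊆ Set.Ioi (0:ℝ)),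
      ← intervalIntegral.integral_of_le hS.le, integral_pow]
    have hb : volume.real (Metric.ball (0 : VV D) 1) = 4 ^ D := by
      rw [measureReal_def, ball_pi _ one_pos, volume_pi_pi]
      have : ∀ i : Fin D, volume (Metric.ball ((0 : VV D) i) 1) = 4 := by
        intro i
        rw [show (0 : VV D) i = ((0:ℝ),(0:ℝ)) from rfl, ← ball_prod_same, Measure.volume_eq_prod, Measure.prod_prod, Real.volume_ball]
        rw [← ENNReal.ofReal_mul (by norm_num)]; norm_num
      rw [Finset.prod_congr rfl fun i _ => this i]; simp
    rw [hb]
    have e : 2 * D - 1 - s + 1 = 2 * D - s := by omega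
    rw [e, zero_pow (by omega), sub_zero]
    have h1 : (1:ℝ) ≤ (((2 * D - 1 - s : ℕ) : ℝ) + 1) := by
      have : (0:ℝ) ≤ ((2 * D - 1 - s : ℕ) : ℝ) := Nat.cast_nonneg _
      linarith
    rw [nsmul_eq_mul, smul_eq_mul]
    push_cast
    rw [mul_assoc (2 * (D:ℝ))]
    gcongr
    exact div_le_self (by positivity) h1
  calc _ = ∫⁻ v : VV D, ENNReal.ofReal (f ‖v‖) := by
        refine lintegral_congr fun v => ?_
        simp only [hf, Set.indicator, Metric.mem_closedBall, dist_zero_right, Set.mem_Iic]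
        split_ifs <;> simp
    _ = ENNReal.ofReal (∫ v : VV D, f ‖v‖) := by
        rw [ofReal_integral_eq_lintegral_ofReal hint (Filter.Eventually.of_forall fun v => ?_)]
        simp only [hf, Pi.zero_apply]
        exact Set.indicator_apply_nonneg fun _ => by positivity
    _ ≤ _ := ENNReal.ofReal_le_ofReal hval

theorem WS_closed (n r : ℕ) (S K : ℝ) (c) : IsClosed (WS n r S K c) := by
  change IsClosed {u : Fin r → VV n | (∀ l, ‖u l‖ ≤ S) ∧ ∀ i j, i < j → |om (u i) (u j) - c i j| ≤ K}
  simp only [Set.ofPred_and, Set.ofPred_forall]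
  refine IsClosed.inter (isClosed_iInter fun j => isClosed_le (by fun_prop) (by fun_prop))
      (isClosed_iInter fun i => isClosed_iInter fun j => isClosed_iInter fun _ =>
        isClosed_le (Continuous.abs (Continuous.sub (om_cont' (by fun_prop) (by fun_prop)) (by fun_prop))) (by fun_prop))

theorem WS_vol (r : ℕ) : ∀ n, r ≤ n → ∀ K : ℝ, 0 ≤ K → ∃ C : ℝ, 0 ≤ C ∧ ∀ S : ℝ, 0 < S → ∀ c,
    volume (WS n r S K c) ≤ ENNReal.ofReal (C * S ^ (r * (2 * n + 1 - r))) := by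
  induction r with
  | zero =>
    intro n _ K _
    refine ⟨1, zero_le_one, fun S hS c => ?_⟩
    refine (measure_mono (Set.subset_univ _)).trans ?_
    rw [← Set.pi_univ Set.univ, volume_pi_pi]
    simp
  | succ s ih =>
    intro n hn K hK
    obtain ⟨m, rfl⟩ : ∃ m, n = m + 1 := ⟨n - 1, by omega⟩
    obtain ⟨C, hC, hCS⟩ := ih m (by omega) K hK
    refine ⟨8 ^ s * K ^ s * (C * 3 ^ (s * (2 * m + 1 - s))) * (2 * (m+1 : ℕ) * 4 ^ (m+1)), by positivity, fun S hS c => ?_⟩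
    have hmp := (volume_preserving_piFinSuccAbove (fun _ : Fin (s+1) => VV (m+1)) 0).symm
    have hcl := (WS_closed (m+1) (s+1) S K c).measurableSet
    rw [← hmp.measure_preimage hcl.nullMeasurableSet, Measure.volume_eq_prod,
      Measure.prod_apply (hmp.measurable hcl)]
    set B := ENNReal.ofReal (C * (3 * S) ^ (s * (2 * m + 1 - s))) with hB
    have hstep : ∀ᵐ u : VV (m+1), volume (Prod.mk u ⁻¹' ((MeasurableEquiv.piFinSuccAbove (fun _ : Fin (s+1) => VV (m+1)) 0).symm ⁻¹' WS (m+1) (s+1) S K c))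
        ≤ ENNReal.ofReal ((8 * S * K) ^ s) * B * (Metric.closedBall (0 : VV (m+1)) S).indicator (fun v => ENNReal.ofReal ((‖v‖ ^ s)⁻¹)) u := by
      have h0 : ∀ᵐ u : VV (m+1), u ≠ 0 := by
        rw [ae_iff]
        simp only [ne_eq, not_not]
        have e : {a : VV (m+1) | a = 0} = Set.univ.pi fun _ => ({(0, 0)} : Set (ℝ × ℝ)) := by
          ext a
          simp only [Set.mem_ofPred_eq, Set.mem_univ_pi, Set.mem_singleton_iff, funext_iff]
          rfl
        rw [e, volume_pi_pi, ← Set.singleton_prod_singleton]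
        refine Finset.prod_eq_zero (Finset.mem_univ 0) ?_
        rw [Measure.volume_eq_prod, Measure.prod_prod]; simp
      filter_upwards [h0] with u hu
      by_cases hS' : ‖u‖ ≤ S
      · rw [Set.indicator_of_mem (by simpa using hS')]
        have hup : 0 < ‖u‖ := norm_pos_iff.2 hu
        refine (measure_mono ?_).trans ((slice u hu S K (fun j => c 0 j.succ) (fun i j => c i.succ j.succ) B
          (fun c' => hCS (3 * S) (by positivity) c')).trans (le_of_eq ?_))
        · rintro x ⟨h1, h2⟩
          refine ⟨fun j => ?_, fun j => ?_, fun i j hij => ?_⟩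
          · simpa using h1 j.succ
          · simpa using h2 0 j.succ (Fin.succ_pos _)
          · simpa using h2 i.succ j.succ (Fin.succ_lt_succ_iff.2 hij)
        · have e : (8 * S * K) ^ s * (‖u‖ ^ s)⁻¹ = (4 * S / ‖u‖ * (2 * K)) ^ s := by
            rw [← inv_pow, ← mul_pow]
            congr 1
            field_simp; ring
          rw [mul_right_comm (ENNReal.ofReal ((8 * S * K) ^ s)), ← ENNReal.ofReal_mul (p := 4 * S / ‖u‖) (by positivity),
            ← ENNReal.ofReal_pow (by positivity), ← ENNReal.ofReal_mul (p := (8 * S * K) ^ s) (by positivity), e]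
      · rw [Set.indicator_of_notMem (by simpa using hS'), mul_zero, nonpos_iff_eq_zero]
        convert measure_empty (μ := (volume : Measure (Fin s → VV (m+1))))
        ext x
        simp only [Set.mem_empty_iff_false, iff_false]
        intro h
        exact hS' (by simpa using h.1 0)
    refine (lintegral_mono_ae hstep).trans ?_
    rw [lintegral_const_mul']
    swap
    · exact ENNReal.mul_ne_top ENNReal.ofReal_ne_top ENNReal.ofReal_ne_top
    refine (mul_le_mul_right (norm_int (D := m+1) (s := s) (by omega) hS) _).trans ?_
    rw [hB, ← ENNReal.ofReal_mul (by positivity), ← ENNReal.ofReal_mul (by positivity)]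
    refine ENNReal.ofReal_le_ofReal (le_of_eq ?_)
    obtain ⟨t, ht⟩ : ∃ t, 2 * (m+1) = s + t := ⟨2 * (m+1) - s, by omega⟩
    have e1 : 2 * (m+1) - s = t := by omega
    have e2 : (s + 1) * (2 * (m + 1) + 1 - (s + 1)) = s * (2 * m + 1 - s) + s + t := by
      obtain ⟨q, hq⟩ : ∃ q, m = s + q := ⟨m - s, by omega⟩
      have a1 : 2 * (m + 1) + 1 - (s + 1) = s + 2 * q + 2 := by omega
      have a2 : 2 * m + 1 - s = s + 2 * q + 1 := by omega
      have a3 : t = s + 2 * q + 2 := by omega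
      rw [a1, a2, a3]; ring
    rw [e1, e2, pow_add, pow_add, mul_pow, mul_pow, mul_pow]
    ring

def eFin (n : ℕ) : Fin n ⊕ Fin n ≃ Fin (2 * n) := finSumFinEquiv.trans (finCongr (two_mul n).symm)

theorem eFin_inl {n : ℕ} (i : Fin n) : (eFin n (Sum.inl i) : ℕ) = i := by simp [eFin]
theorem eFin_inr {n : ℕ} (i : Fin n) : (eFin n (Sum.inr i) : ℕ) = n + i := by simp [eFin, add_comm]

def psi (n : ℕ) (x : Fin (2 * n) → ℝ) : VV n := fun i => (x (eFin n (Sum.inl i)), x (eFin n (Sum.inr i)))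

theorem psi_mp (n : ℕ) : MeasurePreserving (psi n) volume volume := by
  have h1 := (volume_measurePreserving_piCongrLeft (fun _ : Fin (2 * n) => ℝ) (eFin n)).symm
  have h2 := volume_measurePreserving_sumPiEquivProdPi (fun _ : Fin n ⊕ Fin n => ℝ)
  have h3 := (volume_measurePreserving_arrowProdEquivProdArrow ℝ ℝ (Fin n)).symm
  exact h3.comp (h2.comp h1)

theorem symp_om (n : ℕ) (x y : Fin (2 * n) → ℝ) : symp n x y = om (psi n x) (psi n y) := by
  have key : ∀ i : Fin n ⊕ Fin n, (Jmat n).mulVec y (eFin n i) = Sum.elim (fun i => y (eFin n (Sum.inr i))) (fun i => - y (eFin n (Sum.inl i))) i := by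
    intro i
    have hs : (Jmat n).mulVec y (eFin n i) = ∑ j : Fin n ⊕ Fin n, Jmat n (eFin n i) (eFin n j) * y (eFin n j) := by
      rw [Matrix.mulVec, dotProduct, ← Equiv.sum_comp (eFin n)]
    rw [hs, Fintype.sum_sum_type]
    rcases i with i | i
    · rw [Finset.sum_eq_zero, Finset.sum_eq_single i, zero_add]
      · simp [Jmat, eFin_inl, eFin_inr, add_comm]
      · intro j _ hj
        have : (j : ℕ) ≠ i := fun h => hj (Fin.ext h)
        have h1 : ¬ ((i : ℕ) + n = n + j) := by omega
        have h2 : ¬ (n + (j : ℕ) + n = i) := by have := i.2; omega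
        simp [Jmat, eFin_inl, eFin_inr, h1, h2]
      · simp
      · intro j _
        have h1 : ¬ ((i : ℕ) + n = j) := by have := j.2; omega
        have h2 : ¬ ((j : ℕ) + n = i) := by have := i.2; omega
        simp [Jmat, eFin_inl, h1, h2]
    · rw [Finset.sum_eq_single i, Finset.sum_eq_zero, add_zero]
      · have h1 : ¬ (n + (i : ℕ) + n = i) := by have := i.2; omega
        have h2 : ((i : ℕ) + n = n + i) := by omega
        simp [Jmat, eFin_inl, eFin_inr, h1, h2]
      · intro j _
        have h1 : ¬ (n + (i : ℕ) + n = n + j) := by have := j.2; omega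
        have h2 : ¬ (n + (j : ℕ) + n = n + i) := by have := i.2; omega
        simp [Jmat, eFin_inr, h1, h2]
      · intro j _ hj
        have : (j : ℕ) ≠ i := fun h => hj (Fin.ext h)
        have h1 : ¬ (n + (i : ℕ) + n = j) := by have := j.2; omega
        have h2 : ¬ ((j : ℕ) + n = n + i) := by omega
        simp [Jmat, eFin_inl, eFin_inr, h1, h2]
      · simp
  rw [symp, dotProduct, ← Equiv.sum_comp (eFin n)]
  simp only [key, Fintype.sum_sum_type, Sum.elim_inl, Sum.elim_inr, om, psi]
  rw [← Finset.sum_add_distrib]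
  refine Finset.sum_congr rfl fun i _ => by ring

theorem symp_cont (n : ℕ) {X : Type*} [TopologicalSpace X] {f g : X → Fin (2*n) → ℝ} (hf : Continuous f) (hg : Continuous g) :
    Continuous fun z => symp n (f z) (g z) := by
  simp only [symp_om]
  apply om_cont' <;> (unfold psi; fun_prop)

theorem symp_anti (n : ℕ) (x y : Fin (2*n) → ℝ) : symp n x y = - symp n y x := by
  simp only [symp_om, om]
  rw [← Finset.sum_neg_distrib]
  exact Finset.sum_congr rfl fun i _ => by ring

def SS (n r : ℕ) (S K : ℝ) : Set (Fin r → Fin (2 * n) → ℝ) :=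
  {u | (∀ l j, |u l j| ≤ S) ∧ ∀ i j, i < j → |symp n (u i) (u j)| ≤ K}

theorem SS_meas (n r : ℕ) (S K : ℝ) : MeasurableSet (SS n r S K) := by
  apply IsClosed.measurableSet
  change IsClosed {u : Fin r → Fin (2 * n) → ℝ | (∀ l j, |u l j| ≤ S) ∧ ∀ i j, i < j → |symp n (u i) (u j)| ≤ K}
  simp only [Set.ofPred_and, Set.ofPred_forall]
  refine IsClosed.inter (isClosed_iInter fun j => isClosed_iInter fun l => isClosed_le (by fun_prop) (by fun_prop))
      (isClosed_iInter fun i => isClosed_iInter fun j => isClosed_iInter fun _ =>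
        isClosed_le (Continuous.abs (symp_cont n (by fun_prop) (by fun_prop))) (by fun_prop))

theorem SS_vol (r n : ℕ) (hr : r ≤ n) (K : ℝ) (hK : 0 ≤ K) : ∃ C : ℝ, 0 ≤ C ∧ ∀ S : ℝ, 0 < S →
    volume (SS n r S K) ≤ ENNReal.ofReal (C * S ^ (r * (2 * n + 1 - r))) := by
  obtain ⟨C, hC, h⟩ := WS_vol r n hr K hK
  refine ⟨C, hC, fun S hS => le_trans ?_ (h S hS 0)⟩
  have hm := volume_preserving_pi (fun _ : Fin r => psi_mp n)
  rw [← hm.measure_preimage (WS_closed n r S K 0).measurableSet.nullMeasurableSet]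
  refine measure_mono fun u hu => ⟨fun l => ?_, fun i j hij => ?_⟩
  · rw [pi_norm_le_iff_of_nonneg hS.le]
    intro i
    rw [Prod.norm_def]
    exact max_le (hu.1 _ _) (hu.1 _ _)
  · have := hu.2 i j hij
    rw [symp_om] at this
    simpa using this

theorem enorm2_cont {d : ℕ} : Continuous (enorm2 (d := d)) := by
  unfold enorm2; fun_prop

theorem EgT_meas (n k : ℕ) (g : SLR (2*n)) (a b : Pairs k → ℝ) (T : ℝ) : MeasurableSet (EgT n k g a b T) := by
  apply IsOpen.measurableSet
  change IsOpen {v : Fin k → Fin (2*n) → ℝ | (∀ p : Pairs k, symp n (v p.1.1) (v p.1.2) ∈ Set.Ioo (a p) (b p)) ∧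
       ∀ l, enorm2 ((g : Matrix (Fin (2*n)) (Fin (2*n)) ℝ).mulVec (v l)) < T}
  simp only [Set.ofPred_and, Set.ofPred_forall]
  refine IsOpen.inter (isOpen_iInter_of_finite fun p => ?_) (isOpen_iInter_of_finite fun l => ?_)
  · exact isOpen_Ioo.preimage (symp_cont n (by fun_prop) (by fun_prop))
  · refine isOpen_lt (enorm2_cont.comp ?_) continuous_const
    exact Continuous.matrix_mulVec continuous_const (by fun_prop)

theorem abs_le_enorm2 {d : ℕ} (v : Fin d → ℝ) (j) : |v j| ≤ enorm2 v := by
  unfold enorm2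
  rw [← Real.sqrt_sq_eq_abs]
  exact Real.sqrt_le_sqrt (Finset.single_le_sum (f := fun i => (v i)^2) (fun i _ => sq_nonneg _) (Finset.mem_univ j))

theorem EgT_bd (n k : ℕ) (g : SLR (2*n)) : ∃ κ : ℝ, 0 < κ ∧ ∀ (a b : Pairs k → ℝ) (T : ℝ), ∀ v ∈ EgT n k g a b T,
    ∀ l j, |v l j| ≤ κ * T := by
  set M : Matrix (Fin (2*n)) (Fin (2*n)) ℝ := ((g⁻¹ : SLR (2*n)) : Matrix (Fin (2*n)) (Fin (2*n)) ℝ)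
  refine ⟨1 + ∑ i, ∑ j, |M i j|, by positivity, fun a b T v hv l j => ?_⟩
  have h1 := hv.2 l
  set w := (g : Matrix (Fin (2*n)) (Fin (2*n)) ℝ).mulVec (v l)
  have hT : 0 < T := lt_of_le_of_lt (Real.sqrt_nonneg _) h1
  have hw : M.mulVec w = v l := by
    simp only [M, w, Matrix.mulVec_mulVec, ← Matrix.SpecialLinearGroup.coe_mul, inv_mul_cancel,
      Matrix.SpecialLinearGroup.coe_one, Matrix.one_mulVec]
  rw [← hw]
  calc |M.mulVec w j| = |∑ i, M j i * w i| := rfl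
    _ ≤ ∑ i, |M j i * w i| := Finset.abs_sum_le_sum_abs _ _
    _ ≤ ∑ i, |M j i| * T := by
        refine Finset.sum_le_sum fun i _ => ?_
        rw [abs_mul]
        exact mul_le_mul_of_nonneg_left ((abs_le_enorm2 w i).trans h1.le) (abs_nonneg _)
    _ = (∑ i, |M j i|) * T := by rw [Finset.sum_mul]
    _ ≤ _ := by
        gcongr
        have : ∑ i, |M j i| ≤ ∑ j, ∑ i, |M j i| :=
          Finset.single_le_sum (f := fun j => ∑ i, |M j i|) (fun i _ => by positivity) (Finset.mem_univ j)
        linarith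

theorem EgT_proj (n k : ℕ) (g : SLR (2*n)) (a b : Pairs k → ℝ) (κ : ℝ)
    (hκ : ∀ (a b : Pairs k → ℝ) (T : ℝ), ∀ v ∈ EgT n k g a b T, ∀ l j, |v l j| ≤ κ * T)
    (T : ℝ) (r : ℕ) (ι : Fin r → Fin k) (hι : Function.Injective ι) (x) (hx : x ∈ EgT n k g a b T) :
    (fun j => x (ι j)) ∈ SS n r (κ * T) (∑ p, (|a p| + |b p|)) := by
  refine ⟨fun l j => hκ a b T x hx _ _, fun i j hij => ?_⟩
  have hp : ∀ p : Pairs k, |symp n (x p.1.1) (x p.1.2)| ≤ ∑ p, (|a p| + |b p|) := by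
    intro p
    have h := hx.1 p
    have h2 : |a p| + |b p| ≤ ∑ p, (|a p| + |b p|) :=
      Finset.single_le_sum (f := fun p => |a p| + |b p|) (fun i _ => by positivity) (Finset.mem_univ p)
    refine le_trans ?_ h2
    rw [abs_le]
    have := neg_abs_le (a p); have := le_abs_self (b p); have := abs_nonneg (a p); have := abs_nonneg (b p)
    exact ⟨by linarith [h.1], by linarith [h.2]⟩
  dsimp only
  rcases lt_or_gt_of_ne (fun h => hij.ne (hι h) : ι i ≠ ι j) with h | h
  · exact hp ⟨(ι i, ι j), h⟩
  · rw [symp_anti, abs_neg]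
    exact hp ⟨(ι j, ι i), h⟩

theorem card_tsum {α : Type*} (O : Set α) (P : Set α) :
    ((Nat.card {v | v ∈ O ∧ v ∈ P} : ℕ) : ℝ) = (∑' v : O, P.indicator (fun _ => (1:ℝ≥0∞)) v.1).toReal := by
  have h1 : ∑' v : O, P.indicator (fun _ => (1:ℝ≥0∞)) v.1 = ∑' v : α, {v | v ∈ O ∧ v ∈ P}.indicator (fun _ => (1:ℝ≥0∞)) v := by
    rw [tsum_subtype O (fun v => P.indicator (fun _ => (1:ℝ≥0∞)) v)]
    refine tsum_congr fun v => ?_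
    rw [Set.indicator_indicator]; rfl
  rw [h1, ← tsum_subtype {v | v ∈ O ∧ v ∈ P} (fun _ => (1:ℝ≥0∞)), ENNReal.tsum_const]
  have e : ∀ x : ℕ∞, ((x.toNat : ℕ) : ℝ) = (x : ℝ≥0∞).toReal := fun x => by cases x <;> simp
  rw [mul_one, Nat.card]
  exact e _

/-- Proposition 5.7 (mean of the rank-`k` congruence Siegel transform): for
`2n ≥ (k/2)² + 3`, `N ∈ ℕ` and `v₀ ∈ ℤ^{2n}` with `gcd(v₀,N) = 1`,
`∫ S_{(v₀,N)}(χ_{E_{g,T}}) dμ_N = N^{-2nk} vol_{2nk}(E_{g,T})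
 + O_g(T^{2n(k-1) - (k-1)(k-2)})`. -/
theorem stmt12 (n k : ℕ) (hk : 1 ≤ k) (hn : 1 ≤ n)
    (hnk : ((k : ℝ)/2)^2 + 3 ≤ (2*n : ℝ))
    (N : ℕ) (hN : 0 < N) (v₀ : Fin (2*n) → ℤ)
    (hgcd : Int.gcd (Finset.univ.gcd v₀) (N : ℤ) = 1)
    (a b : Pairs k → ℝ) (hab : ∀ p, a p < b p) (g : SLR (2*n)) :
    ∀ μ : Measure (XspaceN (2*n) N), IsProbabilityMeasure μ →
      (∀ γ : SLR (2*n), Measure.map (fun x => γ • x) μ = μ) →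
      ∃ C > (0:ℝ), ∃ T0 > (0:ℝ), ∀ T ≥ T0,
        ∀ Φ : XspaceN (2*n) N → ℝ,
          (∀ h : SLR (2*n), Φ (QuotientGroup.mk h) =
            (Nat.card {v : Fin k → (Fin (2*n) → ℤ) |
              (∀ l j, (N : ℤ) ∣ (v l j - v₀ j)) ∧
              (fun i => (h : Matrix (Fin (2*n)) (Fin (2*n)) ℝ).mulVec
                (fun j => ((v i j : ℤ) : ℝ))) ∈ EgT n k g a b T} : ℝ)) →
          |(∫ x, Φ x ∂μ) - (1 / (N : ℝ) ^ (2*n*k)) * (volume (EgT n k g a b T)).toReal|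
            ≤ C * T ^ (((2*n*(k-1) : ℕ) : ℝ) - (((k-1)*(k-2) : ℕ) : ℝ)) := by
  intro μ hμ hinv
  have hc1 : k + 2 ≤ 2 * n := by
    have : (k:ℝ) + 2 ≤ 2 * n := by nlinarith [sq_nonneg ((k:ℝ) / 2 - 1)]
    exact_mod_cast this
  have hc2 : k - 1 ≤ n := by
    have : 2 * (k:ℝ) ≤ 2 * n + 2 := by nlinarith [sq_nonneg ((k:ℝ) / 2 - 2)]
    have : 2 * k ≤ 2 * n + 2 := by exact_mod_cast this
    omega
  obtain ⟨s, hs, hs'⟩ := exists_section (2*n) N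
  have hprob : IsProbabilityMeasure (μ.map s) := Measure.isProbabilityMeasure_map hs.aemeasurable
  obtain ⟨K, hK, hmain⟩ := main_id hk hc1 hN v₀ (μ.map s)
    (fun r O hO => nu_GInv μ hinv s hs hs' O hO)
  obtain ⟨κ, hκ0, hκ⟩ := EgT_bd n k g
  set K0 : ℝ := ∑ p, (|a p| + |b p|) with hK0
  have hK0n : 0 ≤ K0 := by positivity
  have hvol : ∀ r : ℕ, ∃ C : ℝ, 0 ≤ C ∧ (r < k → ∀ S : ℝ, 0 < S →
      volume (SS n r S K0) ≤ ENNReal.ofReal (C * S ^ (r * (2 * n + 1 - r)))) := by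
    intro r
    by_cases hr : r < k
    · obtain ⟨C, hC, h⟩ := SS_vol r n (by omega) K0 hK0n
      exact ⟨C, hC, fun _ => h⟩
    · exact ⟨0, le_rfl, fun h => absurd h hr⟩
  choose Cr hCr0 hCr using hvol
  set C1 : ℝ := ∑ r ∈ Finset.range k, Cr r * κ ^ (r * (2 * n + 1 - r)) with hC1
  have hC1n : 0 ≤ C1 := Finset.sum_nonneg fun r _ => mul_nonneg (hCr0 r) (by positivity)
  set e : ℕ := (k - 1) * (2 * n + 1 - (k - 1)) with he
  refine ⟨K.toReal * C1 + 1, by positivity, 1, one_pos, fun T hT Φ hΦ => ?_⟩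
  have hT0 : 0 < T := lt_of_lt_of_le one_pos hT
  have hexp : (((2*n*(k-1) : ℕ) : ℝ) - (((k-1)*(k-2) : ℕ) : ℝ)) = (e : ℝ) := by
    have : 2*n*(k-1) = e + (k-1)*(k-2) := by
      rcases Nat.lt_or_ge k 2 with h | h
      · have : k - 1 = 0 := by omega
        simp [he, this]
      · obtain ⟨q, rfl⟩ : ∃ q, k = q + 2 := ⟨k - 2, by omega⟩
        obtain ⟨t, ht⟩ : ∃ t, 2 * n = q + t := ⟨2 * n - q, by omega⟩
        have h1 : 2 * n + 1 - (q + 2 - 1) = t := by omega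
        have h2 : q + 2 - 1 = q + 1 := by omega
        rw [he, h1, h2, ht, Nat.add_sub_cancel]; ring
    rw [this]; push_cast; ring
  rw [hexp, Real.rpow_natCast]
  have hemono : ∀ r, r < k → r * (2 * n + 1 - r) ≤ e := by
    intro r hr
    obtain ⟨q, hq⟩ : ∃ q, k - 1 = r + q := ⟨k - 1 - r, by omega⟩
    obtain ⟨t, ht⟩ : ∃ t, n = r + q + t := ⟨n - (r + q), by omega⟩
    have h1 : 2 * n + 1 - r = r + 2 * q + 2 * t + 1 := by omega
    have h2 : 2 * n + 1 - (k - 1) = r + q + 2 * t + 1 := by omega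
    rw [he, h1, h2, hq]
    nlinarith [Nat.zero_le (q * q), Nat.zero_le (q * t), Nat.zero_le (q * r)]
  have hEm := EgT_meas n k g a b T
  obtain ⟨L, hL, hid⟩ := hmain (EgT n k g a b T) (ENNReal.ofReal (C1 * T ^ e)) hEm (by
    intro r hr ι hι
    refine ⟨SS n r (κ * T) K0, SS_meas _ _ _ _, fun x hx => EgT_proj n k g a b κ hκ T r ι hι x hx, ?_⟩
    refine (hCr r hr (κ * T) (by positivity)).trans (ENNReal.ofReal_le_ofReal ?_)
    rw [mul_pow, ← mul_assoc]
    refine mul_le_mul ?_ (pow_le_pow_right₀ hT (hemono r hr)) (by positivity) hC1n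
    exact Finset.single_le_sum (f := fun r => Cr r * κ ^ (r * (2 * n + 1 - r)))
      (fun r _ => mul_nonneg (hCr0 r) (by positivity)) (Finset.mem_range.2 hr))
  have hEfin : volume (EgT n k g a b T) ≠ ∞ := by
    have : EgT n k g a b T ⊆ bx (2*n) k (κ * T + 1) := fun v hv l j => by
      have := hκ a b T v hv l j
      linarith
    refine ne_top_of_le_ne_top ?_ (measure_mono this)
    rw [bx_vol]
    exact ENNReal.pow_ne_top ENNReal.ofReal_ne_top
  have hLfin : L ≠ ∞ := ne_top_of_le_ne_top (ENNReal.mul_ne_top hK ENNReal.ofReal_ne_top) hL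
  have hNinv : ((N:ℝ≥0∞) ^ (2*n*k))⁻¹ ≠ ∞ := by
    rw [ne_eq, ENNReal.inv_eq_top]
    exact pow_ne_zero _ (by exact_mod_cast hN.ne')
  set f : SLR (2*n) → ℝ≥0∞ := fun h => ∑' v : Oall k N v₀, (EgT n k g a b T).indicator (fun _ => (1:ℝ≥0∞)) (act h (castv v.1)) with hf
  have hfm : Measurable f := meas_sum (Oall k N v₀) _ hEm
  have hΦ' : ∀ x, Φ x = (f (s x)).toReal := by
    intro x
    have h1 := hΦ (s x)
    rw [hs' x] at h1
    rw [h1]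
    exact card_tsum (Oall k N v₀) {v | act (s x) (castv v) ∈ EgT n k g a b T}
  have hint : ∫⁻ x, f (s x) ∂μ = ((N:ℝ≥0∞) ^ (2*n*k))⁻¹ * volume (EgT n k g a b T) + L := by
    rw [← hid, lintegral_map hfm hs]
  have hΦint : ∫ x, Φ x ∂μ = (((N:ℝ≥0∞) ^ (2*n*k))⁻¹ * volume (EgT n k g a b T) + L).toReal := by
    rw [← hint]
    simp only [hΦ']
    refine integral_toReal (hfm.comp hs).aemeasurable ?_
    refine ae_lt_top (hfm.comp hs) ?_
    change ∫⁻ x, f (s x) ∂μ ≠ ∞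
    rw [hint]
    exact ENNReal.add_ne_top.2 ⟨ENNReal.mul_ne_top hNinv hEfin, hLfin⟩
  rw [hΦint, ENNReal.toReal_add (ENNReal.mul_ne_top hNinv hEfin) hLfin, ENNReal.toReal_mul, ENNReal.toReal_inv,
    ENNReal.toReal_pow, ENNReal.toReal_natCast, one_div, add_sub_cancel_left, abs_of_nonneg ENNReal.toReal_nonneg]
  have hL2 : L.toReal ≤ K.toReal * (C1 * T ^ e) := by
    have := ENNReal.toReal_mono (ENNReal.mul_ne_top hK ENNReal.ofReal_ne_top) hL
    rwa [ENNReal.toReal_mul, ENNReal.toReal_ofReal (by positivity)] at this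
  have : 0 ≤ T ^ e := by positivity
  linarith
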